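/- Fix a constant λ ≥ 0 and consider loop-weighted walk with weight λ per erased loop on ℤ^d. There exists d₀ = d₀(λ) such that for every dimension d ≥ d₀ there are constants A > 0 and D > 0 with: (1) the susceptibility diverges linearly at the critical point, i.e. χ_λ(z)·(z_c(λ) − z) → A·z_c(λ) as z ↑ z_c(λ); (2) for every δ < 1 one has c_n^λ = A·z_c(λ)^{−n}·(1 + O(n^{−δ})) as n → ∞; (3) the walk is diffusive: for every δ < 1, the mean-square displacement satisfies ⟨|ω_n|²⟩_n^λ = D·n·(1 + O(n^{−δ})) as n → ∞, where |·| denotes the Euclidean norm on ℤ^d. -/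

import Mathlib

open scoped ENNReal NNReal BigOperators Classical

noncomputable section

namespace LWW

/-- A point of the lattice ℤ^d. -/
abbrev Pt (d : ℕ) := Fin d → ℤ

/-- ℓ¹ distance on ℤ^d. -/
def dist1 {d : ℕ} (x y : Pt d) : ℕ := ∑ i, (x i - y i).natAbs

/-- Nearest-neighbour adjacency on ℤ^d. -/
def Adj {d : ℕ} (x y : Pt d) : Prop := dist1 x y = 1

/-- Auxiliary function for single loop erasure: scan the list, keeping the
self-avoiding prefix `pre`; when the first repeated vertex is met, return the
loop-erased list together with the removed loop. -/
def le1Aux {α : Type*} [DecidableEq α] : List α → List α → List α × Option (List α)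
  | pre, [] => (pre, none)
  | pre, x :: rest =>
    if x ∈ pre then
      (pre.takeWhile (fun y => y ≠ x) ++ x :: rest,
        some (pre.dropWhile (fun y => y ≠ x) ++ [x]))
    else le1Aux (pre ++ [x]) rest

/-- Single loop erasure LE¹. -/
def LE1 {α : Type*} [DecidableEq α] (l : List α) : List α := (le1Aux [] l).1

/-- The loop removed by a single loop erasure (if the list is not self-avoiding). -/
def removedLoop {α : Type*} [DecidableEq α] (l : List α) : Option (List α) := (le1Aux [] l).2

/-- Iterate single loop erasure (with fuel), collecting the multiset of removed loops. -/
def leAux {α : Type*} [DecidableEq α] : ℕ → List α → List α × Multiset (List α)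
  | 0, l => (l, 0)
  | n + 1, l =>
    match le1Aux ([] : List α) l with
    | (_, none) => (l, 0)
    | (l', some c) => ((leAux n l').1, c ::ₘ (leAux n l').2)

/-- Loop erasure LE. -/
def LE {α : Type*} [DecidableEq α] (l : List α) : List α := (leAux l.length l).1

/-- The multiset of loops removed by loop erasure. -/
def erasedLoops {α : Type*} [DecidableEq α] (l : List α) : Multiset (List α) :=
  (leAux l.length l).2

/-- The number of loops removed by loop erasure. -/
def nLoops {α : Type*} [DecidableEq α] (l : List α) : ℕ := Multiset.card (erasedLoops l)

/-- A (finite) nearest-neighbour walk on ℤ^d, recorded as its (nonempty) list of vertices. -/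
structure Walk (d : ℕ) where
  pts : List (Pt d)
  ne : pts ≠ []
  chain : pts.Chain' Adj

namespace Walk

variable {d : ℕ}

/-- The number of steps of a walk. -/
def len (ω : Walk d) : ℕ := ω.pts.length - 1

/-- The initial vertex of a walk. -/
def start (ω : Walk d) : Pt d := ω.pts.headI

/-- The final vertex of a walk. -/
def finish (ω : Walk d) : Pt d := ω.pts.getLastD default

/-- The range (set of visited vertices) of a walk. -/
def range (ω : Walk d) : Set (Pt d) := {x | x ∈ ω.pts}

/-- The `i`-th vertex of a walk. -/
def nth (ω : Walk d) (i : ℕ) : Pt d := ω.pts.getD i default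

/-- A walk is a loop if it has at least one step and ends where it began. -/
def IsLoop (ω : Walk d) : Prop := 1 ≤ ω.len ∧ ω.finish = ω.start

end Walk

/-- The list of vertices of a self-avoiding polygon: a closed nearest-neighbour
walk all of whose vertices are distinct except that the last equals the first. -/
def IsSAPList {d : ℕ} (l : List (Pt d)) : Prop :=
  l.Chain' Adj ∧ 3 ≤ l.length ∧ l.getLastD default = l.headI ∧ l.dropLast.Nodup

/-- Change the initial vertex of a polygon list by a cyclic rotation. -/
def polyRot {d : ℕ} (l : List (Pt d)) (r : ℕ) : List (Pt d) :=
  l.dropLast.rotate r ++ [(l.dropLast.rotate r).headI]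

/-- An isometry of the lattice ℤ^d: a bijection preserving ℓ¹ distance. -/
def IsLatticeIso {d : ℕ} (R : Pt d ≃ Pt d) : Prop :=
  ∀ x y : Pt d, dist1 (R x) (R y) = dist1 x y

/-- The symmetry assumption on the loop activities: invariance under isometries of ℤ^d
and under change of initial vertex and of orientation of the polygon. -/
def SymmAssumption {d : ℕ} (lam : List (Pt d) → ℝ≥0) : Prop :=
  (∀ R : Pt d ≃ Pt d, IsLatticeIso R → ∀ l : List (Pt d), IsSAPList l →
      lam (l.map R) = lam l) ∧
  (∀ l : List (Pt d), IsSAPList l → ∀ r : ℕ, lam (polyRot l r) = lam l) ∧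
  (∀ l : List (Pt d), IsSAPList l → lam l.reverse = lam l)

/-- The boundedness assumption: sup over self-avoiding polygons of the activity is finite. -/
def BoundedAssumption {d : ℕ} (lam : List (Pt d) → ℝ≥0) : Prop :=
  ∃ M : ℝ≥0, ∀ l : List (Pt d), IsSAPList l → lam l ≤ M

/-- The product of the loop activities over the loops erased from `ω`, i.e. λ^{n_L(ω)}. -/
def wt0 {d : ℕ} (lam : List (Pt d) → ℝ≥0) (ω : Walk d) : ℝ≥0∞ :=
  ((erasedLoops ω.pts).map (fun η => (lam η : ℝ≥0∞))).prod

/-- The λ-LWW weight w_{λ,z}(ω) = z^{|ω|} λ^{n_L(ω)}. -/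
def wt {d : ℕ} (lam : List (Pt d) → ℝ≥0) (z : ℝ≥0) (ω : Walk d) : ℝ≥0∞ :=
  (z : ℝ≥0∞) ^ ω.len * wt0 lam ω

/-- The λ-LWW two-point function. -/
def G {d : ℕ} (lam : List (Pt d) → ℝ≥0) (z : ℝ≥0) (x y : Pt d) : ℝ≥0∞ :=
  ∑' ω : Walk d, if ω.start = x ∧ ω.finish = y then wt lam z ω else 0

/-- The λ-LWW loop measure μ_{λ,z}(A;B). -/
def mu {d : ℕ} (lam : List (Pt d) → ℝ≥0) (z : ℝ≥0) (A B : Set (Pt d)) : ℝ≥0∞ :=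
  ∑' ω : Walk d,
    if ω.IsLoop ∧ (ω.range ∩ A).Nonempty ∧ ω.range ∩ B = ∅
    then wt lam z ω / (ω.len : ℝ≥0∞) else 0

/-- The generalized λ-LWW loop measure μ_{λ,z}(A,B;C) with two hitting sets. -/
def mu2 {d : ℕ} (lam : List (Pt d) → ℝ≥0) (z : ℝ≥0) (A B C : Set (Pt d)) : ℝ≥0∞ :=
  ∑' ω : Walk d,
    if ω.IsLoop ∧ (ω.range ∩ A).Nonempty ∧ (ω.range ∩ B).Nonempty ∧ ω.range ∩ C = ∅
    then wt lam z ω / (ω.len : ℝ≥0∞) else 0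

/-- exp : [0,∞] → [0,∞] with exp(∞) = ∞. -/
def eexp (x : ℝ≥0∞) : ℝ≥0∞ := if x = ⊤ then ⊤ else ENNReal.ofReal (Real.exp x.toReal)

/-- The loop-erased λ-LWW weight w̄_{λ,z}(η) of a self-avoiding walk η. -/
def wbar {d : ℕ} (lam : List (Pt d) → ℝ≥0) (z : ℝ≥0) (η : Walk d) : ℝ≥0∞ :=
  ∑' ω : Walk d, if LE ω.pts = η.pts then wt lam z ω else 0

/-- c_n^λ : the total λ-LWW mass of n-step walks started at the origin. -/
def cN {d : ℕ} (lam : List (Pt d) → ℝ≥0) (n : ℕ) : ℝ≥0∞ :=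
  ∑' ω : Walk d, if ω.start = 0 ∧ ω.len = n then wt0 lam ω else 0

/-- The susceptibility χ_λ(z) = Σ_n c_n^λ z^n. -/
def chi {d : ℕ} (lam : List (Pt d) → ℝ≥0) (z : ℝ) : ℝ≥0∞ :=
  ∑' n : ℕ, cN lam n * ENNReal.ofReal z ^ n

/-- The critical point z_c(λ): the radius of convergence of the susceptibility
(for a power series with nonnegative coefficients this is the supremum of the
set of nonnegative z at which the series converges). -/
def zc {d : ℕ} (lam : List (Pt d) → ℝ≥0) : ℝ :=
  sSup {z : ℝ | 0 ≤ z ∧ chi lam z < ⊤}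


/-- The squared Euclidean norm of a lattice point, in `[0,∞]`. -/
def sqNormE {d : ℕ} (x : Pt d) : ℝ≥0∞ := ∑ i, ((x i).natAbs : ℝ≥0∞) ^ 2

/-- The (unnormalized) mean-square displacement: the λ-weighted sum of `|ω_n|²` over
`n`-step walks started at the origin. -/
def msd {d : ℕ} (lam : List (Pt d) → ℝ≥0) (n : ℕ) : ℝ≥0∞ :=
  ∑' ω : Walk d, if ω.start = 0 ∧ ω.len = n then sqNormE ω.finish * wt0 lam ω else 0

/-- The mean-square displacement `⟨|ω_n|²⟩_n^λ` of `n`-step λ-LWW. -/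
def meanSq {d : ℕ} (lam : List (Pt d) → ℝ≥0) (n : ℕ) : ℝ :=
  (msd lam n / cN lam n).toReal

/-- Constant loop activities: weight `λ` per erased loop. -/
def constLam (d : ℕ) (lam : ℝ) : List (Pt d) → ℝ≥0 := fun _ => lam.toNNReal

section Rho
open PowerSeries

/-- A submultiplicative extended seminorm on a commutative ring. -/
class L1 (R : Type*) [CommRing R] where
  nm : R → ℝ≥0∞
  nm_zero : nm 0 = 0
  nm_add : ∀ a b, nm (a + b) ≤ nm a + nm b
  nm_mul : ∀ a b, nm (a * b) ≤ nm a * nm b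
  nm_neg : ∀ a, nm (-a) = nm a
  nm_one : nm 1 = 1

open L1

instance : L1 ℝ where
  nm a := ‖a‖ₑ
  nm_zero := by simp
  nm_add a b := enorm_add_le a b
  nm_mul a b := by simp [enorm_mul]
  nm_neg a := by simp
  nm_one := by simp

theorem nm_real (a : ℝ) : nm a = ‖a‖ₑ := rfl

theorem nm_sum_le {R : Type*} [CommRing R] [L1 R] {ι : Type*} (s : Finset ι) (f : ι → R) :
    nm (∑ i ∈ s, f i) ≤ ∑ i ∈ s, nm (f i) := by
  induction s using Finset.induction_on with
  | empty => simp [nm_zero]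
  | insert a s ha ih =>
    rw [Finset.sum_insert ha, Finset.sum_insert ha]
    exact (nm_add _ _).trans (by gcongr)

/-- The weighted ℓ¹ norm of a power series. -/
def rho {R : Type*} [CommRing R] [L1 R] (u : ℕ → ℝ≥0∞) (F : PowerSeries R) : ℝ≥0∞ :=
  ∑' n, u n * nm (coeff n F)

variable {R : Type*} [CommRing R] [L1 R]

theorem rho_zero (u : ℕ → ℝ≥0∞) : rho u (0 : PowerSeries R) = 0 := by
  simp [rho, nm_zero]

theorem rho_add_le (u : ℕ → ℝ≥0∞) (F H : PowerSeries R) : rho u (F + H) ≤ rho u F + rho u H := by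
  unfold rho
  rw [← ENNReal.tsum_add]
  refine ENNReal.tsum_le_tsum fun n => ?_
  rw [map_add, ← mul_add]
  gcongr
  exact nm_add _ _

theorem rho_neg (u : ℕ → ℝ≥0∞) (F : PowerSeries R) : rho u (-F) = rho u F := by
  simp [rho, nm_neg]

theorem rho_sub_le (u : ℕ → ℝ≥0∞) (F H : PowerSeries R) : rho u (F - H) ≤ rho u F + rho u H := by
  rw [sub_eq_add_neg, ← rho_neg u H]
  exact rho_add_le _ _ _

theorem rho_sum_le (u : ℕ → ℝ≥0∞) {ι : Type*} (s : Finset ι) (f : ι → PowerSeries R) :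
    rho u (∑ i ∈ s, f i) ≤ ∑ i ∈ s, rho u (f i) := by
  induction s using Finset.induction_on with
  | empty => simp [rho_zero]
  | insert a s ha ih =>
    rw [Finset.sum_insert ha, Finset.sum_insert ha]
    exact (rho_add_le _ _ _).trans (by gcongr)

theorem rho_mono_weight {u v : ℕ → ℝ≥0∞} (h : ∀ n, u n ≤ v n) (F : PowerSeries R) :
    rho u F ≤ rho v F :=
  ENNReal.tsum_le_tsum fun n => by gcongr; exact h n

theorem tsum_antidiagonal (f : ℕ × ℕ → ℝ≥0∞) :
    ∑' n, ∑ p ∈ Finset.HasAntidiagonal.antidiagonal n, f p = ∑' p, f p := by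
  rw [← (Finset.HasAntidiagonal.sigmaAntidiagonalEquivProd).tsum_eq f, ENNReal.tsum_sigma']
  refine tsum_congr fun n => ?_
  rw [← Finset.tsum_subtype]
  rfl

theorem rho_mul_le {u u₁ u₂ : ℕ → ℝ≥0∞} {F H : PowerSeries R}
    (h : ∀ a b, coeff a F ≠ 0 → u (a + b) ≤ u₁ a * u₂ b) :
    rho u (F * H) ≤ rho u₁ F * rho u₂ H := by
  unfold rho
  calc ∑' n, u n * nm (coeff n (F * H))
      ≤ ∑' n, ∑ p ∈ Finset.HasAntidiagonal.antidiagonal n,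
          (u₁ p.1 * nm (coeff p.1 F)) * (u₂ p.2 * nm (coeff p.2 H)) := by
        refine ENNReal.tsum_le_tsum fun n => ?_
        rw [coeff_mul]
        calc _ ≤ u n * ∑ p ∈ Finset.HasAntidiagonal.antidiagonal n, nm (coeff p.1 F) * nm (coeff p.2 H) := by
              gcongr
              exact (nm_sum_le _ _).trans (Finset.sum_le_sum fun p _ => nm_mul _ _)
          _ ≤ _ := by
              rw [Finset.mul_sum]
              refine Finset.sum_le_sum fun p hp => ?_
              rw [Finset.HasAntidiagonal.mem_antidiagonal] at hp
              by_cases h0 : coeff p.1 F = 0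
              · simp [h0, nm_zero]
              · calc _ ≤ (u₁ p.1 * u₂ p.2) * (nm (coeff p.1 F) * nm (coeff p.2 H)) := by
                      gcongr
                      rw [← hp]
                      exact h _ _ h0
                  _ = _ := by ring
    _ = ∑' p : ℕ × ℕ, (u₁ p.1 * nm (coeff p.1 F)) * (u₂ p.2 * nm (coeff p.2 H)) :=
        tsum_antidiagonal _
    _ = _ := by
        rw [ENNReal.tsum_prod']
        simp_rw [ENNReal.tsum_mul_left, ENNReal.tsum_mul_right]

/-- Polynomially tilted geometric weights. -/
def wz (p : ℕ) (z : ℝ≥0) (m : ℕ) : ℝ≥0∞ := (1 + m : ℝ≥0∞) ^ p * (z : ℝ≥0∞) ^ m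

/-- Truncation of a weight. -/
def trunc (n : ℕ) (u : ℕ → ℝ≥0∞) (m : ℕ) : ℝ≥0∞ := if m < n then u m else 0

/-- Submultiplicative weights. -/
def SubM (u : ℕ → ℝ≥0∞) : Prop := ∀ a b, u (a + b) ≤ u a * u b

theorem wz_subM (p : ℕ) (z : ℝ≥0) : SubM (wz p z) := by
  intro a b
  unfold wz
  calc _ ≤ ((1 + a : ℝ≥0∞) * (1 + b)) ^ p * (z : ℝ≥0∞) ^ (a + b) := by
        gcongr
        push_cast
        calc (1 + (a + b) : ℝ≥0∞) ≤ 1 + (a + b) + a * b := le_self_add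
          _ = _ := by ring
    _ = _ := by rw [mul_pow, pow_add]; ring

theorem trunc_le (n : ℕ) (u : ℕ → ℝ≥0∞) (m : ℕ) : trunc n u m ≤ u m := by
  unfold trunc; split_ifs <;> simp

theorem rho_mul_le' {u : ℕ → ℝ≥0∞} (hu : SubM u) (F H : PowerSeries R) :
    rho u (F * H) ≤ rho u F * rho u H := rho_mul_le fun a b _ => hu a b

theorem rho_trunc_mul_le {u : ℕ → ℝ≥0∞} (hu : SubM u) (n : ℕ) (F H : PowerSeries R) :
    rho (trunc n u) (F * H) ≤ rho (trunc n u) F * rho (trunc n u) H := rho_mul_le fun a b _ => by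
  unfold trunc
  split_ifs <;> first | exact hu a b | omega | simp

theorem rho_trunc_le (n : ℕ) (u : ℕ → ℝ≥0∞) (F : PowerSeries R) :
    rho (trunc n u) F ≤ rho u F := rho_mono_weight (trunc_le n u) F

theorem rho_trunc_succ_mul_le {u : ℕ → ℝ≥0∞} (hu : SubM u) (n : ℕ) (F H : PowerSeries R)
    (h0 : X ∣ F) :
    rho (trunc (n + 1) u) (F * H) ≤ rho u F * rho (trunc n u) H := rho_mul_le fun a b ha => by
  have : a ≠ 0 := by
    rintro rfl
    rw [X_dvd_iff] at h0
    exact ha (by simpa using h0)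
  unfold trunc
  split_ifs <;> first | exact hu a b | omega | simp

theorem rho_trunc_zero (u : ℕ → ℝ≥0∞) (F : PowerSeries R) : rho (trunc 0 u) F = 0 := by
  simp [rho, trunc]

theorem rho_trunc_of_dvd {n : ℕ} (u : ℕ → ℝ≥0∞) {F : PowerSeries R} (h : X ^ n ∣ F) :
    rho (trunc n u) F = 0 := by
  rw [X_pow_dvd_iff] at h
  simp only [rho, trunc, ENNReal.tsum_eq_zero]
  intro m
  split_ifs with hm
  · simp [h m hm, nm_zero]
  · simp

theorem rho_le_of_trunc {u : ℕ → ℝ≥0∞} {F : PowerSeries R} {K : ℝ≥0∞}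
    (h : ∀ n, rho (trunc n u) F ≤ K) : rho u F ≤ K := by
  unfold rho
  refine ENNReal.tsum_le_of_sum_range_le fun n => le_trans ?_ (h n)
  refine le_trans (Finset.sum_le_sum fun i hi => ?_) (ENNReal.sum_le_tsum (Finset.range n))
  rw [trunc, if_pos (Finset.mem_range.1 hi)]

theorem rho_C_one (u : ℕ → ℝ≥0∞) (a : R) : rho u (C a) = u 0 * nm a := by
  unfold rho
  rw [tsum_eq_single 0]
  · simp
  · intro n hn; simp [coeff_C, hn, nm_zero]

theorem rho_X_mul (u : ℕ → ℝ≥0∞) (F : PowerSeries R) :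
    rho u (X * F) = rho (fun n => u (n + 1)) F := by
  unfold rho
  rw [tsum_eq_zero_add' ENNReal.summable]
  simp [coeff_succ_X_mul, nm_zero]

theorem rho_X (u : ℕ → ℝ≥0∞) : rho u (X : PowerSeries R) = u 1 := by
  have := rho_X_mul u (C (1 : R))
  simp only [map_one, mul_one] at this
  rw [this, ← map_one C, rho_C_one]
  simp [nm_one]

theorem rho_X_mul_le {u : ℕ → ℝ≥0∞} (hu : SubM u) (F : PowerSeries R) :
    rho u (X * F) ≤ u 1 * rho u F := by
  rw [← rho_X (R := R) u]
  exact rho_mul_le' hu _ _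

/-- Coefficientwise nonnegativity. -/
def NN (f : PowerSeries ℝ) : Prop := ∀ n, 0 ≤ coeff n f

/-- Coefficientwise order. -/
def cle (f g : PowerSeries ℝ) : Prop := ∀ n, coeff n f ≤ coeff n g

theorem cle.refl (f : PowerSeries ℝ) : cle f f := fun _ => le_rfl
theorem cle.trans {f g h : PowerSeries ℝ} (h₁ : cle f g) (h₂ : cle g h) : cle f h :=
  fun n => (h₁ n).trans (h₂ n)
theorem cle_iff {f g : PowerSeries ℝ} : cle f g ↔ NN (g - f) := by
  simp [cle, NN]
theorem NN_zero : NN 0 := fun n => by simp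
theorem NN_one : NN 1 := fun n => by rw [coeff_one]; split_ifs <;> simp
theorem NN_X : NN X := fun n => by rw [coeff_X]; split_ifs <;> simp
theorem NN_C {a : ℝ} (h : 0 ≤ a) : NN (C a) := fun n => by
  rw [coeff_C]; split_ifs <;> simp [h]
theorem NN.add {f g : PowerSeries ℝ} (hf : NN f) (hg : NN g) : NN (f + g) := fun n => by
  rw [map_add]; exact add_nonneg (hf n) (hg n)
theorem NN.mul {f g : PowerSeries ℝ} (hf : NN f) (hg : NN g) : NN (f * g) := fun n => by
  rw [coeff_mul]; exact Finset.sum_nonneg fun p _ => mul_nonneg (hf _) (hg _)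
theorem NN.pow {f : PowerSeries ℝ} (hf : NN f) (k : ℕ) : NN (f ^ k) := by
  induction k with
  | zero => simpa using NN_one
  | succ k ih => rw [pow_succ]; exact ih.mul hf
theorem NN_sum {ι : Type*} {s : Finset ι} {f : ι → PowerSeries ℝ} (h : ∀ i ∈ s, NN (f i)) :
    NN (∑ i ∈ s, f i) := fun n => by
  rw [map_sum]; exact Finset.sum_nonneg fun i hi => h i hi n
theorem cle.add {f g f' g' : PowerSeries ℝ} (h : cle f g) (h' : cle f' g') :
    cle (f + f') (g + g') := fun n => by
  rw [map_add, map_add]; exact add_le_add (h n) (h' n)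
theorem cle.mul_left {f g h : PowerSeries ℝ} (hfg : cle f g) (hh : NN h) :
    cle (h * f) (h * g) := by
  rw [cle_iff, ← mul_sub]; exact hh.mul (cle_iff.1 hfg)
theorem cle.mul_right {f g h : PowerSeries ℝ} (hfg : cle f g) (hh : NN h) :
    cle (f * h) (g * h) := by
  rw [cle_iff, ← sub_mul]; exact (cle_iff.1 hfg).mul hh
theorem cle_sum {ι : Type*} {s : Finset ι} {f g : ι → PowerSeries ℝ}
    (h : ∀ i ∈ s, cle (f i) (g i)) : cle (∑ i ∈ s, f i) (∑ i ∈ s, g i) := fun n => by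
  rw [map_sum, map_sum]; exact Finset.sum_le_sum fun i hi => h i hi n

theorem rho_mono {f g : PowerSeries ℝ} (u : ℕ → ℝ≥0∞) (hf : NN f) (h : cle f g) :
    rho u f ≤ rho u g := by
  refine ENNReal.tsum_le_tsum fun n => ?_
  gcongr
  rw [nm_real, nm_real, Real.enorm_eq_ofReal (hf n), Real.enorm_eq_ofReal ((hf n).trans (h n))]
  exact ENNReal.ofReal_le_ofReal (h n)

theorem rho_add (u : ℕ → ℝ≥0∞) {f g : PowerSeries ℝ} (hf : NN f) (hg : NN g) :
    rho u (f + g) = rho u f + rho u g := by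
  unfold rho
  rw [← ENNReal.tsum_add]
  refine tsum_congr fun n => ?_
  rw [map_add, ← mul_add]
  simp only [nm_real]
  rw [Real.enorm_eq_ofReal (hf n), Real.enorm_eq_ofReal (hg n),
    Real.enorm_eq_ofReal (add_nonneg (hf n) (hg n)), ENNReal.ofReal_add (hf n) (hg n)]

theorem rho_sum (u : ℕ → ℝ≥0∞) {ι : Type*} (s : Finset ι) {f : ι → PowerSeries ℝ}
    (h : ∀ i ∈ s, NN (f i)) : rho u (∑ i ∈ s, f i) = ∑ i ∈ s, rho u (f i) := by
  induction s using Finset.induction_on with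
  | empty => simp [rho_zero]
  | insert a s ha ih =>
    rw [Finset.sum_insert ha, Finset.sum_insert ha,
      rho_add u (h a (by simp)) (NN_sum fun i hi => h i (by simp [hi])),
      ih fun i hi => h i (by simp [hi])]

theorem rho_C_mul (u : ℕ → ℝ≥0∞) (a : ℝ) (f : PowerSeries ℝ) :
    rho u (C a * f) = ‖a‖ₑ * rho u f := by
  unfold rho
  rw [← ENNReal.tsum_mul_left]
  refine tsum_congr fun n => ?_
  rw [coeff_C_mul, nm_real, nm_real, enorm_mul]
  ring

end Rho

section LoopCount

variable {α : Type*} [DecidableEq α]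

/-- The part of a stack lying strictly below the first occurrence of `y`. -/
def popTo (y : α) : List α → List α
  | [] => []
  | a :: s => if a = y then s else popTo y s

/-- Number of loops erased while reading a list, starting from a given stack. -/
def cnt : List α → List α → ℕ
  | _, [] => 0
  | s, y :: r => if y ∈ s then cnt (y :: popTo y s) r + 1 else cnt (y :: s) r

theorem le1Aux_append (q pre rest : List α) (h : (q ++ pre).Nodup) :
    le1Aux q (pre ++ rest) = le1Aux (q ++ pre) rest := by
  induction pre generalizing q with
  | nil => simp
  | cons a pre ih =>
    have ha : a ∉ q := by
      intro hq
      rw [List.nodup_append] at h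
      exact h.2.2 a hq a (by simp) rfl
    simp only [List.cons_append, le1Aux, if_neg ha]
    rw [ih (q ++ [a]) (by simpa using h)]
    simp

theorem takeWhile_popTo (y : α) (s : List α) (hs : s.Nodup) (hy : y ∈ s) :
    s.reverse.takeWhile (fun z => z ≠ y) = (popTo y s).reverse := by
  induction s with
  | nil => simp at hy
  | cons a s ih =>
    rw [List.nodup_cons] at hs
    simp only [popTo, List.reverse_cons]
    by_cases ha : a = y
    · subst ha
      rw [if_pos rfl, List.takeWhile_append_of_pos]
      · simp
      · intro z hz
        simp only [List.mem_reverse] at hz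
        simp only [ne_eq, decide_not, Bool.not_eq_eq_eq_not, Bool.not_true, decide_eq_false_iff_not]
        rintro rfl
        exact hs.1 hz
    · have hy' : y ∈ s := by
        rcases List.mem_cons.1 hy with h | h
        · exact absurd h.symm ha
        · exact h
      rw [if_neg ha, ← ih hs.2 hy', List.takeWhile_append]
      rw [if_neg]
      intro hlen
      have : s.reverse.takeWhile (fun z => decide (z ≠ y)) = s.reverse :=
        (List.takeWhile_prefix _).eq_of_length hlen
      rw [List.takeWhile_eq_self_iff] at this
      simpa using this y (by simpa using hy')

theorem popTo_sublist (y : α) (s : List α) : (popTo y s).Sublist s := by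
  induction s with
  | nil => simp [popTo]
  | cons a s ih =>
    simp only [popTo]
    split_ifs
    · exact List.sublist_cons_self a s
    · exact ih.trans (List.sublist_cons_self a s)

theorem notMem_popTo (y : α) (s : List α) (hs : s.Nodup) : y ∉ popTo y s := by
  induction s with
  | nil => simp [popTo]
  | cons a s ih =>
    rw [List.nodup_cons] at hs
    simp only [popTo]
    split_ifs with h
    · subst h; exact hs.1
    · exact ih hs.2

theorem card_leAux (rest pre : List α) (fuel : ℕ) (h : pre.Nodup) (hf : rest.length ≤ fuel) :
    Multiset.card (leAux fuel (pre ++ rest)).2 = cnt pre.reverse rest := by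
  induction rest generalizing pre fuel with
  | nil =>
    cases fuel with
    | zero => simp [leAux, cnt]
    | succ n =>
      have : le1Aux [] pre = (pre, none) := by
        have := le1Aux_append [] pre [] (by simpa using h)
        simpa [le1Aux] using this
      simp [leAux, this, cnt]
  | cons y rest ih =>
    by_cases hy : y ∈ pre
    · obtain ⟨m, rfl⟩ : ∃ m, fuel = m + 1 := ⟨fuel - 1, by simp at hf; omega⟩
      have h1 := le1Aux_append [] pre (y :: rest) (by simpa using h)
      have hp := takeWhile_popTo y pre.reverse (by simpa using h) (by simpa using hy)
      rw [List.reverse_reverse] at hp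
      have hnd : ((popTo y pre.reverse).reverse ++ [y]).Nodup := by
        rw [← List.nodup_reverse, List.reverse_append]
        simp only [List.reverse_cons, List.reverse_nil, List.nil_append, List.reverse_reverse,
          List.singleton_append, List.nodup_cons]
        exact ⟨notMem_popTo _ _ (by simpa using h),
          (popTo_sublist _ _).nodup (by simpa using h)⟩
      simp only [le1Aux, List.nil_append, if_pos hy] at h1
      simp only [leAux, h1, Multiset.card_cons, cnt, List.mem_reverse, if_pos hy]
      rw [hp]
      have := ih _ m hnd (by simp at hf; omega)
      simp only [List.append_assoc, List.singleton_append, List.reverse_append,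
        List.reverse_reverse, List.reverse_cons, List.reverse_nil, List.nil_append] at this
      rw [this]
    · have := ih (pre ++ [y]) fuel (by
        rw [List.nodup_append]
        refine ⟨h, by simp, ?_⟩
        intro a ha b hb hab
        simp at hb
        subst hb; subst hab
        exact hy ha) (by simp at hf; omega)
      simp only [List.append_assoc, List.singleton_append, List.reverse_append,
        List.reverse_cons, List.reverse_nil, List.nil_append] at this
      simp only [cnt, List.mem_reverse, if_neg hy]
      rw [this]

theorem nLoops_cons (x : α) (l : List α) : nLoops (x :: l) = cnt [x] l := by
  have := card_leAux l [x] (x :: l).length (by simp) (by simp)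
  simpa [nLoops, erasedLoops] using this

end LoopCount

section Steps

variable {d : ℕ}

/-- The steps of nearest-neighbour walks. -/
abbrev Stp (d : ℕ) := Fin d × Bool

/-- The displacement of a step. -/
def stp (e : Stp d) : Pt d := Pi.single e.1 (if e.2 then 1 else -1)

/-- The reversed step. -/
def nst (e : Stp d) : Stp d := (e.1, !e.2)

theorem stp_nst (e : Stp d) : stp (nst e) = -stp e := by
  obtain ⟨i, b⟩ := e
  cases b <;> simp [stp, nst, ← Pi.single_neg]

theorem nst_nst (e : Stp d) : nst (nst e) = e := by simp [nst]

/-- Reversal of steps as a permutation. -/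
def nstEquiv : Stp d ≃ Stp d := ⟨nst, nst, nst_nst, nst_nst⟩

theorem stp_injective : Function.Injective (stp : Stp d → Pt d) := by
  rintro ⟨i, b⟩ ⟨j, c⟩ h
  simp only [stp] at h
  have hi := congrFun h i
  by_cases hij : i = j
  · subst hij
    cases b <;> cases c <;> simp_all
  · rw [Pi.single_eq_same, Pi.single_eq_of_ne hij] at hi
    cases b <;> simp at hi

theorem stp_ne_zero (e : Stp d) : stp e ≠ 0 := by
  obtain ⟨i, b⟩ := e
  intro h
  have := congrFun h i
  cases b <;> simp [stp] at this

theorem dist1_add_stp (x : Pt d) (e : Stp d) : dist1 x (x + stp e) = 1 := by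
  obtain ⟨i, b⟩ := e
  unfold dist1
  rw [Finset.sum_eq_single i]
  · cases b <;> simp [stp]
  · intro j _ hj
    simp [stp, Pi.single_eq_of_ne hj]
  · simp

theorem adj_iff (x y : Pt d) : Adj x y ↔ ∃ e : Stp d, y = x + stp e := by
  constructor
  · intro h
    unfold Adj dist1 at h
    obtain ⟨i, _, hi⟩ : ∃ i ∈ Finset.univ, (x i - y i).natAbs ≠ 0 := by
      by_contra! hc
      rw [Finset.sum_eq_zero hc] at h
      omega
    rw [← Finset.add_sum_erase _ _ (Finset.mem_univ i)] at h
    have hi1 : (x i - y i).natAbs = 1 := by omega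
    have h0 : ∑ j ∈ Finset.univ.erase i, (x j - y j).natAbs = 0 := by omega
    rw [Finset.sum_eq_zero_iff] at h0
    refine ⟨(i, decide (y i - x i = 1)), ?_⟩
    ext j
    by_cases hj : j = i
    · subst hj
      simp only [stp, Pi.add_apply, Pi.single_eq_same]
      split_ifs with hh <;> simp at hh <;> omega
    · have := h0 j (by simp [hj])
      simp only [stp, Pi.add_apply, Pi.single_eq_of_ne hj]
      omega
  · rintro ⟨e, rfl⟩
    exact dist1_add_stp x e

end Steps

section WalkSum

variable {d : ℕ}

/-- Sum of a functional over the `n`-step walks started at `x`. -/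
def WS : ℕ → Pt d → (List (Pt d) → ℝ≥0∞) → ℝ≥0∞
  | 0, x, F => F [x]
  | n + 1, x, F => ∑ e : Stp d, WS n (x + stp e) (fun l => F (x :: l))

theorem tsum_list {α : Type*} (f : List α → ℝ≥0∞) :
    ∑' l, f l = f [] + ∑' a, ∑' l, f (a :: l) := by
  let E : Unit ⊕ (α × List α) ≃ List α :=
    { toFun := fun o => o.elim (fun _ => []) (fun p => p.1 :: p.2)
      invFun := fun l => match l with | [] => .inl () | a :: l => .inr (a, l)
      left_inv := by rintro (_ | ⟨a, l⟩) <;> rfl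
      right_inv := by rintro (_ | ⟨a, l⟩) <;> rfl }
  rw [← E.tsum_eq, ← ENNReal.tsum_prod (f := fun a l => f (a :: l))]
  refine (HasSum.sum (a := f []) (b := ∑' p : α × List α, f (p.1 :: p.2)) ?_ ?_).tsum_eq
  · exact hasSum_unique ((fun o => f (E o)) ∘ Sum.inl)
  · exact ENNReal.summable.hasSum

theorem tsum_list_eq_WS (n : ℕ) (x : Pt d) (F : List (Pt d) → ℝ≥0∞) :
    (∑' l : List (Pt d), if l.IsChain Adj ∧ l.headI = x ∧ l.length = n + 1 then F l else 0)
      = WS n x F := by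
  induction n generalizing x F with
  | zero =>
    rw [tsum_eq_single [x]]
    · simp [WS]
    · rintro l hl
      rw [if_neg]
      rintro ⟨-, h2, h3⟩
      obtain ⟨a, rfl⟩ := List.length_eq_one_iff.1 h3
      simp at h2
      subst h2
      exact hl rfl
  | succ n ih =>
    rw [tsum_list]
    simp only [List.length_nil, WS]
    rw [if_neg (by simp), zero_add, tsum_eq_single x]
    · simp_rw [← ih]
      rw [← Summable.tsum_finsetSum (fun i _ => ENNReal.summable)]
      refine tsum_congr fun l => ?_
      cases l with
      | nil => simp
      | cons y l =>
        simp only [List.isChain_cons_cons, List.headI_cons, List.length_cons, true_and]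
        by_cases hc : (y :: l).IsChain Adj ∧ l.length = n
        · by_cases ha : Adj x y
          · obtain ⟨e, rfl⟩ := (adj_iff x y).1 ha
            rw [Finset.sum_eq_single e]
            · simp [hc, ha]
            · intro b _ hb
              refine if_neg ?_
              rintro ⟨-, h, -⟩
              exact hb (stp_injective (add_left_cancel h)).symm
            · simp
          · rw [if_neg (by tauto), Finset.sum_eq_zero]
            intro e _
            refine if_neg ?_
            rintro ⟨-, h, -⟩
            exact ha ((adj_iff x y).2 ⟨e, h⟩)
        · rw [if_neg (by simp; tauto), Finset.sum_eq_zero]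
          intro e _
          refine if_neg ?_
          rintro ⟨h1, -, h3⟩
          exact hc ⟨h1, by omega⟩
    · intro y hy
      simp [hy]

theorem tsum_walk_eq_WS (n : ℕ) (x : Pt d) (F : List (Pt d) → ℝ≥0∞) :
    (∑' ω : Walk d, if ω.start = x ∧ ω.len = n then F ω.pts else 0) = WS n x F := by
  rw [← tsum_list_eq_WS]
  have hinj : Function.Injective (Walk.pts : Walk d → List (Pt d)) := by
    rintro ⟨a, _, _⟩ ⟨b, _, _⟩ h
    simpa using h
  rw [← hinj.tsum_eq]
  · refine tsum_congr fun ω => ?_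
    have h1 : 0 < ω.pts.length := List.length_pos_iff.2 ω.ne
    have h2 := ω.chain
    congr 1
    simp only [Walk.start, Walk.len, eq_iff_iff]
    constructor
    · rintro ⟨h, h'⟩; exact ⟨h2, h, by omega⟩
    · rintro ⟨-, h, h'⟩; exact ⟨h, by omega⟩
  · intro l hl
    simp only [Function.mem_support, ne_eq, ite_eq_right_iff, not_forall] at hl
    obtain ⟨⟨h1, -, h3⟩, -⟩ := hl
    exact ⟨⟨l, by rintro rfl; simp at h3, h1⟩, rfl⟩

end WalkSum

section Machine

variable {d : ℕ}

/-- The ring of finite real measures on the lattice. -/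
abbrev LA (d : ℕ) := AddMonoidAlgebra ℝ (Pt d)

/-- Weighted endpoint distribution of the loop-erasing stack machine with `n` steps to go, tip `x`,
lower stack `s`, killed on `C`. -/
def W (lam : ℝ) (C : Finset (Pt d)) : ℕ → Pt d → List (Pt d) → LA d
  | 0, x, _ => AddMonoidAlgebra.single x 1
  | n + 1, x, s => ∑ e : Stp d, if x + stp e ∈ C then 0 else
      if x + stp e ∈ s then lam • W lam C n (x + stp e) (popTo (x + stp e) s)
      else W lam C n (x + stp e) (x :: s)

theorem W_nonneg {lam : ℝ} (h : 0 ≤ lam) (C : Finset (Pt d)) (n : ℕ) (x : Pt d) (s : List (Pt d))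
    (v : Pt d) : 0 ≤ (W lam C n x s).coeff v := by
  induction n generalizing x s with
  | zero =>
    simp only [W, AddMonoidAlgebra.coeff_single, Finsupp.single_apply]
    split_ifs <;> simp
  | succ n ih =>
    simp only [W, AddMonoidAlgebra.coeff_sum, Finsupp.finsetSum_apply]
    refine Finset.sum_nonneg fun e _ => ?_
    split_ifs
    · simp
    · simpa using mul_nonneg h (ih _ _)
    · exact ih _ _

/-- Integral of a nonnegative functional. -/
def integ (φ : Pt d → ℝ≥0∞) (a : LA d) : ℝ≥0∞ := ∑' v, φ v * ENNReal.ofReal (a.coeff v)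

theorem integ_sum (φ : Pt d → ℝ≥0∞) {ι : Type*} (s : Finset ι) (f : ι → LA d)
    (h : ∀ i ∈ s, ∀ v, 0 ≤ (f i).coeff v) : integ φ (∑ i ∈ s, f i) = ∑ i ∈ s, integ φ (f i) := by
  unfold integ
  rw [← Summable.tsum_finsetSum (fun i _ => ENNReal.summable)]
  refine tsum_congr fun v => ?_
  rw [← Finset.mul_sum, AddMonoidAlgebra.coeff_sum, Finsupp.finsetSum_apply,
    ENNReal.ofReal_sum_of_nonneg fun i hi => h i hi v]

theorem integ_smul (φ : Pt d → ℝ≥0∞) {c : ℝ} (hc : 0 ≤ c) (a : LA d) :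
    integ φ (c • a) = ENNReal.ofReal c * integ φ a := by
  unfold integ
  rw [← ENNReal.tsum_mul_left]
  refine tsum_congr fun v => ?_
  simp only [AddMonoidAlgebra.coeff_smul, Finsupp.smul_apply, smul_eq_mul]
  rw [ENNReal.ofReal_mul hc]
  ring

theorem integ_single (φ : Pt d → ℝ≥0∞) (x : Pt d) : integ φ (AddMonoidAlgebra.single x 1) = φ x := by
  unfold integ
  rw [tsum_eq_single x]
  · simp
  · intro v hv
    simp [hv.symm]

theorem WS_congr (n : ℕ) (x : Pt d) {F F' : List (Pt d) → ℝ≥0∞}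
    (h : ∀ l, F (x :: l) = F' (x :: l)) : WS n x F = WS n x F' := by
  induction n generalizing x F F' with
  | zero => exact h []
  | succ n ih =>
    exact Finset.sum_congr rfl fun e _ => ih _ fun l => h _

theorem WS_mul (n : ℕ) (x : Pt d) (c : ℝ≥0∞) (F : List (Pt d) → ℝ≥0∞) :
    WS n x (fun l => c * F l) = c * WS n x F := by
  induction n generalizing x F with
  | zero => rfl
  | succ n ih =>
    simp only [WS]
    rw [Finset.mul_sum]
    exact Finset.sum_congr rfl fun e _ => ih _ _

theorem WS_eq_integ {lam : ℝ} (hl : 0 ≤ lam) (φ : Pt d → ℝ≥0∞) (n : ℕ) (x : Pt d)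
    (s : List (Pt d)) :
    WS n x (fun l => φ (l.getLastD default) * ENNReal.ofReal lam ^ cnt (x :: s) l.tail)
      = integ φ (W lam ∅ n x s) := by
  induction n generalizing x s with
  | zero => simp [WS, W, cnt, integ_single, List.getLastD]
  | succ n ih =>
    simp only [WS, W]
    rw [integ_sum]
    swap
    · intro e _ v
      split_ifs
      · simp
      · simpa using mul_nonneg hl (W_nonneg hl _ _ _ _ _)
      · exact W_nonneg hl _ _ _ _ _
    refine Finset.sum_congr rfl fun e _ => ?_
    have hne : x ≠ x + stp e := by simpa using stp_ne_zero e
    simp only [Finset.notMem_empty, if_false]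
    split_ifs with h
    · rw [integ_smul _ hl, ← ih, ← WS_mul]
      refine WS_congr _ _ fun l => ?_
      simp only [List.tail_cons, cnt, List.mem_cons, h, or_true, if_true, popTo, if_neg hne]
      rw [pow_succ]
      simp only [List.getLastD_cons]
      ring
    · rw [← ih]
      refine WS_congr _ _ fun l => ?_
      simp only [List.tail_cons, cnt, List.mem_cons, h, or_false, if_neg hne.symm]
      simp only [List.getLastD_cons]

theorem tsum_walk_eq_integ {lam : ℝ} (hl : 0 ≤ lam) (φ : Pt d → ℝ≥0∞) (n : ℕ) :
    (∑' ω : Walk d, if ω.start = 0 ∧ ω.len = n then φ ω.finish * wt0 (constLam d lam) ω else 0)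
      = integ φ (W lam ∅ n 0 []) := by
  rw [← WS_eq_integ hl, ← WS_congr (F := fun l => φ (l.getLastD default) *
    ENNReal.ofReal lam ^ nLoops l) _ _ fun l => by rw [nLoops_cons]; rfl, ← tsum_walk_eq_WS]
  refine tsum_congr fun ω => ?_
  congr 1
  simp [wt0, constLam, Walk.finish, nLoops, ENNReal.ofReal]

theorem cN_eq {lam : ℝ} (hl : 0 ≤ lam) (n : ℕ) :
    cN (constLam d lam) n = integ (fun _ => 1) (W (d := d) lam ∅ n 0 []) := by
  rw [← tsum_walk_eq_integ hl]
  simp [cN]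

theorem msd_eq {lam : ℝ} (hl : 0 ≤ lam) (n : ℕ) :
    msd (constLam d lam) n = integ sqNormE (W (d := d) lam ∅ n 0 []) := by
  rw [← tsum_walk_eq_integ hl]
  rfl

end Machine

section Machine

variable {d : ℕ} {lam : ℝ}

theorem integ_W_le (hl : 0 ≤ lam) (n : ℕ) (x : Pt d) (s : List (Pt d)) :
    integ (fun _ => 1) (W lam ∅ n x s) ≤ ENNReal.ofReal ((2 * d * max 1 lam) ^ n) := by
  induction n generalizing x s with
  | zero => simp [W, integ_single]
  | succ n ih =>
    have hterm : ∀ e : Stp d, integ (fun _ => 1)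
        (if x + stp e ∈ (∅ : Finset (Pt d)) then 0 else
          if x + stp e ∈ s then lam • W lam ∅ n (x + stp e) (popTo (x + stp e) s)
          else W lam ∅ n (x + stp e) (x :: s))
        ≤ ENNReal.ofReal (max 1 lam * (2 * d * max 1 lam) ^ n) := by
      intro e
      rw [ENNReal.ofReal_mul (by positivity)]
      simp only [Finset.notMem_empty, if_false]
      split_ifs
      · rw [integ_smul _ hl]
        exact mul_le_mul' (ENNReal.ofReal_le_ofReal (le_max_right _ _)) (ih _ _)
      · exact le_mul_of_one_le_of_le (by simp) (ih _ _)
    simp only [W]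
    rw [integ_sum]
    · refine (Finset.sum_le_sum fun e _ => hterm e).trans ?_
      rw [Finset.sum_const, Finset.card_univ, nsmul_eq_mul, ← ENNReal.ofReal_natCast,
        ← ENNReal.ofReal_mul (by positivity)]
      apply ENNReal.ofReal_le_ofReal
      simp only [Fintype.card_prod, Fintype.card_fin, Fintype.card_bool]
      push_cast
      rw [pow_succ]
      apply le_of_eq
      ring
    · intro e _ v
      split_ifs
      · simp
      · simpa using mul_nonneg hl (W_nonneg hl _ _ _ _ _)
      · exact W_nonneg hl _ _ _ _ _

theorem le_integ_W (hl : 0 ≤ lam) (n : ℕ) (x : Pt d) (s : List (Pt d))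
    (hs : ∀ y ∈ s, ∑ i, y i ≤ ∑ i, x i) :
    (d : ℝ≥0∞) ^ n ≤ integ (fun _ => 1) (W lam ∅ n x s) := by
  induction n generalizing x s with
  | zero => simp [W, integ_single]
  | succ n ih =>
    simp only [W]
    rw [integ_sum]
    · rw [Fintype.sum_prod_type]
      calc (d : ℝ≥0∞) ^ (n + 1) = ∑ i : Fin d, (d : ℝ≥0∞) ^ n := by
            simp [pow_succ, mul_comm]
        _ ≤ _ := Finset.sum_le_sum fun i _ => ?_
      refine le_trans ?_ (Finset.single_le_sum (fun _ _ => zero_le) (Finset.mem_univ true))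
      have hsum : ∑ j, (x + stp (i, true)) j = ∑ j, x j + 1 := by
        simp [stp, Finset.sum_add_distrib, Finset.sum_pi_single']
      have hnot : x + stp (i, true) ∉ s := fun h => by
        have := hs _ h
        omega
      simp only [Finset.notMem_empty, if_false, if_neg hnot]
      apply ih
      intro y hy
      rcases List.mem_cons.1 hy with rfl | h
      · omega
      · have := hs y h
        omega
    · intro e _ v
      split_ifs
      · simp
      · simpa using mul_nonneg hl (W_nonneg hl _ _ _ _ _)
      · exact W_nonneg hl _ _ _ _ _

theorem W_coeff_killed {C : Finset (Pt d)} {n : ℕ} {x : Pt d} {s : List (Pt d)} {v : Pt d}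
    (hv : v ∈ C) (hx : x ∉ C) : (W lam C n x s).coeff v = 0 := by
  induction n generalizing x s with
  | zero =>
    simp only [W, AddMonoidAlgebra.coeff_single]
    rw [Finsupp.single_apply, if_neg]
    rintro rfl; exact hx hv
  | succ n ih =>
    simp only [W, AddMonoidAlgebra.coeff_sum, Finsupp.finsetSum_apply]
    refine Finset.sum_eq_zero fun e _ => ?_
    split_ifs with h1 h2
    · simp
    · simp [ih h1]
    · exact ih h1

theorem W_anti (hl : 0 ≤ lam) {C C' : Finset (Pt d)} (h : C ⊆ C') (n : ℕ) (x : Pt d)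
    (s : List (Pt d)) (v : Pt d) : (W lam C' n x s).coeff v ≤ (W lam C n x s).coeff v := by
  induction n generalizing x s with
  | zero => simp [W]
  | succ n ih =>
    simp only [W, AddMonoidAlgebra.coeff_sum, Finsupp.finsetSum_apply]
    refine Finset.sum_le_sum fun e _ => ?_
    by_cases h1 : x + stp e ∈ C
    · simp [h1, h h1]
    · rw [if_neg h1]
      by_cases h3 : x + stp e ∈ C'
      · rw [if_pos h3]
        split_ifs
        · simpa using mul_nonneg hl (W_nonneg hl _ _ _ _ _)
        · simpa using W_nonneg hl _ _ _ _ _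
      · rw [if_neg h3]
        split_ifs
        · simpa using mul_le_mul_of_nonneg_left (ih _ _) hl
        · exact ih _ _

theorem W_submod (hl : 0 ≤ lam) (B : Finset (Pt d)) (a : Pt d) (n : ℕ) (x : Pt d)
    (s : List (Pt d)) (v : Pt d) :
    (W lam B n x s).coeff v - (W lam (insert a B) n x s).coeff v
      ≤ (W lam ∅ n x s).coeff v - (W lam {a} n x s).coeff v := by
  induction n generalizing x s with
  | zero => simp [W]
  | succ n ih =>
    simp only [W, AddMonoidAlgebra.coeff_sum, Finsupp.finsetSum_apply]
    rw [← Finset.sum_sub_distrib, ← Finset.sum_sub_distrib]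
    refine Finset.sum_le_sum fun e _ => ?_
    simp only [Finset.notMem_empty, if_false, Finset.mem_insert, Finset.mem_singleton]
    by_cases h1 : x + stp e ∈ B
    · simp only [h1, or_true, if_true, AddMonoidAlgebra.coeff_zero, Finsupp.coe_zero,
        Pi.zero_apply, sub_zero]
      rw [sub_nonneg]
      split_ifs
      · simpa using mul_nonneg hl (W_nonneg hl _ _ _ _ _)
      · simpa using W_nonneg hl _ _ _ _ _
      · simpa using mul_le_mul_of_nonneg_left (W_anti hl (Finset.empty_subset _) _ _ _ _) hl
      · exact W_anti hl (Finset.empty_subset _) _ _ _ _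
    · by_cases h2 : x + stp e = a
      · simp only [h2, true_or, if_true, AddMonoidAlgebra.coeff_zero, Finsupp.coe_zero,
          Pi.zero_apply, sub_zero]
        rw [h2] at h1
        simp only [h1, if_false]
        split_ifs
        · simpa using mul_le_mul_of_nonneg_left (W_anti hl (Finset.empty_subset _) _ _ _ _) hl
        · exact W_anti hl (Finset.empty_subset _) _ _ _ _
      · simp only [h1, h2, or_self, if_false]
        split_ifs
        · simp only [AddMonoidAlgebra.coeff_smul, Finsupp.smul_apply, smul_eq_mul, ← mul_sub]
          exact mul_le_mul_of_nonneg_left (ih _ _) hl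
        · exact ih _ _

theorem popTo_map {α β : Type*} [DecidableEq α] [DecidableEq β] (R : α ≃ β) (y : α) (s : List α) :
    popTo (R y) (s.map R) = (popTo y s).map R := by
  induction s with
  | nil => simp [popTo]
  | cons a s ih =>
    simp only [List.map_cons, popTo, EmbeddingLike.apply_eq_iff_eq]
    split_ifs
    · rfl
    · exact ih

/-- A bijection of the lattice permuting the nearest-neighbour steps. -/
def StepPerm (R : Pt d ≃ Pt d) (σ : Stp d ≃ Stp d) : Prop :=
  ∀ x e, R (x + stp e) = R x + stp (σ e)

theorem W_cov {R : Pt d ≃ Pt d} {σ : Stp d ≃ Stp d} (h : StepPerm R σ) (C : Finset (Pt d)) (n : ℕ)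
    (x : Pt d) (s : List (Pt d)) (v : Pt d) :
    (W lam (C.map R.toEmbedding) n (R x) (s.map R)).coeff (R v) = (W lam C n x s).coeff v := by
  induction n generalizing x s with
  | zero => simp [W, Finsupp.single_apply]
  | succ n ih =>
    simp only [W, AddMonoidAlgebra.coeff_sum, Finsupp.finsetSum_apply]
    rw [← σ.sum_comp]
    refine Finset.sum_congr rfl fun e _ => ?_
    have e1 : R (x + stp e) ∈ C.map R.toEmbedding ↔ x + stp e ∈ C := by
      simp
    have e2 : R (x + stp e) ∈ s.map R ↔ x + stp e ∈ s := by simp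
    rw [← h x e, popTo_map, ← List.map_cons]
    simp only [e1, e2]
    split_ifs
    · simp
    · simp only [AddMonoidAlgebra.coeff_smul, Finsupp.smul_apply, ih]
    · exact ih _ _

theorem W_support {C : Finset (Pt d)} {n : ℕ} {x : Pt d} {s : List (Pt d)} {v : Pt d}
    (h : n < dist1 x v) : (W lam C n x s).coeff v = 0 := by
  induction n generalizing x s with
  | zero =>
    simp only [W, AddMonoidAlgebra.coeff_single]
    rw [Finsupp.single_apply, if_neg]
    rintro rfl; simp [dist1] at h
  | succ n ih =>
    have key : ∀ e : Stp d, n < dist1 (x + stp e) v := by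
      intro e
      have htri : dist1 x v ≤ dist1 x (x + stp e) + dist1 (x + stp e) v := by
        unfold dist1
        rw [← Finset.sum_add_distrib]
        exact Finset.sum_le_sum fun i _ => by omega
      rw [dist1_add_stp] at htri
      omega
    simp only [W, AddMonoidAlgebra.coeff_sum, Finsupp.finsetSum_apply]
    refine Finset.sum_eq_zero fun e _ => ?_
    split_ifs with h1 h2
    · simp
    · simp [ih (key e)]
    · exact ih (key e)

end Machine

section Series
open PowerSeries

variable {d : ℕ}

/-- Power series with coefficients in the lattice algebra. -/
abbrev PS (d : ℕ) := PowerSeries (LA d)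

/-- The embedding of scalar power series. -/
def io (d : ℕ) : PowerSeries ℝ →+* PS d := PowerSeries.map (algebraMap ℝ (LA d))

/-- The scalar power series of coefficients at a lattice point. -/
def cX (v : Pt d) : PS d →+ PowerSeries ℝ where
  toFun F := PowerSeries.mk fun n => (coeff n F).coeff v
  map_zero' := by ext; simp
  map_add' F H := by ext; simp

theorem coeff_cX (v : Pt d) (F : PS d) (n : ℕ) : coeff n (cX v F) = (coeff n F).coeff v := by
  simp [cX]

theorem cX_io_mul (v : Pt d) (f : PowerSeries ℝ) (F : PS d) : cX v (io d f * F) = f * cX v F := by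
  ext n
  rw [coeff_cX, coeff_mul, coeff_mul, AddMonoidAlgebra.coeff_sum, Finsupp.finsetSum_apply]
  refine Finset.sum_congr rfl fun p _ => ?_
  rw [io, PowerSeries.coeff_map, ← Algebra.smul_def, coeff_cX]
  simp

theorem io_X : io d X = X := by simp [io]

theorem cX_X_mul (v : Pt d) (F : PS d) : cX v (X * F) = X * cX v F := by
  rw [← io_X, cX_io_mul]

/-- A unit mass at a lattice point. -/
def sg (u : Pt d) : PS d := C (AddMonoidAlgebra.single u 1)

theorem cX_sg (u v : Pt d) : cX v (sg u) = if u = v then 1 else 0 := by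
  ext n
  rw [coeff_cX, sg, coeff_C]
  by_cases h : n = 0 <;> by_cases h' : u = v <;> simp [h, h', coeff_one]

theorem sg_zero : sg (0 : Pt d) = 1 := by
  rw [sg, ← AddMonoidAlgebra.one_def, map_one]

theorem sg_mul (u v : Pt d) : sg u * sg v = sg (u + v) := by
  rw [sg, sg, ← map_mul, AddMonoidAlgebra.single_mul_single, mul_one, sg]

variable (lam : ℝ)

/-- Generating series of the stack machine. -/
def GW (C : Finset (Pt d)) (x : Pt d) (s : List (Pt d)) : PS d := PowerSeries.mk fun n => W lam C n x s

theorem GW_eq (B : Finset (Pt d)) (x : Pt d) (s : List (Pt d)) :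
    GW lam B x s = sg x + X * ∑ e : Stp d, (if x + stp e ∈ B then 0 else
      if x + stp e ∈ s then io d (C lam) * GW lam B (x + stp e) (popTo (x + stp e) s)
      else GW lam B (x + stp e) (x :: s)) := by
  ext1 n
  cases n with
  | zero => simp [GW, W, sg]
  | succ n =>
    rw [map_add, coeff_succ_X_mul, map_sum]
    simp only [GW, coeff_mk, W, sg, coeff_C, Nat.succ_ne_zero, if_false, zero_add]
    refine Finset.sum_congr rfl fun e _ => ?_
    split_ifs
    · simp
    · simp [io, Algebra.smul_def]
    · simp

/-- Green's series for the loop-weighted walk killed on `B`. -/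
def Gk (B : Finset (Pt d)) (x : Pt d) : PS d := if x ∈ B then 0 else GW lam B x []

/-- Two-point series. -/
def S (B : Finset (Pt d)) (x v : Pt d) : PowerSeries ℝ := cX v (Gk lam B x)

/-- Diagonal Green's series. -/
def gg (B : Finset (Pt d)) (x : Pt d) : PowerSeries ℝ := S lam B x x

/-- Series of walks started at `u` whose later vertices avoid `B`. -/
def Tk (B : Finset (Pt d)) (u : Pt d) : PS d := sg u + X * ∑ e : Stp d, Gk lam B (u + stp e)

/-- First return series. -/
def rr (B : Finset (Pt d)) (x : Pt d) : PowerSeries ℝ :=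
  C lam * X ^ 2 * ∑ e : Stp d, ∑ e' : Stp d, S lam (insert x B) (x + stp e) (x + stp e')

theorem popTo_append {α : Type*} [DecidableEq α] (y b : α) (s : List α) (h : y ∈ s) :
    popTo y (s ++ [b]) = popTo y s ++ [b] := by
  induction s with
  | nil => simp at h
  | cons a s ih =>
    simp only [List.cons_append, popTo]
    split_ifs with ha
    · rfl
    · apply ih
      rcases List.mem_cons.1 h with h | h
      · exact absurd h.symm ha
      · exact h

theorem popTo_append_self {α : Type*} [DecidableEq α] (b : α) (s : List α) (h : b ∉ s) :
    popTo b (s ++ [b]) = [] := by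
  induction s with
  | nil => simp [popTo]
  | cons a s ih =>
    simp only [List.mem_cons, not_or] at h
    simp only [List.cons_append, popTo, if_neg (Ne.symm h.1)]
    exact ih h.2

theorem eq_zero_of_forall_X_pow_dvd {R : Type*} [CommRing R] {F : PowerSeries R}
    (h : ∀ n, X ^ n ∣ F) : F = 0 := by
  ext n
  exact X_pow_dvd_iff.1 (h (n + 1)) n (Nat.lt_succ_self n)

/-- Splitting a trajectory at the first visit to the bottom of the stack. -/
theorem GW_append {A : Finset (Pt d)} {b : Pt d} (hb : b ∉ A) (x : Pt d) (s : List (Pt d))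
    (hbs : b ∉ x :: s) :
    GW lam A x (s ++ [b]) = GW lam (insert b A) x s +
      X * io d (C lam * ∑ e : Stp d, cX (b + stp e) (GW lam (insert b A) x s)) * GW lam A b [] := by
  set K := GW lam A b [] with hK
  set Hf : PS d →+ PowerSeries ℝ := ∑ e : Stp d, cX (b + stp e) with hHf
  have hHfa : ∀ F, Hf F = ∑ e : Stp d, cX (b + stp e) F := fun F => by
    simp [hHf]
  have hHX : ∀ F, Hf (X * F) = X * Hf F := fun F => by
    simp only [hHfa, cX_X_mul, Finset.mul_sum]
  have hHio : ∀ f F, Hf (io d f * F) = f * Hf F := fun f F => by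
    simp only [hHfa, cX_io_mul, Finset.mul_sum]
  simp only [← hHfa]
  let D : Pt d → List (Pt d) → PS d := fun x s => GW lam A x (s ++ [b]) -
    (GW lam (insert b A) x s + X * io d (C lam * Hf (GW lam (insert b A) x s)) * K)
  suffices hD : ∀ n x s, b ∉ x :: s → X ^ n ∣ D x s from
    sub_eq_zero.1 (eq_zero_of_forall_X_pow_dvd fun n => hD n x s hbs)
  intro n
  induction n with
  | zero => simp
  | succ n ih =>
    intro x s hbs
    simp only [List.mem_cons, not_or] at hbs
    have hH0 : Hf (sg x) = ∑ e : Stp d, if x + stp e = b then 1 else 0 := by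
      rw [hHfa, ← nstEquiv.sum_comp]
      refine Finset.sum_congr rfl fun e _ => ?_
      rw [cX_sg]
      congr 1
      change (x = b + stp (nst e)) = _
      rw [stp_nst, eq_iff_iff]
      constructor
      · rintro rfl; abel
      · rintro rfl; abel
    have hterm : ∀ e : Stp d,
        (if x + stp e ∈ A then 0 else if x + stp e ∈ s ++ [b] then
          io d (C lam) * GW lam A (x + stp e) (popTo (x + stp e) (s ++ [b]))
          else GW lam A (x + stp e) (x :: (s ++ [b]))) =
        (if x + stp e ∈ insert b A then 0 else
        if x + stp e ∈ s then io d (C lam) * D (x + stp e) (popTo (x + stp e) s)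
        else D (x + stp e) (x :: s)) +
        (if x + stp e ∈ insert b A then 0 else if x + stp e ∈ s then
          io d (C lam) * GW lam (insert b A) (x + stp e) (popTo (x + stp e) s)
          else GW lam (insert b A) (x + stp e) (x :: s)) +
        X * (io d (C lam) * io d (Hf (if x + stp e ∈ insert b A then 0 else if x + stp e ∈ s then
          io d (C lam) * GW lam (insert b A) (x + stp e) (popTo (x + stp e) s)
          else GW lam (insert b A) (x + stp e) (x :: s)))) * K +
        io d (C lam) * io d (if x + stp e = b then 1 else 0) * K := by
      intro e
      by_cases h1 : x + stp e = b
      · rw [h1]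
        simp [hb, popTo_append_self b s hbs.2, hK]
      · by_cases h2 : x + stp e ∈ A
        · simp [h1, h2]
        · by_cases h3 : x + stp e ∈ s
          · simp only [Finset.mem_insert, h1, h2, h3, List.mem_append, true_or, if_true, if_false,
              or_self, popTo_append _ _ _ h3, hHio, D, map_mul, map_zero]
            ring
          · simp only [Finset.mem_insert, h1, h2, h3, List.mem_append, List.mem_singleton,
              if_false, or_self, D, map_mul, map_zero, List.cons_append]
            ring
    have key : D x s = X * ∑ e : Stp d, (if x + stp e ∈ insert b A then 0 else
        if x + stp e ∈ s then io d (C lam) * D (x + stp e) (popTo (x + stp e) s)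
        else D (x + stp e) (x :: s)) := by
      rw [show D x s = GW lam A x (s ++ [b]) -
        (GW lam (insert b A) x s + X * io d (C lam * Hf (GW lam (insert b A) x s)) * K) from rfl]
      rw [GW_eq lam A x (s ++ [b]), GW_eq lam (insert b A) x s]
      rw [map_add Hf, hH0, hHX, map_sum Hf]
      simp only [mul_add, map_add, map_mul, map_sum, io_X, add_mul]
      simp only [hterm, Finset.sum_add_distrib, ← Finset.mul_sum, ← Finset.sum_mul]
      ring
    rw [key, pow_succ']
    refine mul_dvd_mul_left _ (Finset.dvd_sum fun e _ => ?_)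
    split_ifs with h1 h2
    · simp
    · simp only [Finset.mem_insert, not_or] at h1
      refine Dvd.dvd.mul_left (ih _ _ ?_) _
      simp only [List.mem_cons, not_or]
      exact ⟨Ne.symm h1.1, fun h => hbs.2 ((popTo_sublist _ _).subset h)⟩
    · simp only [Finset.mem_insert, not_or] at h1
      refine ih _ _ ?_
      simp only [List.mem_cons, not_or]
      exact ⟨Ne.symm h1.1, hbs.1, hbs.2⟩

end Series

section Renewal
open PowerSeries

variable {d : ℕ} (lam : ℝ)

theorem Gk_of_mem {B : Finset (Pt d)} {x : Pt d} (h : x ∈ B) : Gk lam B x = 0 := if_pos h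

theorem Gk_of_notMem {B : Finset (Pt d)} {x : Pt d} (h : x ∉ B) : Gk lam B x = GW lam B x [] :=
  if_neg h

theorem coeff_S {B : Finset (Pt d)} {x : Pt d} (h : x ∉ B) (v : Pt d) (n : ℕ) :
    coeff n (S lam B x v) = (W lam B n x []).coeff v := by
  rw [S, coeff_cX, Gk_of_notMem lam h, GW, coeff_mk]

theorem S_of_mem {B : Finset (Pt d)} {x : Pt d} (h : x ∈ B) (v : Pt d) : S lam B x v = 0 := by
  rw [S, Gk_of_mem lam h, map_zero]

theorem gg_of_mem {B : Finset (Pt d)} {x : Pt d} (h : x ∈ B) : gg lam B x = 0 := S_of_mem lam h x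

theorem S_killed {B : Finset (Pt d)} {v : Pt d} (h : v ∈ B) (x : Pt d) : S lam B x v = 0 := by
  by_cases hx : x ∈ B
  · exact S_of_mem lam hx v
  · ext n
    rw [coeff_S lam hx, W_coeff_killed h hx, map_zero]

theorem Gk_renewal {B : Finset (Pt d)} {x : Pt d} (hx : x ∉ B) :
    Gk lam B x = Tk lam (insert x B) x + io d (rr lam B x) * Gk lam B x := by
  rw [Gk_of_notMem lam hx]
  conv_lhs => rw [GW_eq]
  have hterm : ∀ e : Stp d, (if x + stp e ∈ B then (0 : PS d) else
      if x + stp e ∈ ([] : List (Pt d)) then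
        io d (C lam) * GW lam B (x + stp e) (popTo (x + stp e) [])
      else GW lam B (x + stp e) (x :: [])) = Gk lam (insert x B) (x + stp e) +
      X * io d (C lam * ∑ e' : Stp d, S lam (insert x B) (x + stp e) (x + stp e')) * GW lam B x [] := by
    intro e
    by_cases h : x + stp e ∈ B
    · rw [if_pos h, Gk_of_mem lam (Finset.mem_insert_of_mem h)]
      simp only [S_of_mem lam (Finset.mem_insert_of_mem h)]
      simp
    · have hn : x + stp e ∉ insert x B := by simp [h, stp_ne_zero]
      have h1 := GW_append lam hx (x + stp e) [] (by simpa using stp_ne_zero e)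
      simp only [List.nil_append] at h1
      rw [if_neg h, if_neg (by simp), h1]
      simp only [S, Gk_of_notMem lam hn]
  simp only [hterm, Tk, rr, map_mul, map_sum, map_pow, io_X, Finset.sum_add_distrib,
    ← Finset.mul_sum, ← Finset.sum_mul]
  ring

theorem cX_Tk {B : Finset (Pt d)} {x : Pt d} (h : x ∈ B) : cX x (Tk lam B x) = 1 := by
  rw [Tk, map_add, cX_sg, if_pos rfl, cX_X_mul, map_sum]
  have : ∀ e : Stp d, cX x (Gk lam B (x + stp e)) = 0 := fun e => S_killed lam h _
  simp [this]

theorem gg_renewal {B : Finset (Pt d)} {x : Pt d} (hx : x ∉ B) :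
    gg lam B x = 1 + rr lam B x * gg lam B x := by
  have := congrArg (cX x) (Gk_renewal lam hx)
  rwa [map_add, cX_io_mul, cX_Tk lam (Finset.mem_insert_self x B)] at this

theorem Gk_eq {B : Finset (Pt d)} {x : Pt d} (hx : x ∉ B) :
    Gk lam B x = io d (gg lam B x) * Tk lam (insert x B) x := by
  have h1 := Gk_renewal lam hx
  have h2 : io d (gg lam B x) = 1 + io d (rr lam B x) * io d (gg lam B x) := by
    rw [← map_mul, ← map_one (io d), ← map_add, ← gg_renewal lam hx]
  linear_combination io d (gg lam B x) * h1 - Gk lam B x * h2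

theorem S_eq {B : Finset (Pt d)} {x : Pt d} (hx : x ∉ B) (v : Pt d) :
    S lam B x v = gg lam B x * ((if x = v then 1 else 0) +
      X * ∑ e : Stp d, S lam (insert x B) (x + stp e) v) := by
  rw [S, Gk_eq lam hx, cX_io_mul, Tk, map_add, cX_sg, cX_X_mul, map_sum]
  rfl

theorem NN_S (hl : 0 ≤ lam) (B : Finset (Pt d)) (x v : Pt d) : NN (S lam B x v) := by
  by_cases hx : x ∈ B
  · rw [S_of_mem lam hx]; exact NN_zero
  · intro n
    rw [coeff_S lam hx]
    exact W_nonneg hl _ _ _ _ _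

theorem NN_gg (hl : 0 ≤ lam) (B : Finset (Pt d)) (x : Pt d) : NN (gg lam B x) := NN_S lam hl _ _ _

theorem NN_rr (hl : 0 ≤ lam) (B : Finset (Pt d)) (x : Pt d) : NN (rr lam B x) :=
  ((NN_C hl).mul (NN_X.pow 2)).mul (NN_sum fun _ _ => NN_sum fun _ _ => NN_S lam hl _ _ _)

theorem S_anti (hl : 0 ≤ lam) {B C : Finset (Pt d)} (h : B ⊆ C) (x v : Pt d) :
    cle (S lam C x v) (S lam B x v) := by
  by_cases hx : x ∈ C
  · rw [S_of_mem lam hx]; exact NN_S lam hl _ _ _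
  · intro n
    rw [coeff_S lam hx, coeff_S lam fun h' => hx (h h')]
    exact W_anti hl h _ _ _ _

theorem S_cov {R : Pt d ≃ Pt d} {σ : Stp d ≃ Stp d} (h : StepPerm R σ) (B : Finset (Pt d))
    (x v : Pt d) : S lam (B.map R.toEmbedding) (R x) (R v) = S lam B x v := by
  by_cases hx : x ∈ B
  · rw [S_of_mem lam hx, S_of_mem lam (by simpa using hx)]
  · ext n
    rw [coeff_S lam hx, coeff_S lam (by simpa using hx)]
    exact W_cov h B n x [] v

theorem S_add (a : Pt d) (B : Finset (Pt d)) (x v : Pt d) :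
    S lam (B.map (Equiv.addRight a).toEmbedding) (x + a) (v + a) = S lam B x v :=
  S_cov lam (R := Equiv.addRight a) (σ := Equiv.refl _)
    (fun y e => by simp [add_right_comm]) B x v

theorem S_empty_sub (x v : Pt d) : S lam ∅ x v = S lam ∅ 0 (v - x) := by
  have := S_add lam x ∅ 0 (v - x)
  simpa using this

theorem S_singleton_sub (b x v : Pt d) : S lam {b} x v = S lam {0} (x - b) (v - b) := by
  have := S_add lam b {0} (x - b) (v - b)
  simpa using this

theorem S_support {B : Finset (Pt d)} {x v : Pt d} {n : ℕ} (h : n < dist1 x v) :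
    coeff n (S lam B x v) = 0 := by
  by_cases hx : x ∈ B
  · rw [S_of_mem lam hx, map_zero]
  · rw [coeff_S lam hx]; exact W_support h

/-- The increment of the diagonal Green's series caused by killing one point. -/
def hh (y : Pt d) : PowerSeries ℝ := gg lam ∅ y - gg lam {0} y

theorem gg_empty (x : Pt d) : gg lam ∅ x = gg lam ∅ (0 : Pt d) := by
  rw [gg, S_empty_sub, sub_self, gg]

theorem hh_sub (x a : Pt d) : hh lam (x - a) = gg lam ∅ x - gg lam {a} x := by
  rw [hh, gg_empty, ← gg_empty lam x]
  congr 1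
  rw [gg, gg, ← S_singleton_sub]

theorem NN_hh (hl : 0 ≤ lam) (y : Pt d) : NN (hh lam y) :=
  cle_iff.1 (S_anti lam hl (Finset.empty_subset _) _ _)

theorem gg_sub_insert (hl : 0 ≤ lam) (B : Finset (Pt d)) (x a : Pt d) :
    cle (gg lam B x - gg lam (insert a B) x) (hh lam (x - a)) := by
  by_cases hx : x ∈ B
  · rw [gg_of_mem lam hx, gg_of_mem lam (Finset.mem_insert_of_mem hx), sub_zero]
    exact NN_hh lam hl _
  rw [hh_sub]
  by_cases hxa : x = a
  · subst hxa
    rw [gg_of_mem lam (Finset.mem_insert_self _ _), gg_of_mem lam (Finset.mem_singleton_self _),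
      sub_zero, sub_zero]
    exact S_anti lam hl (Finset.empty_subset _) _ _
  · intro n
    rw [map_sub, map_sub, gg, gg, gg, gg, coeff_S lam hx, coeff_S lam (by simp [hxa, hx]),
      coeff_S lam (by simp), coeff_S lam (by simp [hxa])]
    exact W_submod hl _ _ _ _ _ _

theorem gg_sub_le (hl : 0 ≤ lam) {B C : Finset (Pt d)} (h : B ⊆ C) (x : Pt d) :
    cle (gg lam B x - gg lam C x) (∑ a ∈ C \ B, hh lam (x - a)) := by
  have key : ∀ D : Finset (Pt d), Disjoint D B →
      cle (gg lam B x - gg lam (D ∪ B) x) (∑ a ∈ D, hh lam (x - a)) := by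
    intro D
    induction D using Finset.induction_on with
    | empty => intro _; simpa using cle.refl _
    | insert a D ha ih =>
      intro hd
      have h1 := ih (Finset.disjoint_of_subset_left (Finset.subset_insert _ _) hd)
      have h2 := gg_sub_insert lam hl (D ∪ B) x a
      rw [Finset.sum_insert ha, Finset.insert_union]
      have := h2.add h1
      intro n
      have := this n
      simp only [map_add, map_sub] at this ⊢
      linarith
  have := key (C \ B) Finset.sdiff_disjoint
  rwa [Finset.sdiff_union_of_subset h] at this

/-- Coordinate permutations act on steps. -/
theorem stepPerm_perm (π : Equiv.Perm (Fin d)) :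
    StepPerm (Equiv.piCongrLeft (fun _ => ℤ) π) (Equiv.prodCongr π (Equiv.refl Bool)) := by
  intro x e
  ext i
  obtain ⟨j, rfl⟩ := π.surjective i
  obtain ⟨k, b⟩ := e
  simp [stp, Equiv.piCongrLeft_apply_apply, Pi.single_apply, EmbeddingLike.apply_eq_iff_eq]

theorem stepPerm_neg : StepPerm (Equiv.neg (Pt d)) nstEquiv := by
  intro x e
  change -(x + stp e) = -x + stp (nst e)
  rw [stp_nst]; abel

theorem S_neg (x v : Pt d) : S lam ∅ (-x) (-v) = S lam ∅ x v := by
  have := S_cov lam stepPerm_neg ∅ x v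
  simpa using this

end Renewal

section Duhamel
open PowerSeries

variable {d : ℕ} (lam : ℝ)

/-- Two-point series of walks of positive length which do not return to their starting point. -/
def Sp (b v : Pt d) : PowerSeries ℝ := X * ∑ e : Stp d, S lam {b} (b + stp e) v

theorem NN_Sp (hl : 0 ≤ lam) (b v : Pt d) : NN (Sp lam b v) :=
  NN_X.mul (NN_sum fun _ _ => NN_S lam hl _ _ _)

theorem one_cle_gg (hl : 0 ≤ lam) {B : Finset (Pt d)} {x : Pt d} (hx : x ∉ B) :
    cle 1 (gg lam B x) := by
  rw [cle_iff, sub_eq_iff_eq_add'.2 (gg_renewal lam hx)]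
  exact (NN_rr lam hl _ _).mul (NN_gg lam hl _ _)

theorem duhamel (hl : 0 ≤ lam) (u : ℕ → ℝ≥0∞) (q : ℝ≥0∞) {y : Pt d → PowerSeries ℝ}
    (hy : ∀ v, NN (y v)) (D0 : Finset (Pt d)) (m n : ℕ)
    (Xf : PowerSeries ℝ → Finset (Pt d) → Finset (Pt d) → Pt d → ℝ≥0∞)
    (hkill : ∀ f B C x, X ^ n ∣ f → Xf f B C x = 0)
    (hmem : ∀ f B C x, x ∈ B → B ⊆ C → Xf f B C x = 0)
    (hstep : ∀ f B C x, NN f → X ^ m ∣ f → B ⊆ C → C \ B ⊆ D0 → x ∉ B →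
      Xf f B C x ≤ (1 + q * B.card) * rho u (f * y x) +
        ∑ e : Stp d, Xf (f * (X * gg lam C x)) (insert x B) (insert x C) (x + stp e))
    (f : PowerSeries ℝ) (B C : Finset (Pt d)) (x : Pt d) (hf : NN f) (hfm : X ^ m ∣ f)
    (hBC : B ⊆ C) (hD : C \ B ⊆ D0) :
    Xf f B C x ≤ (1 + q * B.card) * ∑' v, rho u (f * S lam B x v * y v) +
      q * ∑' v, ∑' b, rho u (f * S lam B x b * (Sp lam b v * y v)) := by
  have main : ∀ k : ℕ, ∀ f B C x, NN f → X ^ m ∣ f → X ^ (n - k) ∣ f → B ⊆ C → C \ B ⊆ D0 →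
      Xf f B C x ≤ (1 + q * B.card) * ∑' v, rho u (f * S lam B x v * y v) +
      q * ∑' v, ∑' b, rho u (f * S lam B x b * (Sp lam b v * y v)) := by
    intro k
    induction k with
    | zero =>
      intro f B C x _ _ h _ _
      rw [hkill f B C x h]
      exact zero_le
    | succ k ih =>
      intro f B C x hf hfm hfk hBC hD
      by_cases hx : x ∈ B
      · rw [hmem f B C x hx hBC]; exact zero_le
      set P : Pt d → PowerSeries ℝ := fun v =>
        gg lam B x * (X * ∑ e : Stp d, S lam (insert x B) (x + stp e) v) with hP
      have hPN : ∀ v, NN (P v) := fun v =>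
        (NN_gg lam hl _ _).mul (NN_X.mul (NN_sum fun _ _ => NN_S lam hl _ _ _))
      have hSP : ∀ v, S lam B x v = gg lam B x * (if x = v then 1 else 0) + P v := fun v => by
        rw [S_eq lam hx, mul_add]
      have hA : ∀ (v : Pt d) (H : PowerSeries ℝ), NN H →
          ∑ e : Stp d, rho u (f * (X * gg lam C x) * S lam (insert x B) (x + stp e) v * H)
            ≤ rho u (f * P v * H) := by
        intro v H hH
        have hNN : NN (f * (X * gg lam C x)) := hf.mul (NN_X.mul (NN_gg lam hl _ _))
        rw [← rho_sum u _ fun e _ => (hNN.mul (NN_S lam hl _ _ _)).mul hH]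
        refine rho_mono u (NN_sum fun e _ => (hNN.mul (NN_S lam hl _ _ _)).mul hH) ?_
        rw [← Finset.sum_mul, ← Finset.mul_sum, hP]
        have : cle (gg lam C x * (f * (X * ∑ e : Stp d, S lam (insert x B) (x + stp e) v) * H))
            (gg lam B x * (f * (X * ∑ e : Stp d, S lam (insert x B) (x + stp e) v) * H)) :=
          (S_anti lam hl hBC x x).mul_right
            ((hf.mul (NN_X.mul (NN_sum fun _ _ => NN_S lam hl _ _ _))).mul hH)
        convert this using 1 <;> ring
      have hsplit : ∀ H : Pt d → PowerSeries ℝ, (∀ v, NN (H v)) →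
          ∑' v, rho u (f * S lam B x v * H v) =
            rho u (f * gg lam B x * H x) + ∑' v, rho u (f * P v * H v) := by
        intro H hH
        have : ∀ v, rho u (f * S lam B x v * H v) =
            rho u (f * (gg lam B x * (if x = v then 1 else 0)) * H v) + rho u (f * P v * H v) := by
          intro v
          rw [hSP v, mul_add, add_mul]
          refine rho_add u ((hf.mul ((NN_gg lam hl _ _).mul ?_)).mul (hH v))
            ((hf.mul (hPN v)).mul (hH v))
          split_ifs
          exacts [NN_one, NN_zero]
        simp only [this]
        rw [ENNReal.tsum_add, tsum_eq_single x]
        · simp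
        · intro v hv
          rw [if_neg (Ne.symm hv)]
          simp [rho_zero]
      have hg1 := one_cle_gg lam hl hx
      have hPS : ∀ v, cle (f * P v * y v) (f * gg lam B x * (Sp lam x v * y v)) := by
        intro v
        have h1 : cle (∑ e : Stp d, S lam (insert x B) (x + stp e) v)
            (∑ e : Stp d, S lam {x} (x + stp e) v) :=
          cle_sum fun e _ => S_anti lam hl (by simp) _ _
        have h2 := h1.mul_left (((hf.mul (NN_gg lam hl B x)).mul NN_X).mul (hy v))
        rw [hP, Sp]
        convert h2 using 1 <;> ring
      have hf' : NN (f * (X * gg lam C x)) := hf.mul (NN_X.mul (NN_gg lam hl _ _))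
      have hfm' : X ^ m ∣ f * (X * gg lam C x) := Dvd.dvd.mul_right hfm _
      have hfk' : X ^ (n - k) ∣ f * (X * gg lam C x) := by
        refine (pow_dvd_pow X (show n - k ≤ (n - (k + 1)) + 1 by omega)).trans ?_
        rw [pow_succ, ← mul_assoc]
        exact Dvd.dvd.mul_right (mul_dvd_mul_right hfk X) _
      have hBC' : insert x B ⊆ insert x C := Finset.insert_subset_insert _ hBC
      have hD' : insert x C \ insert x B ⊆ D0 := fun z hz => hD (by
        simp only [Finset.mem_sdiff, Finset.mem_insert, not_or] at hz ⊢
        exact ⟨hz.1.resolve_left hz.2.1, hz.2.2⟩)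
      set a : ℝ≥0∞ := 1 + q * B.card with ha
      have hcard : (1 + q * (insert x B).card : ℝ≥0∞) = a + q := by
        rw [Finset.card_insert_of_notMem hx, ha]
        push_cast; ring
      calc Xf f B C x ≤ a * rho u (f * y x) +
            ∑ e : Stp d, Xf (f * (X * gg lam C x)) (insert x B) (insert x C) (x + stp e) :=
            hstep f B C x hf hfm hBC hD hx
        _ ≤ a * rho u (f * y x) + ∑ e : Stp d, ((a + q) * ∑' v,
              rho u (f * (X * gg lam C x) * S lam (insert x B) (x + stp e) v * y v) +
              q * ∑' v, ∑' b, rho u (f * (X * gg lam C x) * S lam (insert x B) (x + stp e) b *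
                (Sp lam b v * y v))) := by
            gcongr with e
            have := ih _ _ _ (x + stp e) hf' hfm' hfk' hBC' hD'
            rwa [hcard] at this
        _ ≤ a * rho u (f * y x) + ((a + q) * ∑' v, rho u (f * P v * y v) +
              q * ∑' v, ∑' b, rho u (f * P b * (Sp lam b v * y v))) := by
            rw [Finset.sum_add_distrib, ← Finset.mul_sum, ← Finset.mul_sum,
              ← Summable.tsum_finsetSum (fun i _ => ENNReal.summable),
              ← Summable.tsum_finsetSum (fun i _ => ENNReal.summable)]
            gcongr with v v
            · exact hA v _ (hy v)
            · rw [← Summable.tsum_finsetSum (fun i _ => ENNReal.summable)]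
              gcongr with b
              exact hA b _ ((NN_Sp lam hl _ _).mul (hy v))
        _ ≤ a * rho u (f * gg lam B x * y x) + (a * ∑' v, rho u (f * P v * y v) +
              q * ∑' v, rho u (f * gg lam B x * (Sp lam x v * y v)) +
              q * ∑' v, ∑' b, rho u (f * P b * (Sp lam b v * y v))) := by
            rw [add_mul a q]
            gcongr with v
            · refine rho_mono u (hf.mul (hy x)) ?_
              have := hg1.mul_left (hf.mul (hy x))
              convert this using 1 <;> ring
            · exact rho_mono u ((hf.mul (hPN v)).mul (hy v)) (hPS v)
        _ = _ := by
            rw [hsplit y hy]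
            have : ∀ v, ∑' b, rho u (f * S lam B x b * (Sp lam b v * y v)) =
                rho u (f * gg lam B x * (Sp lam x v * y v)) +
                  ∑' b, rho u (f * P b * (Sp lam b v * y v)) := fun v =>
              hsplit (fun b => Sp lam b v * y v) fun b => (NN_Sp lam hl _ _).mul (hy v)
            simp only [this]
            rw [ENNReal.tsum_add]
            ring
  exact main n f B C x hf hfm (by simp) hBC hD

/-- The operator `n ↦ (n+1) f_n` on series. -/
def Th (f : PowerSeries ℝ) : PowerSeries ℝ := PowerSeries.mk fun n => (n + 1 : ℝ) * coeff n f

theorem coeff_Th (f : PowerSeries ℝ) (n : ℕ) : coeff n (Th f) = (n + 1 : ℝ) * coeff n f := by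
  simp [Th]

theorem Th_eq (f : PowerSeries ℝ) : Th f = f + X * derivative ℝ f := by
  ext n
  cases n with
  | zero => simp [coeff_Th]
  | succ n => rw [coeff_Th, map_add, coeff_succ_X_mul, coeff_derivative]; push_cast; ring

theorem rho_Th (p : ℕ) (z : ℝ≥0) (f : PowerSeries ℝ) :
    rho (wz p z) (Th f) = rho (wz (p + 1) z) f := by
  unfold rho
  refine tsum_congr fun n => ?_
  rw [coeff_Th, nm_real, nm_real, enorm_mul]
  have : ‖(n + 1 : ℝ)‖ₑ = 1 + n := by
    rw [Real.enorm_of_nonneg (by positivity), ENNReal.ofReal_add (by positivity) (by norm_num)]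
    simp [add_comm]
  rw [this, wz, wz, pow_succ]
  ring

theorem NN.Th {f : PowerSeries ℝ} (hf : NN f) : NN (Th f) := fun n => by
  rw [coeff_Th]; exact mul_nonneg (by positivity) (hf n)

theorem cle.Th {f g : PowerSeries ℝ} (h : cle f g) : cle (Th f) (LWW.Th g) := fun n => by
  rw [coeff_Th, coeff_Th]; exact mul_le_mul_of_nonneg_left (h n) (by positivity)

theorem Th_sum {ι : Type*} (s : Finset ι) (f : ι → PowerSeries ℝ) :
    Th (∑ i ∈ s, f i) = ∑ i ∈ s, Th (f i) := by
  ext n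
  simp only [coeff_Th, map_sum, Finset.mul_sum]

theorem step_cle_S (hl : 0 ≤ lam) {B : Finset (Pt d)} {x : Pt d} (v : Pt d) :
    cle ((if x = v then 1 else 0) + X * ∑ e : Stp d, S lam (insert x B) (x + stp e) v)
      (S lam ∅ x v) := by
  have h1 : cle (∑ e : Stp d, S lam (insert x B) (x + stp e) v)
      (∑ e : Stp d, S lam (insert x ∅) (x + stp e) v) :=
    cle_sum fun e _ => S_anti lam hl (by simp) _ _
  have h2 := (cle.refl (if x = v then 1 else 0 : PowerSeries ℝ)).add (h1.mul_left NN_X)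
  refine h2.trans ?_
  have hN : NN ((if x = v then 1 else 0 : PowerSeries ℝ) +
      X * ∑ e : Stp d, S lam (insert x ∅) (x + stp e) v) := by
    refine NN.add ?_ (NN_X.mul (NN_sum fun _ _ => NN_S lam hl _ _ _))
    split_ifs
    exacts [NN_one, NN_zero]
  have := (one_cle_gg lam hl (Finset.notMem_empty x)).mul_right hN
  rwa [one_mul, ← S_eq lam (Finset.notMem_empty x)] at this

theorem NN_U (hl : 0 ≤ lam) (B : Finset (Pt d)) (x v : Pt d) :
    NN ((if x = v then 1 else 0) + X * ∑ e : Stp d, S lam B (x + stp e) v) := by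
  refine NN.add ?_ (NN_X.mul (NN_sum fun _ _ => NN_S lam hl _ _ _))
  split_ifs
  exacts [NN_one, NN_zero]

theorem rho_Th_S_le (hl : 0 ≤ lam) (u : ℕ → ℝ≥0∞) (x v : Pt d) :
    rho u (Th (S lam ∅ x v)) ≤
      ∑' b, rho u (S lam ∅ x b * (Th (gg lam ∅ (0 : Pt d)) * S lam ∅ b v)) := by
  refine rho_le_of_trunc fun n => ?_
  have key := duhamel lam hl (trunc n u) 0 (y := fun x => Th (gg lam ∅ (0 : Pt d)) * S lam ∅ x v)
    (fun x => (NN_gg lam hl _ _).Th.mul (NN_S lam hl _ _ _)) ∅ 0 n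
    (fun f B _ x => rho (trunc n u) (f * Th (S lam B x v))) ?_ ?_ ?_ 1 ∅ ∅ x NN_one (by simp)
    (by simp) (by simp)
  · simp only [one_mul, zero_mul, add_zero] at key
    exact key.trans (ENNReal.tsum_le_tsum fun b => rho_trunc_le _ _ _)
  · intro f B C x hf
    exact rho_trunc_of_dvd _ (Dvd.dvd.mul_right hf _)
  · intro f B C x hx _
    simp only [S_of_mem lam hx]
    rw [show Th 0 = 0 by ext n; simp [coeff_Th], mul_zero, rho_zero]
  · intro f B C x hf _ hBC hD hx
    have hCB : C = B := by
      refine Finset.Subset.antisymm ?_ hBC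
      rwa [← Finset.sdiff_eq_empty_iff_subset, ← Finset.subset_empty]
    subst hCB
    set U : PowerSeries ℝ := (if x = v then 1 else 0) +
      X * ∑ e : Stp d, S lam (insert x C) (x + stp e) v with hU
    have hT : Th (S lam C x v) = Th (gg lam C x) * U +
        gg lam C x * (X * ∑ e : Stp d, Th (S lam (insert x C) (x + stp e) v)) := by
      rw [S_eq lam hx, ← hU, ← Th_sum, Th_eq, Th_eq, Th_eq]
      have hdU : derivative ℝ U = (∑ e : Stp d, S lam (insert x C) (x + stp e) v) +
          X * derivative ℝ (∑ e : Stp d, S lam (insert x C) (x + stp e) v) := by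
        rw [hU, map_add, Derivation.leibniz, derivative_X]
        have : derivative ℝ (if x = v then 1 else 0 : PowerSeries ℝ) = 0 := by
          split_ifs <;> simp
        rw [this]
        simp only [smul_eq_mul]; ring
      rw [Derivation.leibniz, hdU]
      simp only [smul_eq_mul]; ring
    simp only [hT, zero_mul, add_zero, one_mul]
    rw [mul_add]
    refine (rho_add_le _ _ _).trans ?_
    gcongr
    · refine rho_mono _ (hf.mul ((NN_gg lam hl _ _).Th.mul (NN_U lam hl _ _ _))) ?_
      refine cle.mul_left ?_ hf
      have h1 : cle (Th (gg lam C x)) (Th (gg lam ∅ (0 : Pt d))) := by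
        rw [← gg_empty lam x]
        exact (S_anti lam hl (Finset.empty_subset _) x x).Th
      exact (h1.mul_right (NN_U lam hl _ _ _)).trans
        ((step_cle_S lam hl v).mul_left (NN_gg lam hl _ _).Th)
    · rw [← rho_sum _ _ fun e _ => (hf.mul (NN_X.mul (NN_gg lam hl _ _))).mul
        (NN_S lam hl _ _ _).Th, ← Finset.mul_sum]
      apply le_of_eq
      congr 1
      ring

theorem rho_S_sub_le (hl : 0 ≤ lam) (u : ℕ → ℝ≥0∞) {f : PowerSeries ℝ} (hf : NN f)
    {B C : Finset (Pt d)} (hBC : B ⊆ C) (a : Pt d) (ha : C \ B ⊆ {a}) (x v : Pt d) :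
    rho u (f * (S lam B x v - S lam C x v)) ≤
      ∑' b, rho u (f * S lam B x b * (hh lam (b - a) * S lam ∅ b v)) := by
  refine rho_le_of_trunc fun n => ?_
  have key := duhamel lam hl (trunc n u) 0 (y := fun x => hh lam (x - a) * S lam ∅ x v)
    (fun x => (NN_hh lam hl _).mul (NN_S lam hl _ _ _)) {a} 0 n
    (fun f B C x => rho (trunc n u) (f * (S lam B x v - S lam C x v))) ?_ ?_ ?_ f B C x hf (by simp)
    hBC ha
  · simp only [one_mul, zero_mul, add_zero] at key
    exact key.trans (ENNReal.tsum_le_tsum fun b => rho_trunc_le _ _ _)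
  · intro f B C x hf
    exact rho_trunc_of_dvd _ (Dvd.dvd.mul_right hf _)
  · intro f B C x hx hBC
    simp only [S_of_mem lam hx, S_of_mem lam (hBC hx)]
    simp [rho_zero]
  · intro f B C x hf _ hBC hD hx
    have hT : S lam B x v - S lam C x v = (gg lam B x - gg lam C x) * ((if x = v then 1 else 0) +
        X * ∑ e : Stp d, S lam (insert x B) (x + stp e) v) + gg lam C x * (X * ∑ e : Stp d,
          (S lam (insert x B) (x + stp e) v - S lam (insert x C) (x + stp e) v)) := by
      rw [S_eq lam hx]
      by_cases hxC : x ∈ C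
      · rw [S_of_mem lam hxC, gg_of_mem lam hxC]; ring
      · rw [S_eq lam hxC, Finset.sum_sub_distrib]; ring
    rw [hT]
    simp only [zero_mul, add_zero, one_mul]
    rw [mul_add]
    refine (rho_add_le _ _ _).trans ?_
    have hNs : NN (gg lam B x - gg lam C x) := cle_iff.1 (S_anti lam hl hBC x x)
    gcongr
    · refine rho_mono _ (hf.mul (hNs.mul (NN_U lam hl _ _ _))) ?_
      refine cle.mul_left ?_ hf
      have h1 : cle (gg lam B x - gg lam C x) (hh lam (x - a)) := by
        refine (gg_sub_le lam hl hBC x).trans ?_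
        have h2 : NN (∑ b ∈ ({a} : Finset (Pt d)) \ (C \ B), hh lam (x - b)) :=
          NN_sum fun _ _ => NN_hh lam hl _
        rw [cle_iff]
        have h3 := Finset.sum_sdiff hD (f := fun b => hh lam (x - b))
        rw [Finset.sum_singleton] at h3
        rw [← h3, add_sub_cancel_right]
        exact h2
      exact (h1.mul_right (NN_U lam hl _ _ _)).trans
        ((step_cle_S lam hl v).mul_left (NN_hh lam hl _))
    · rw [← rho_sum _ _ fun e _ => (hf.mul (NN_X.mul (NN_gg lam hl _ _))).mul
        (cle_iff.1 (S_anti lam hl (Finset.insert_subset_insert _ hBC) _ _)), ← Finset.mul_sum]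
      apply le_of_eq
      congr 1
      ring

end Duhamel

section LatticeNorm
open PowerSeries L1

variable {d : ℕ}

theorem LA_eq_sum (a : LA d) : a = ∑ v ∈ a.coeff.support, AddMonoidAlgebra.single v (a.coeff v) := by
  ext v
  rw [AddMonoidAlgebra.coeff_sum, Finsupp.finsetSum_apply]
  simp only [AddMonoidAlgebra.coeff_single, Finsupp.single_apply]
  rw [Finset.sum_ite_eq']
  simp

/-- The total variation of a finite real measure on the lattice. -/
def tv (a : LA d) : ℝ≥0∞ := ∑' v, ‖a.coeff v‖ₑ

theorem tv_add (a b : LA d) : tv (a + b) ≤ tv a + tv b := by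
  unfold tv
  rw [← ENNReal.tsum_add]
  exact ENNReal.tsum_le_tsum fun v => by simpa using enorm_add_le _ _

theorem tv_zero : tv (0 : LA d) = 0 := by simp [tv]

theorem tv_single (v : Pt d) (c : ℝ) : tv (AddMonoidAlgebra.single v c) = ‖c‖ₑ := by
  unfold tv
  rw [tsum_eq_single v]
  · simp
  · intro w hw
    simp [hw.symm]

theorem tv_sum_le {ι : Type*} (s : Finset ι) (f : ι → LA d) : tv (∑ i ∈ s, f i) ≤ ∑ i ∈ s, tv (f i) := by
  induction s using Finset.induction_on with
  | empty => simp [tv_zero]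
  | insert a s ha ih =>
    rw [Finset.sum_insert ha, Finset.sum_insert ha]
    exact (tv_add _ _).trans (by gcongr)

theorem tv_eq_sum (a : LA d) : tv a = ∑ v ∈ a.coeff.support, ‖a.coeff v‖ₑ :=
  tsum_eq_sum fun v hv => by simpa using hv

instance : L1 (LA d) where
  nm := tv
  nm_zero := tv_zero
  nm_add := tv_add
  nm_neg a := by simp [tv]
  nm_one := by rw [AddMonoidAlgebra.one_def, tv_single]; simp
  nm_mul a b := by
    conv_lhs => rw [LA_eq_sum a, LA_eq_sum b, Finset.sum_mul_sum]
    rw [tv_eq_sum a, tv_eq_sum b, Finset.sum_mul_sum]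
    refine (tv_sum_le _ _).trans (Finset.sum_le_sum fun v _ => (tv_sum_le _ _).trans
      (Finset.sum_le_sum fun w _ => ?_))
    rw [AddMonoidAlgebra.single_mul_single, tv_single, enorm_mul]

theorem nm_LA (a : LA d) : nm a = tv a := rfl

theorem rho_io (u : ℕ → ℝ≥0∞) (f : PowerSeries ℝ) : rho u (io d f) = rho u f := by
  unfold rho
  refine tsum_congr fun n => ?_
  rw [io, PowerSeries.coeff_map, nm_real, nm_LA]
  congr 1
  exact tv_single 0 _

theorem rho_sg (u : ℕ → ℝ≥0∞) (v : Pt d) : rho u (sg v) = u 0 := by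
  rw [sg, rho_C_one, nm_LA, tv_single]; simp

theorem rho_eq_tsum_cX (u : ℕ → ℝ≥0∞) (F : PS d) : rho u F = ∑' v, rho u (cX v F) := by
  unfold rho
  rw [ENNReal.tsum_comm]
  refine tsum_congr fun n => ?_
  rw [ENNReal.tsum_mul_left]
  congr 1
  simp only [nm_LA, tv, nm_real, coeff_cX]

end LatticeNorm

section Convolution

variable {d : ℕ}

/-- Extended nonnegative functions on the lattice under convolution. -/
@[ext] structure CF (d : ℕ) where
  /-- The underlying function. -/
  fn : Pt d → ℝ≥0∞

namespace CF

instance : CoeFun (CF d) (fun _ => Pt d → ℝ≥0∞) := ⟨fn⟩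

theorem ext' {f g : CF d} (h : ∀ v, f v = g v) : f = g := CF.ext (funext h)

instance : PartialOrder (CF d) := PartialOrder.lift fn fun _ _ => CF.ext
instance : Zero (CF d) := ⟨⟨fun _ => 0⟩⟩
instance : Add (CF d) := ⟨fun f g => ⟨fun v => f v + g v⟩⟩
instance : Mul (CF d) := ⟨fun f g => ⟨fun v => ∑' w, f w * g (v - w)⟩⟩
instance : One (CF d) := ⟨⟨fun v => if v = 0 then 1 else 0⟩⟩

theorem add_apply (f g : CF d) (v : Pt d) : (f + g) v = f v + g v := rfl
theorem zero_apply (v : Pt d) : (0 : CF d) v = 0 := rfl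
theorem mul_apply (f g : CF d) (v : Pt d) : (f * g) v = ∑' w, f w * g (v - w) := rfl
theorem one_apply (v : Pt d) : (1 : CF d) v = if v = 0 then 1 else 0 := rfl

protected theorem mul_comm (f g : CF d) : f * g = g * f := by
  refine ext' fun v => ?_
  rw [mul_apply, mul_apply, ← (Equiv.subLeft v).tsum_eq]
  refine tsum_congr fun w => ?_
  simp [mul_comm]

protected theorem mul_assoc (f g h : CF d) : f * g * h = f * (g * h) := by
  refine ext' fun v => ?_
  simp only [mul_apply, ← ENNReal.tsum_mul_right, ← ENNReal.tsum_mul_left]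
  rw [ENNReal.tsum_comm]
  refine tsum_congr fun w => ?_
  rw [← (Equiv.addRight w).tsum_eq]
  refine tsum_congr fun w' => ?_
  simp only [Equiv.coe_addRight, add_sub_cancel_right]
  rw [mul_assoc, sub_sub, add_comm]

protected theorem one_mul (f : CF d) : 1 * f = f := by
  refine ext' fun v => ?_
  rw [mul_apply, tsum_eq_single 0]
  · simp [one_apply]
  · intro w hw
    simp [one_apply, hw]

instance : CommSemiring (CF d) where
  add_comm f g := by refine ext' fun v => ?_; simp [add_apply, add_comm]
  add_assoc f g h := by refine ext' fun v => ?_; simp [add_apply, add_assoc]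
  zero_add f := by refine ext' fun v => ?_; simp [add_apply, zero_apply]
  add_zero f := by refine ext' fun v => ?_; simp [add_apply, zero_apply]
  mul_comm := CF.mul_comm
  mul_assoc := CF.mul_assoc
  one_mul := CF.one_mul
  mul_one f := by rw [CF.mul_comm, CF.one_mul]
  zero_mul f := by refine ext' fun v => ?_; simp [mul_apply, zero_apply]
  mul_zero f := by refine ext' fun v => ?_; simp [mul_apply, zero_apply]
  left_distrib f g h := by refine ext' fun v => ?_; simp [mul_apply, add_apply, mul_add, ENNReal.tsum_add]
  right_distrib f g h := by refine ext' fun v => ?_; simp [mul_apply, add_apply, add_mul, ENNReal.tsum_add]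
  nsmul := nsmulRec

protected theorem mul_le_mul {f f' g g' : CF d} (h : f ≤ f') (h' : g ≤ g') : f * g ≤ f' * g' :=
  fun v => ENNReal.tsum_le_tsum fun w => mul_le_mul' (h w) (h' (v - w))

instance : MulLeftMono (CF d) := ⟨fun _ _ _ h => CF.mul_le_mul le_rfl h⟩
instance : MulRightMono (CF d) := ⟨fun _ _ _ h => CF.mul_le_mul h le_rfl⟩

/-- Constants. -/
def K (c : ℝ≥0∞) : CF d := ⟨fun v => if v = 0 then c else 0⟩

theorem K_mul (c : ℝ≥0∞) (f : CF d) (v : Pt d) : (K c * f : CF d) v = c * f v := by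
  rw [mul_apply, tsum_eq_single 0]
  · simp [K]
  · intro w hw
    simp [K, hw]

theorem K_mul_K (a b : ℝ≥0∞) : (K a * K b : CF d) = K (a * b) := by
  refine ext' fun v => ?_
  rw [K_mul]
  simp [K]

theorem K_pow (a : ℝ≥0∞) (n : ℕ) : (K a ^ n : CF d) = K (a ^ n) := by
  induction n with
  | zero => refine ext' fun v => ?_; simp [K, one_apply]
  | succ n ih => rw [pow_succ, ih, K_mul_K, pow_succ]

/-- Total mass. -/
def mass (f : CF d) : ℝ≥0∞ := ∑' v, f v

theorem mass_mul (f g : CF d) : mass (f * g) = mass f * mass g := by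
  unfold mass
  simp only [mul_apply]
  rw [ENNReal.tsum_comm, ← ENNReal.tsum_mul_right]
  refine tsum_congr fun w => ?_
  rw [ENNReal.tsum_mul_left, ← (Equiv.subRight w).tsum_eq g]
  rfl

theorem le_mass (f : CF d) (v : Pt d) : f v ≤ mass f := ENNReal.le_tsum v

theorem mul_apply_le {f g : CF d} {s : ℝ≥0∞} (h : ∀ v, g v ≤ s) (v : Pt d) :
    (f * g) v ≤ mass f * s := by
  rw [mul_apply, mass, ← ENNReal.tsum_mul_right]
  exact ENNReal.tsum_le_tsum fun w => mul_le_mul' le_rfl (h _)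

/-- Reflection-symmetric functions. -/
def Ev (f : CF d) : Prop := ∀ v, f (-v) = f v

theorem Ev.mul {f g : CF d} (hf : Ev f) (hg : Ev g) : Ev (f * g) := fun v => by
  rw [mul_apply, mul_apply, ← (Equiv.neg (Pt d)).tsum_eq]
  refine tsum_congr fun w => ?_
  rw [Equiv.neg_apply, hf, ← neg_sub_neg, neg_neg, ← hg (v - w)]
  congr 2
  abel

theorem Ev.sq_le {f : CF d} (hf : Ev f) (v : Pt d) : f v ^ 2 ≤ (f * f) 0 := by
  rw [mul_apply, sq]
  refine le_trans (le_of_eq ?_) (ENNReal.le_tsum v)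
  rw [zero_sub, hf]

/-- The unnormalized step distribution. -/
def N : CF d := ⟨fun v => ∑ e : Stp d, if stp e = v then 1 else 0⟩

theorem N_mul (f : CF d) (v : Pt d) : (N * f : CF d) v = ∑ e : Stp d, f (v - stp e) := by
  rw [mul_apply]
  simp only [N, Finset.sum_mul]
  rw [Summable.tsum_finsetSum (fun i _ => ENNReal.summable)]
  refine Finset.sum_congr rfl fun e _ => ?_
  rw [tsum_eq_single (stp e)]
  · simp
  · intro w hw
    simp [hw.symm]

theorem N_mul' (f : CF d) (v : Pt d) : (N * f : CF d) v = ∑ e : Stp d, f (v + stp e) := by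
  rw [N_mul, ← nstEquiv.sum_comp]
  refine Finset.sum_congr rfl fun e _ => ?_
  change f (v - stp (nst e)) = _
  rw [stp_nst, sub_neg_eq_add]

theorem mass_N : mass (N : CF d) = 2 * d := by
  unfold mass N
  rw [Summable.tsum_finsetSum (fun i _ => ENNReal.summable)]
  simp [mul_comm]

theorem Ev_N : Ev (N : CF d) := fun v => by
  change (∑ e : Stp d, if stp e = -v then (1 : ℝ≥0∞) else 0) = ∑ e : Stp d, if stp e = v then 1 else 0
  rw [← nstEquiv.sum_comp]
  refine Finset.sum_congr rfl fun e _ => ?_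
  change (if stp (nst e) = -v then (1 : ℝ≥0∞) else 0) = _
  rw [stp_nst]
  simp

end CF

end Convolution

section Bounds
open PowerSeries L1

variable {d : ℕ} (lam : ℝ) (z : ℝ≥0)

theorem wz_zero (p : ℕ) : wz p z 0 = 1 := by simp [wz]

theorem wz_mono_left {p q : ℕ} (h : p ≤ q) (n : ℕ) : wz p z n ≤ wz q z n := by
  unfold wz
  gcongr
  simp

theorem rho_wz_X (p : ℕ) : rho (wz p z) (X : PowerSeries ℝ) = 2 ^ p * z := by
  rw [rho_X, wz]
  norm_num

theorem rho_wz_X_sq : rho (wz 3 z) (X ^ 2 : PowerSeries ℝ) = 27 * z ^ 2 := by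
  rw [sq, rho_X_mul, rho_X, wz]
  norm_num

variable (d) in
/-- Weighted two-point function. -/
def Gw (p : ℕ) : CF d := ⟨fun v => rho (wz p z) (S lam ∅ 0 v)⟩

variable (d) in
/-- Weighted bubble at the origin. -/
def gw (p : ℕ) : ℝ≥0∞ := rho (wz p z) (gg lam ∅ (0 : Pt d))

theorem Gw_apply (p : ℕ) (v : Pt d) : Gw d lam z p v = rho (wz p z) (S lam ∅ 0 v) := rfl

theorem rho_S_empty (p : ℕ) (x v : Pt d) : rho (wz p z) (S lam ∅ x v) = Gw d lam z p (v - x) := by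
  rw [S_empty_sub, Gw_apply]

theorem Gw_zero (p : ℕ) : Gw d lam z p 0 = gw d lam z p := rfl

theorem rho_gg_le (hl : 0 ≤ lam) (p : ℕ) (B : Finset (Pt d)) (x : Pt d) :
    rho (wz p z) (gg lam B x) ≤ gw d lam z p := by
  rw [gw, ← gg_empty lam x]
  exact rho_mono _ (NN_gg lam hl _ _) (S_anti lam hl (Finset.empty_subset _) _ _)

theorem rho_S_le (hl : 0 ≤ lam) (p : ℕ) (B : Finset (Pt d)) (x v : Pt d) :
    rho (wz p z) (S lam B x v) ≤ Gw d lam z p (v - x) := by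
  rw [← rho_S_empty]
  exact rho_mono _ (NN_S lam hl _ _ _) (S_anti lam hl (Finset.empty_subset _) _ _)

theorem one_le_gw (hl : 0 ≤ lam) (p : ℕ) : 1 ≤ gw d lam z p := by
  have := rho_mono (wz p z) NN_one (one_cle_gg lam hl (Finset.notMem_empty (0 : Pt d)))
  rwa [← map_one C, rho_C_one, nm_one, wz_zero, mul_one] at this

theorem one_le_Gw (hl : 0 ≤ lam) (p : ℕ) : (1 : CF d) ≤ Gw d lam z p := by
  intro v
  rw [CF.one_apply]
  split_ifs with h
  · rw [h, Gw_zero]; exact one_le_gw lam z hl p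
  · exact zero_le

theorem Ev_Gw (p : ℕ) : CF.Ev (Gw d lam z p) := fun v => by
  rw [Gw_apply, Gw_apply, ← S_neg lam 0 v, neg_zero]

theorem gw_mono {p q : ℕ} (h : p ≤ q) : gw d lam z p ≤ gw d lam z q :=
  rho_mono_weight (wz_mono_left z h) _

theorem Gw_succ_le (hl : 0 ≤ lam) (p : ℕ) :
    Gw d lam z (p + 1) ≤ CF.K (gw d lam z (p + 1)) * (Gw d lam z p * Gw d lam z p) := by
  intro v
  rw [CF.K_mul, Gw_apply, ← rho_Th, CF.mul_apply, ← ENNReal.tsum_mul_left]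
  refine (rho_Th_S_le lam hl _ _ _).trans (ENNReal.tsum_le_tsum fun b => ?_)
  refine (rho_mul_le' (wz_subM p z) _ _).trans ?_
  calc _ ≤ rho (wz p z) (S lam ∅ 0 b) *
        (rho (wz p z) (Th (gg lam ∅ (0 : Pt d))) * rho (wz p z) (S lam ∅ b v)) := by
        gcongr; exact rho_mul_le' (wz_subM p z) _ _
    _ = _ := by
        rw [rho_Th, ← gw, rho_S_empty, rho_S_empty, sub_zero]; ring

theorem Gw_three_le (hl : 0 ≤ lam) :
    Gw d lam z 3 ≤ CF.K (gw d lam z 3 ^ 7) * Gw d lam z 0 ^ 8 := by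
  have hK : ∀ {a b : ℝ≥0∞}, a ≤ b → (CF.K a : CF d) ≤ CF.K b := by
    intro a b h v
    simp only [CF.K]
    split_ifs
    exacts [h, le_rfl]
  have h1 := (Gw_succ_le (d := d) lam z hl 0).trans
    (CF.mul_le_mul (hK (gw_mono lam z (show 0 + 1 ≤ 3 by norm_num))) le_rfl)
  have h2 := (Gw_succ_le (d := d) lam z hl 1).trans
    (CF.mul_le_mul (hK (gw_mono lam z (show 1 + 1 ≤ 3 by norm_num))) (CF.mul_le_mul h1 h1))
  have h3 := (Gw_succ_le (d := d) lam z hl 2).trans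
    (CF.mul_le_mul le_rfl (CF.mul_le_mul h2 h2))
  refine h3.trans (le_of_eq ?_)
  rw [← CF.K_pow]
  ring

theorem sum_Gw (F : CF d) : ∑ e : Stp d, ∑ e' : Stp d, F (stp e' - stp e) =
    (CF.N * (CF.N * F) : CF d) 0 := by
  rw [CF.N_mul, Finset.sum_congr rfl fun e _ => CF.N_mul' F (0 - stp e)]
  refine Finset.sum_congr rfl fun e _ => Finset.sum_congr rfl fun e' _ => ?_
  congr 1
  abel

theorem rho_rr_le (hl : 0 ≤ lam) (B : Finset (Pt d)) (x : Pt d) :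
    rho (wz 3 z) (rr lam B x) ≤
      ENNReal.ofReal lam * (27 * (z ^ 2 * (CF.N * (CF.N * Gw d lam z 3) : CF d) 0)) := by
  rw [rr, mul_assoc, rho_C_mul, Real.enorm_of_nonneg hl]
  gcongr
  refine (rho_mul_le' (wz_subM 3 z) _ _).trans ?_
  rw [rho_wz_X_sq, mul_assoc, ← sum_Gw]
  gcongr
  refine (rho_sum_le _ _ _).trans (Finset.sum_le_sum fun e _ => (rho_sum_le _ _ _).trans
    (Finset.sum_le_sum fun e' _ => ?_))
  refine (rho_S_le lam z hl 3 _ _ _).trans (le_of_eq ?_)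
  congr 1
  abel

/-- The smallness hypothesis on the weighted two-point function. -/
structure Small (d : ℕ) (lam : ℝ) (z : ℝ≥0) (s : ℝ≥0) : Prop where
  p_le : (z : ℝ≥0∞) * (2 * d) ≤ 2
  bub : ∀ v, (z : ℝ≥0∞) * (CF.N * (Gw d lam z 3 * Gw d lam z 3) : CF d) v ≤ s
  s_le : s ≤ 1 / 1000000
  ls_le : lam.toNNReal * s ≤ 1 / 1000000

variable {lam z} {s : ℝ≥0}

theorem N_iter_le (hp : (z : ℝ≥0∞) * (2 * d) ≤ 2) {F : CF d} {s : ℝ≥0∞}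
    (h : ∀ v, (z : ℝ≥0∞) * (CF.N * F : CF d) v ≤ s) (v : Pt d) :
    (z : ℝ≥0∞) ^ 2 * (CF.N * (CF.N * F) : CF d) v ≤ 2 * s := by
  have := CF.mul_apply_le (f := CF.K z * CF.N) (g := CF.K z * (CF.N * F)) (s := s)
    (fun w => by rw [CF.K_mul]; exact h w) v
  rw [CF.mass_mul, CF.mass_N] at this
  have hK : CF.mass (CF.K (z : ℝ≥0∞) : CF d) = z := by
    unfold CF.mass
    rw [tsum_eq_single 0]
    · simp [CF.K]
    · intro v hv; simp [CF.K, hv]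
  rw [hK] at this
  calc _ = (CF.K (z : ℝ≥0∞) * CF.N * (CF.K (z : ℝ≥0∞) * (CF.N * F)) : CF d) v := by
        have e : (CF.K (z : ℝ≥0∞) * CF.N * (CF.K (z : ℝ≥0∞) * (CF.N * F)) : CF d) =
            CF.K (z * z : ℝ≥0∞) * (CF.N * (CF.N * F)) := by
          rw [← CF.K_mul_K]; ring
        rw [e, CF.K_mul, sq]
    _ ≤ _ := this
    _ ≤ _ := by gcongr

theorem Gw_le_sq (hl : 0 ≤ lam) (p : ℕ) : Gw d lam z p ≤ Gw d lam z p * Gw d lam z p := by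
  conv_lhs => rw [← one_mul (Gw d lam z p)]
  exact CF.mul_le_mul (one_le_Gw lam z hl p) le_rfl

theorem Small.bub' (h : Small d lam z s) (hl : 0 ≤ lam) (v : Pt d) :
    (z : ℝ≥0∞) * (CF.N * Gw d lam z 3 : CF d) v ≤ s :=
  le_trans (mul_le_mul' le_rfl (CF.mul_le_mul le_rfl (Gw_le_sq hl 3) v)) (h.bub v)

theorem Small.rr_le (h : Small d lam z s) (hl : 0 ≤ lam) (B : Finset (Pt d)) (x : Pt d) :
    rho (wz 3 z) (rr lam B x) ≤ ((54 * (lam.toNNReal * s) : ℝ≥0) : ℝ≥0∞) := by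
  refine (rho_rr_le lam z hl B x).trans ?_
  calc _ ≤ ENNReal.ofReal lam * (27 * (2 * s)) :=
        mul_le_mul' le_rfl (mul_le_mul' le_rfl (N_iter_le h.p_le (h.bub' hl) 0))
    _ = _ := by
        rw [ENNReal.ofReal]
        push_cast; ring

theorem Small.gw_le (h : Small d lam z s) (hl : 0 ≤ lam) : gw d lam z 3 ≤ 2 := by
  refine rho_le_of_trunc fun n => ?_
  induction n with
  | zero => rw [rho_trunc_zero]; simp
  | succ n ih =>
    rw [gg_renewal lam (Finset.notMem_empty _)]
    have hX : X ∣ rr lam ∅ (0 : Pt d) :=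
      Dvd.dvd.mul_right (Dvd.dvd.mul_left (dvd_pow_self X two_ne_zero) _) _
    calc _ ≤ rho (trunc (n + 1) (wz 3 z)) (1 : PowerSeries ℝ) +
          rho (trunc (n + 1) (wz 3 z)) (rr lam ∅ (0 : Pt d) * gg lam ∅ 0) := rho_add_le _ _ _
      _ ≤ 1 + ((1 / 2 : ℝ≥0) : ℝ≥0∞) * 2 := by
          gcongr
          · refine (rho_trunc_le _ _ _).trans ?_
            rw [← map_one C, rho_C_one, nm_one, wz_zero, mul_one]
          · refine (rho_trunc_succ_mul_le (wz_subM 3 z) n _ _ hX).trans (mul_le_mul' ?_ ih)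
            refine (h.rr_le hl _ _).trans ?_
            have := h.ls_le
            norm_cast
            rw [← NNReal.coe_le_coe] at this ⊢
            push_cast at this ⊢
            linarith
      _ = 2 := by
          rw [show (2 : ℝ≥0∞) = ((2 : ℝ≥0) : ℝ≥0∞) by simp, ← ENNReal.coe_mul, ← ENNReal.coe_one,
            ← ENNReal.coe_add]
          norm_num

theorem Small.gg_sub_one_le (h : Small d lam z s) (hl : 0 ≤ lam) {B : Finset (Pt d)} {x : Pt d}
    (hx : x ∉ B) : rho (wz 3 z) (gg lam B x - 1) ≤ ((108 * (lam.toNNReal * s) : ℝ≥0) : ℝ≥0∞) := by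
  rw [sub_eq_iff_eq_add'.2 (gg_renewal lam hx)]
  calc _ ≤ _ := rho_mul_le' (wz_subM 3 z) _ _
    _ ≤ ((54 * (lam.toNNReal * s) : ℝ≥0) : ℝ≥0∞) * 2 := by
        gcongr
        · exact h.rr_le hl _ _
        · exact (rho_gg_le lam z hl 3 B x).trans (h.gw_le hl)
    _ = _ := by push_cast; ring

theorem hh_eq (y : Pt d) (hy : y ≠ 0) : hh lam y = gg lam ∅ y * gg lam {0} y * (C lam *
    ∑ e : Stp d, ∑ e' : Stp d, X ^ 2 * (S lam (insert y ∅) (y + stp e) (y + stp e') -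
      S lam (insert y {0}) (y + stp e) (y + stp e'))) := by
  have h1 := gg_renewal lam (Finset.notMem_empty y)
  have h2 := gg_renewal lam (B := {0}) (x := y) (by simpa using hy)
  have h3 : rr lam ∅ y - rr lam {0} y = C lam *
      ∑ e : Stp d, ∑ e' : Stp d, X ^ 2 * (S lam (insert y ∅) (y + stp e) (y + stp e') -
      S lam (insert y {0}) (y + stp e) (y + stp e')) := by
    rw [rr, rr]
    simp only [← Finset.mul_sum, Finset.sum_sub_distrib]
    ring
  rw [← h3, hh]
  linear_combination gg lam {0} y * h1 - gg lam ∅ y * h2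

theorem Small.hh_le (h : Small d lam z s) (hl : 0 ≤ lam) :
    ∑' y : Pt d, rho (wz 3 z) (hh lam y) ≤ 4 := by
  have hS := wz_subM 3 z
  have key : ∀ n, ∑' y : Pt d, rho (trunc n (wz 3 z)) (hh lam y) ≤ 4 := by
    intro n
    induction n with
    | zero => simp [rho_trunc_zero]
    | succ n ih =>
      have hpt : ∀ y : Pt d, rho (trunc (n + 1) (wz 3 z)) (hh lam y) ≤
          (if y = 0 then 2 else 0) + 2 * 2 * (ENNReal.ofReal lam * ∑ e : Stp d, ∑ e' : Stp d,
            ∑' b, 27 * z ^ 2 * (Gw d lam z 3 (b - (y + stp e)) * Gw d lam z 3 (y + stp e' - b)) *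
              rho (trunc n (wz 3 z)) (hh lam b)) := by
        intro y
        by_cases hy : y = 0
        · rw [if_pos hy, hy]
          refine le_add_right ((rho_trunc_le _ _ _).trans ?_)
          rw [hh, gg_of_mem lam (Finset.mem_singleton_self _), sub_zero]
          exact h.gw_le hl
        · rw [if_neg hy, zero_add, hh_eq y hy]
          refine (rho_trunc_mul_le hS _ _ _).trans (mul_le_mul' ?_ ?_)
          · refine (rho_trunc_le _ _ _).trans ((rho_mul_le' hS _ _).trans (mul_le_mul' ?_ ?_))
            · exact (rho_gg_le lam z hl 3 _ _).trans (h.gw_le hl)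
            · exact (rho_gg_le lam z hl 3 _ _).trans (h.gw_le hl)
          · rw [rho_C_mul, Real.enorm_of_nonneg hl]
            refine mul_le_mul' le_rfl ((rho_sum_le _ _ _).trans (Finset.sum_le_sum fun e _ =>
              (rho_sum_le _ _ _).trans (Finset.sum_le_sum fun e' _ => ?_)))
            refine (rho_S_sub_le lam hl _ (NN_X.pow 2) (Finset.insert_subset_insert _
              (Finset.empty_subset _)) 0 (fun w hw => ?_) _ _).trans
              (ENNReal.tsum_le_tsum fun b => ?_)
            · simp only [Finset.mem_sdiff, Finset.mem_insert, Finset.mem_singleton] at hw ⊢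
              tauto
            · rw [sub_zero, show (X ^ 2 * S lam (insert y ∅) (y + stp e) b *
                (hh lam b * S lam ∅ b (y + stp e')) : PowerSeries ℝ) =
                (X ^ 2 * (S lam (insert y ∅) (y + stp e) b * S lam ∅ b (y + stp e'))) * hh lam b by
                ring]
              refine (rho_trunc_succ_mul_le hS n _ _
                (Dvd.dvd.mul_right (dvd_pow_self X two_ne_zero) _)).trans (mul_le_mul' ?_ le_rfl)
              refine (rho_mul_le' hS _ _).trans (mul_le_mul' (rho_wz_X_sq z).le ?_)
              exact (rho_mul_le' hS _ _).trans (mul_le_mul' (rho_S_le lam z hl 3 _ _ _)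
                (rho_S_le lam z hl 3 _ _ _))
      refine (ENNReal.tsum_le_tsum hpt).trans ?_
      rw [ENNReal.tsum_add, tsum_ite_eq, ENNReal.tsum_mul_left, ENNReal.tsum_mul_left,
        Summable.tsum_finsetSum (fun i _ => ENNReal.summable)]
      have hin : ∀ e e' : Stp d, ∑' y : Pt d, ∑' b, 27 * (z : ℝ≥0∞) ^ 2 *
          (Gw d lam z 3 (b - (y + stp e)) * Gw d lam z 3 (y + stp e' - b)) *
            rho (trunc n (wz 3 z)) (hh lam b) ≤
          27 * (z : ℝ≥0∞) ^ 2 * (Gw d lam z 3 * Gw d lam z 3 : CF d) (stp e' - stp e) * 4 := by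
        intro e e'
        rw [ENNReal.tsum_comm]
        refine le_trans ?_ (mul_le_mul' le_rfl ih)
        rw [← ENNReal.tsum_mul_left]
        refine ENNReal.tsum_le_tsum fun b => ?_
        rw [ENNReal.tsum_mul_right, ENNReal.tsum_mul_left]
        gcongr
        rw [CF.mul_apply, ← (Equiv.subLeft (b - stp e)).tsum_eq]
        refine ENNReal.tsum_le_tsum fun y => ?_
        apply le_of_eq
        simp only [Equiv.subLeft_apply]
        congr 2 <;> abel
      calc _ ≤ 2 + 2 * 2 * (ENNReal.ofReal lam * ∑ e : Stp d, ∑ e' : Stp d,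
            27 * (z : ℝ≥0∞) ^ 2 * (Gw d lam z 3 * Gw d lam z 3 : CF d) (stp e' - stp e) * 4) := by
            gcongr with e
            rw [Summable.tsum_finsetSum (fun i _ => ENNReal.summable)]
            gcongr with e'
            exact hin e e'
        _ = 2 + 2 * 2 * (ENNReal.ofReal lam * (27 * ((z : ℝ≥0∞) ^ 2 *
            (CF.N * (CF.N * (Gw d lam z 3 * Gw d lam z 3)) : CF d) 0) * 4)) := by
            simp only [← Finset.mul_sum, ← Finset.sum_mul]
            rw [sum_Gw]
            ring
        _ ≤ 2 + 2 * 2 * (ENNReal.ofReal lam * (27 * (2 * s) * 4)) :=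
            add_le_add le_rfl (mul_le_mul' le_rfl (mul_le_mul' le_rfl (mul_le_mul'
              (mul_le_mul' le_rfl (N_iter_le h.p_le h.bub 0)) le_rfl)))
        _ ≤ 4 := by
            rw [ENNReal.ofReal]
            have := h.ls_le
            norm_cast
            rw [← NNReal.coe_le_coe] at this ⊢
            push_cast at this ⊢
            linarith
  rw [ENNReal.tsum_eq_iSup_sum]
  refine iSup_le fun D => ?_
  have : ∀ y : Pt d, rho (wz 3 z) (hh lam y) = ⨆ n, rho (trunc n (wz 3 z)) (hh lam y) := by
    intro y
    refine le_antisymm (rho_le_of_trunc fun n => le_iSup (fun n => rho (trunc n (wz 3 z))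
      (hh lam y)) n) (iSup_le fun n => rho_trunc_le _ _ _)
  simp only [this]
  rw [ENNReal.finsetSum_iSup_of_monotone]
  · refine iSup_le fun n => le_trans ?_ (key n)
    exact ENNReal.sum_le_tsum _
  · intro y m n hmn
    refine rho_mono_weight (fun k => ?_) _
    unfold trunc
    split_ifs <;> first | exact le_rfl | exact zero_le | omega

end Bounds

section Lace
open PowerSeries L1

variable {d : ℕ} (lam : ℝ)

theorem PS_ext {F H : PS d} (h : ∀ v, cX v F = cX v H) : F = H := by
  ext1 n
  refine AddMonoidAlgebra.ext (Finsupp.ext fun v => ?_)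
  rw [← coeff_cX, ← coeff_cX, h v]

theorem cX_sg_mul (u v : Pt d) (F : PS d) : cX v (F * sg u) = cX (v - u) F := by
  ext n
  rw [coeff_cX, coeff_cX, sg, coeff_mul_C,
    AddMonoidAlgebra.coeff_mul_single_eq_coeff_mul (v - u)
      (fun m' _ => eq_sub_iff_add_eq.symm), mul_one]

theorem sg_mul_Gk (u x : Pt d) : sg u * Gk lam {0} x = Gk lam {u} (u + x) := by
  refine PS_ext fun v => ?_
  have := S_singleton_sub lam u (u + x) v
  rw [add_sub_cancel_left] at this
  rw [mul_comm, cX_sg_mul]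
  exact this.symm

theorem sg_mul_Tk (u : Pt d) : sg u * Tk lam {0} 0 = Tk lam {u} u := by
  rw [Tk, Tk, mul_add, sg_mul, add_zero, mul_left_comm, Finset.mul_sum]
  simp only [sg_mul_Gk, zero_add]

theorem Gk_eq' (B : Finset (Pt d)) (x : Pt d) :
    Gk lam B x = io d (gg lam B x) * Tk lam (insert x B) x := by
  by_cases hx : x ∈ B
  · rw [Gk_of_mem lam hx, gg_of_mem lam hx, map_zero, zero_mul]
  · exact Gk_eq lam hx

theorem Tk_sub (B C : Finset (Pt d)) (u : Pt d) : Tk lam B u - Tk lam C u =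
    X * ∑ e : Stp d, (Gk lam B (u + stp e) - Gk lam C (u + stp e)) := by
  rw [Tk, Tk, Finset.sum_sub_distrib]
  ring

theorem constantCoeff_Tk : constantCoeff (Tk lam {0} (0 : Pt d)) = 1 := by
  rw [Tk, sg_zero]
  simp

variable (d) in
/-- Inverse of the reference series. -/
def Ti : PS d := invOfUnit (Tk lam {0} (0 : Pt d)) 1

theorem Tk_mul_Ti : Tk lam {0} (0 : Pt d) * Ti d lam = 1 :=
  mul_invOfUnit _ _ (by rw [constantCoeff_Tk]; rfl)

/-- Normalised series. -/
def Psi (B : Finset (Pt d)) (u : Pt d) : PS d := Tk lam B u * Ti d lam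

theorem Psi_singleton (u : Pt d) : Psi lam {u} u = sg u := by
  rw [Psi, ← sg_mul_Tk, mul_assoc, Tk_mul_Ti, mul_one]

theorem Psi_sub (B C : Finset (Pt d)) (u : Pt d) : Psi lam B u - Psi lam C u =
    ∑ e : Stp d, io d X * ((Gk lam B (u + stp e) - Gk lam C (u + stp e)) * Ti d lam) := by
  rw [Psi, Psi, ← sub_mul, Tk_sub, io_X, ← Finset.mul_sum, ← Finset.sum_mul, mul_assoc]

variable {lam} {z s : ℝ≥0}

theorem rho_Sp_le (hl : 0 ≤ lam) (b v : Pt d) :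
    rho (wz 3 z) (Sp lam b v) ≤ 8 * (z * (CF.N * Gw d lam z 3 : CF d) (v - b)) := by
  rw [Sp]
  refine (rho_mul_le' (wz_subM 3 z) _ _).trans ?_
  rw [rho_wz_X, mul_assoc, CF.N_mul]
  refine mul_le_mul' (by norm_num) (mul_le_mul' le_rfl ((rho_sum_le _ _ _).trans
    (Finset.sum_le_sum fun e _ => (rho_S_le lam z hl 3 _ _ _).trans (le_of_eq ?_))))
  congr 1; abel

/-- The error constant in the lace bound. -/
def q0 : ℝ≥0 := 1 / 3200

theorem tsum_hh_le (h : Small d lam z s) (hl : 0 ≤ lam) (D0 : Finset (Pt d)) :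
    ∑' v, rho (wz 3 z) (∑ a ∈ D0, hh lam (v - a)) ≤ 4 * D0.card := by
  refine (ENNReal.tsum_le_tsum fun v => rho_sum_le _ _ _).trans ?_
  rw [Summable.tsum_finsetSum (fun i _ => ENNReal.summable), mul_comm, ← nsmul_eq_mul]
  refine Finset.sum_le_card_nsmul _ _ _ fun a _ => ?_
  exact ((Equiv.subRight a).tsum_eq (fun y => rho (wz 3 z) (hh lam y))).trans_le (h.hh_le hl)

theorem Small.psi_le (h : Small d lam z s) (hl : 0 ≤ lam) {B : Finset (Pt d)} {u : Pt d}
    (hu : u ∉ B) : rho (wz 3 z) (Psi lam (insert u B) u - sg u) ≤ (q0 : ℝ≥0∞) * B.card := by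
  have hS := wz_subM 3 z
  refine rho_le_of_trunc fun n => ?_
  induction n generalizing B u with
  | zero => rw [rho_trunc_zero]; exact zero_le
  | succ n ih =>
    set w := wz 3 z with hw
    set Xf : PowerSeries ℝ → Finset (Pt d) → Finset (Pt d) → Pt d → ℝ≥0∞ := fun f B C x =>
      rho (trunc (n + 1) w) (io d f * ((Gk lam B x - Gk lam C x) * Ti d lam)) with hXf
    set y : Pt d → PowerSeries ℝ := fun v => ∑ a ∈ B, hh lam (v - a) with hy
    have hyN : ∀ v, NN (y v) := fun v => NN_sum fun a _ => NN_hh lam hl _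
    have hiod : ∀ {k : ℕ} {f : PowerSeries ℝ}, X ^ k ∣ f → X ^ k ∣ io d f := by
      intro k f hf
      have := map_dvd (io d) hf
      rwa [map_pow, io_X] at this
    have hd := duhamel lam hl w q0 hyN B 1 (n + 1) Xf
      (fun f B C x hf => rho_trunc_of_dvd w (Dvd.dvd.mul_right (hiod hf) _))
      (fun f B C x hx hBC => by
        simp only [hXf]
        rw [Gk_of_mem lam hx, Gk_of_mem lam (hBC hx), sub_zero, zero_mul, mul_zero, rho_zero])
      (fun f B' C x hf hf1 hBC hD hx => by
        simp only [hXf]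
        have e1 : io d f * ((Gk lam B' x - Gk lam C x) * Ti d lam) =
            io d (f * (gg lam B' x - gg lam C x)) * Psi lam (insert x B') x +
            ∑ e : Stp d, io d (f * (X * gg lam C x)) * ((Gk lam (insert x B') (x + stp e) -
              Gk lam (insert x C) (x + stp e)) * Ti d lam) := by
          rw [← Finset.mul_sum, ← Finset.sum_mul, map_mul, map_mul, map_mul, io_X, map_sub,
            Psi, Gk_eq' lam B', Gk_eq' lam C]
          linear_combination (io d f * io d (gg lam C x) * Ti d lam) *
            Tk_sub lam (insert x B') (insert x C) x
        rw [e1]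
        refine (rho_add_le _ _ _).trans (add_le_add ?_ (rho_sum_le _ _ _))
        have hX : X ∣ io d (f * (gg lam B' x - gg lam C x)) := by
          have := hiod (Dvd.dvd.mul_right hf1 (gg lam B' x - gg lam C x))
          rwa [pow_one] at this
        refine (rho_trunc_succ_mul_le hS n _ _ hX).trans ?_
        rw [mul_comm, rho_io]
        refine mul_le_mul' ?_ ?_
        · rw [← sub_add_cancel (Psi lam (insert x B') x) (sg x), add_comm]
          refine (rho_add_le _ _ _).trans (add_le_add ?_ (ih hx))
          refine (rho_trunc_le _ _ _).trans ?_
          rw [rho_sg, hw, wz_zero]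
        · have h0 : NN (gg lam B' x - gg lam C x) := cle_iff.1 (S_anti lam hl hBC _ _)
          refine rho_mono w (hf.mul h0) (((gg_sub_le lam hl hBC x).trans ?_).mul_left hf)
          rw [cle_iff, hy]
          simp only
          rw [← Finset.sum_sdiff hD, add_sub_cancel_right]
          exact NN_sum fun a _ => NN_hh lam hl _)
      X {u} (insert u B)
    have hBu : insert u B \ {u} ⊆ B := fun a ha => by
      simp only [Finset.mem_sdiff, Finset.mem_insert, Finset.mem_singleton] at ha
      tauto
    have hd' := fun x => hd x NN_X (by rw [pow_one]) (by simp) hBu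
    have e2 : rho (trunc (n + 1) w) (Psi lam (insert u B) u - sg u) ≤
        ∑ e : Stp d, Xf X {u} (insert u B) (u + stp e) := by
      rw [← rho_neg, neg_sub, ← Psi_singleton lam u, Psi_sub]
      exact rho_sum_le _ _ _
    have hG1 : ∀ v, rho w (Sp lam u v) ≤ 8 * s := fun v =>
      (rho_Sp_le hl _ _).trans (mul_le_mul' le_rfl (h.bub' hl _))
    have hG2 : ∀ v, ∑' b, rho w (Sp lam u b) * rho w (Sp lam b v) ≤ 128 * s := by
      intro v
      calc _ ≤ ∑' b, (8 * (z * (CF.N * Gw d lam z 3 : CF d) (b - u))) *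
            (8 * (z * (CF.N * Gw d lam z 3 : CF d) (v - b))) :=
            ENNReal.tsum_le_tsum fun b => mul_le_mul' (rho_Sp_le hl _ _) (rho_Sp_le hl _ _)
        _ = 64 * (z ^ 2 * (CF.N * Gw d lam z 3 * (CF.N * Gw d lam z 3) : CF d) (v - u)) := by
            rw [CF.mul_apply, ← (Equiv.addRight u).tsum_eq, ← ENNReal.tsum_mul_left,
              ← ENNReal.tsum_mul_left]
            refine tsum_congr fun b => ?_
            rw [Equiv.coe_addRight, add_sub_cancel_right, show v - (b + u) = v - u - b by abel]
            ring
        _ ≤ 64 * (2 * s) := by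
            refine mul_le_mul' le_rfl ?_
            have := N_iter_le h.p_le h.bub (v - u)
            rwa [show (CF.N * Gw d lam z 3 * (CF.N * Gw d lam z 3) : CF d) =
              CF.N * (CF.N * (Gw d lam z 3 * Gw d lam z 3)) by ring]
        _ = _ := by ring
    have hsum1 : ∀ (v : Pt d) (H : PowerSeries ℝ), NN H →
        ∑ e : Stp d, rho w (X * S lam {u} (u + stp e) v * H) = rho w (Sp lam u v * H) := by
      intro v H hH
      rw [← rho_sum w _ fun e _ => (NN_X.mul (NN_S lam hl _ _ _)).mul hH, Sp, ← Finset.sum_mul,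
        Finset.mul_sum]
    have hY := tsum_hh_le h hl B
    refine e2.trans ((Finset.sum_le_sum fun e _ => hd' _).trans ?_)
    rw [Finset.sum_add_distrib, ← Finset.mul_sum, ← Finset.mul_sum,
      ← Summable.tsum_finsetSum (fun i _ => ENNReal.summable),
      ← Summable.tsum_finsetSum (fun i _ => ENNReal.summable)]
    have t1 : ∑' v, ∑ e : Stp d, rho w (X * S lam {u} (u + stp e) v * y v) ≤
        8 * s * (4 * B.card) := by
      refine le_trans ?_ (mul_le_mul' le_rfl hY)
      rw [← ENNReal.tsum_mul_left]
      refine ENNReal.tsum_le_tsum fun v => ?_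
      rw [hsum1 v _ (hyN v)]
      exact (rho_mul_le' hS _ _).trans (mul_le_mul' (hG1 v) le_rfl)
    have t2 : ∑' v, ∑ e : Stp d, ∑' b, rho w (X * S lam {u} (u + stp e) b * (Sp lam b v * y v)) ≤
        128 * s * (4 * B.card) := by
      refine le_trans ?_ (mul_le_mul' le_rfl hY)
      rw [← ENNReal.tsum_mul_left]
      refine ENNReal.tsum_le_tsum fun v => ?_
      rw [← Summable.tsum_finsetSum (fun i _ => ENNReal.summable)]
      refine le_trans ?_ (mul_le_mul' (hG2 v) le_rfl)
      rw [← ENNReal.tsum_mul_right]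
      refine ENNReal.tsum_le_tsum fun b => ?_
      rw [hsum1 b _ ((NN_Sp lam hl _ _).mul (hyN v)), mul_assoc]
      exact (rho_mul_le' hS _ _).trans (mul_le_mul' le_rfl (rho_mul_le' hS _ _))
    calc _ ≤ (1 + (q0 : ℝ≥0∞) * ({u} : Finset (Pt d)).card) * (8 * s * (4 * B.card)) +
          q0 * (128 * s * (4 * B.card)) :=
          add_le_add (mul_le_mul' le_rfl t1) (mul_le_mul' le_rfl t2)
      _ = ((32 * s * (1 + q0) + 512 * q0 * s : ℝ≥0) : ℝ≥0∞) * B.card := by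
          rw [Finset.card_singleton]
          push_cast
          ring
      _ ≤ _ := by
          gcongr
          have := h.s_le
          rw [q0, ← NNReal.coe_le_coe] at *
          push_cast at this ⊢
          linarith

variable (d lam) in
/-- The lace-type series: `(1 - Phi) * T = 1`. -/
def Phi : PS d := 1 - Ti d lam

theorem one_sub_Phi_mul : (1 - Phi d lam) * Tk lam {0} 0 = 1 := by
  rw [Phi, sub_sub_cancel, mul_comm, Tk_mul_Ti]

theorem Phi_eq : Phi d lam = X * ∑ e : Stp d,
    io d (gg lam {0} (stp e)) * Psi lam (insert (stp e) {0}) (stp e) := by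
  have h1 : Phi d lam = (Tk lam {0} (0 : Pt d) - 1) * Ti d lam := by
    rw [sub_mul, Tk_mul_Ti, one_mul, Phi]
  rw [h1, Tk, sg_zero, add_sub_cancel_left, mul_assoc, Finset.sum_mul]
  simp only [zero_add]
  refine congrArg (X * ·) (Finset.sum_congr rfl fun e _ => ?_)
  rw [Gk_eq' lam {0}, Psi, mul_assoc]

theorem Small.phi_le (h : Small d lam z s) (hl : 0 ≤ lam) :
    rho (wz 3 z) (Phi d lam - X * ∑ e : Stp d, sg (stp e)) ≤ ((1 / 100 : ℝ≥0) : ℝ≥0∞) := by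
  have hS := wz_subM 3 z
  rw [Phi_eq, ← mul_sub, ← Finset.sum_sub_distrib]
  have key : ∀ e : Stp d, rho (wz 3 z) (io d (gg lam {0} (stp e)) *
      Psi lam (insert (stp e) {0}) (stp e) - sg (stp e)) ≤
      ((108 * (lam.toNNReal * s) * (1 + q0) + q0 : ℝ≥0) : ℝ≥0∞) := by
    intro e
    have he : stp e ∉ ({0} : Finset (Pt d)) := by simpa using stp_ne_zero e
    have hp := h.psi_le hl he
    rw [Finset.card_singleton, Nat.cast_one, mul_one] at hp
    have hp1 : rho (wz 3 z) (Psi lam (insert (stp e) {0}) (stp e)) ≤ 1 + q0 := by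
      rw [← sub_add_cancel (Psi lam (insert (stp e) {0}) (stp e)) (sg (stp e)), add_comm]
      refine (rho_add_le _ _ _).trans (add_le_add ?_ hp)
      rw [rho_sg, wz_zero]
    rw [show io d (gg lam {0} (stp e)) * Psi lam (insert (stp e) {0}) (stp e) - sg (stp e) =
      io d (gg lam {0} (stp e) - 1) * Psi lam (insert (stp e) {0}) (stp e) +
      (Psi lam (insert (stp e) {0}) (stp e) - sg (stp e)) by rw [map_sub, map_one]; ring]
    refine (rho_add_le _ _ _).trans ?_
    push_cast
    refine add_le_add ((rho_mul_le' hS _ _).trans (mul_le_mul' ?_ hp1)) hp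
    rw [rho_io]
    have := h.gg_sub_one_le hl he
    push_cast at this
    exact this
  refine (rho_X_mul_le hS _).trans ?_
  calc _ ≤ wz 3 z 1 * (2 * d * ((108 * (lam.toNNReal * s) * (1 + q0) + q0 : ℝ≥0) : ℝ≥0∞)) := by
        refine mul_le_mul' le_rfl ((rho_sum_le _ _ _).trans
          ((Finset.sum_le_card_nsmul _ _ _ fun e _ => key e).trans (le_of_eq ?_)))
        rw [nsmul_eq_mul]
        simp [mul_comm]
    _ = 8 * (z * (2 * d)) * ((108 * (lam.toNNReal * s) * (1 + q0) + q0 : ℝ≥0) : ℝ≥0∞) := by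
        rw [wz]; norm_num; ring
    _ ≤ 8 * 2 * ((108 * (lam.toNNReal * s) * (1 + q0) + q0 : ℝ≥0) : ℝ≥0∞) :=
        mul_le_mul' (mul_le_mul' le_rfl h.p_le) le_rfl
    _ ≤ _ := by
        have := h.ls_le
        norm_cast
        rw [q0]
        rw [← NNReal.coe_le_coe] at this ⊢
        push_cast at this ⊢
        linarith

end Lace

section Critical
open PowerSeries L1

variable {d : ℕ} (lam : ℝ)

theorem coeff_Gk_empty (n : ℕ) (x : Pt d) : coeff n (Gk lam ∅ x) = W lam ∅ n x [] := by
  rw [Gk_of_notMem lam (Finset.notMem_empty _), GW, coeff_mk]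

theorem nm_coeff_Gk (hl : 0 ≤ lam) (n : ℕ) :
    nm (coeff n (Gk lam ∅ (0 : Pt d))) = cN (constLam d lam) n := by
  rw [cN_eq hl, nm_LA, tv, integ, coeff_Gk_empty]
  refine tsum_congr fun v => ?_
  rw [one_mul, Real.enorm_of_nonneg (W_nonneg hl _ _ _ _ _)]

theorem chi_eq (hl : 0 ≤ lam) (z : ℝ) :
    chi (constLam d lam) z = rho (wz 0 z.toNNReal) (Gk lam ∅ (0 : Pt d)) := by
  rw [chi, rho]
  refine tsum_congr fun n => ?_
  rw [nm_coeff_Gk lam hl, wz, pow_zero, one_mul, mul_comm]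
  rfl

theorem mass_Gw (z : ℝ≥0) (p : ℕ) : CF.mass (Gw d lam z p) = rho (wz p z) (Gk lam ∅ (0 : Pt d)) := by
  rw [rho_eq_tsum_cX]; rfl

theorem mul_lt_one_of_chi (hl : 0 ≤ lam) {z : ℝ} (hz : chi (constLam d lam) z < ⊤) :
    (d : ℝ≥0∞) * ENNReal.ofReal z < 1 := by
  by_contra! h
  refine hz.ne (top_le_iff.1 ?_)
  calc (⊤ : ℝ≥0∞) = ∑' _ : ℕ, 1 := by rw [ENNReal.tsum_const_eq_top_of_ne_zero one_ne_zero]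
    _ ≤ _ := ENNReal.tsum_le_tsum fun n => ?_
  rw [cN_eq hl]
  calc (1 : ℝ≥0∞) ≤ ((d : ℝ≥0∞) * ENNReal.ofReal z) ^ n := one_le_pow₀ h
    _ = (d : ℝ≥0∞) ^ n * ENNReal.ofReal z ^ n := mul_pow _ _ _
    _ ≤ _ := mul_le_mul' (le_integ_W hl n 0 [] (by simp)) le_rfl

theorem bddAbove_chi (hl : 0 ≤ lam) (hd : 1 ≤ d) :
    BddAbove {z : ℝ | 0 ≤ z ∧ chi (constLam d lam) z < ⊤} := by
  refine ⟨1, fun z hz => ?_⟩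
  by_contra! h
  have := mul_lt_one_of_chi lam hl hz.2
  refine absurd this (not_lt.2 ?_)
  have h1 : (1 : ℝ≥0∞) ≤ ENNReal.ofReal z := by
    rw [← ENNReal.ofReal_one]; exact ENNReal.ofReal_le_ofReal h.le
  calc (1 : ℝ≥0∞) = 1 * 1 := by simp
    _ ≤ _ := mul_le_mul' (by exact_mod_cast hd) h1

theorem chi_eq_top (hl : 0 ≤ lam) (hd : 1 ≤ d) {z : ℝ} (hz : zc (constLam d lam) < z) (h0 : 0 ≤ z) :
    chi (constLam d lam) z = ⊤ := by
  by_contra h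
  exact not_lt.2 (le_csSup (bddAbove_chi lam hl hd) ⟨h0, lt_top_iff_ne_top.2 h⟩) hz

theorem zc_pos (hl : 0 ≤ lam) (hd : 1 ≤ d) : 0 < zc (constLam d lam) := by
  have hM : (0 : ℝ) < 2 * d * max 1 lam := by
    have : (1 : ℝ) ≤ d := by exact_mod_cast hd
    positivity
  refine lt_of_lt_of_le (show (0 : ℝ) < (2 * d * max 1 lam)⁻¹ * (1 / 2) by positivity)
    (le_csSup (bddAbove_chi lam hl hd) ⟨by positivity, ?_⟩)
  have : ∀ n : ℕ, cN (constLam d lam) n * ENNReal.ofReal ((2 * d * max 1 lam)⁻¹ * (1 / 2)) ^ n ≤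
      ENNReal.ofReal ((1 / 2) ^ n) := by
    intro n
    rw [cN_eq hl]
    refine (mul_le_mul' (integ_W_le hl n 0 []) le_rfl).trans (le_of_eq ?_)
    rw [← ENNReal.ofReal_pow (by positivity), ← ENNReal.ofReal_mul (by positivity), ← mul_pow]
    congr 2
    field_simp
  refine (ENNReal.tsum_le_tsum this).trans_lt ?_
  rw [← ENNReal.ofReal_tsum_of_nonneg (fun n => by positivity) summable_geometric_two]
  exact ENNReal.ofReal_lt_top

variable (d) in
/-- The critical point as a nonnegative real. -/
def zcN : ℝ≥0 := (zc (constLam d lam)).toNNReal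

theorem coe_zcN (hl : 0 ≤ lam) (hd : 1 ≤ d) : (zcN d lam : ℝ) = zc (constLam d lam) :=
  Real.coe_toNNReal _ (zc_pos lam hl hd).le

theorem chi_finite_nonempty (hl : 0 ≤ lam) :
    {z : ℝ | 0 ≤ z ∧ chi (constLam d lam) z < ⊤}.Nonempty := by
  refine ⟨0, le_rfl, ?_⟩
  rw [chi, tsum_eq_single 0 fun n hn => by simp [hn], cN_eq hl]
  simp [W, integ_single]

theorem exists_chi_lt (hl : 0 ≤ lam) (hd : 1 ≤ d) {z : ℝ≥0} (hz : z < zcN d lam) :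
    ∃ z' : ℝ≥0, z < z' ∧ rho (wz 0 z') (Gk lam ∅ (0 : Pt d)) < ⊤ := by
  have h1 : (z : ℝ) < zc (constLam d lam) := by rw [← coe_zcN lam hl hd]; exact_mod_cast hz
  obtain ⟨z', hz', hlt⟩ := exists_lt_of_lt_csSup (chi_finite_nonempty lam hl) h1
  refine ⟨z'.toNNReal, by rwa [Real.lt_toNNReal_iff_coe_lt], ?_⟩
  rw [← chi_eq lam hl]; exact hz'.2

theorem exists_poly_bound (p : ℕ) {z z' : ℝ≥0} (h : z < z') :
    ∃ C : ℝ≥0, ∀ n, wz p z n ≤ C * wz 0 z' n := by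
  have hz' : 0 < z' := h.bot_lt
  set r : ℝ := z / z' with hr
  have hr1 : |r| < 1 := by
    rw [hr, abs_of_nonneg (by positivity), div_lt_one (by exact_mod_cast hz')]
    exact_mod_cast h
  have hr0 : 0 ≤ r := by positivity
  obtain ⟨M, hM⟩ := (tendsto_pow_const_mul_const_pow_of_abs_lt_one p hr1).bddAbove_range
  have hM' : ∀ n : ℕ, (n : ℝ) ^ p * r ^ n ≤ M := fun n => hM ⟨n, rfl⟩
  have hM0 : 0 ≤ M := le_trans (by positivity) (hM' 0)
  refine ⟨(2 ^ p * (M + 1)).toNNReal, fun n => ?_⟩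
  have hreal : (1 + n : ℝ) ^ p * (z : ℝ) ^ n ≤ 2 ^ p * (M + 1) * (z' : ℝ) ^ n := by
    have h1 : (1 + n : ℝ) ^ p ≤ 2 ^ p * ((n : ℝ) ^ p + 1) := by
      rcases Nat.eq_zero_or_pos n with rfl | hn
      · simp only [Nat.cast_zero, add_zero, one_pow]
        have : (1 : ℝ) ≤ 2 ^ p := one_le_pow₀ (by norm_num)
        have h2 : (0 : ℝ) ≤ 0 ^ p := by positivity
        nlinarith
      · have hn' : (1 : ℝ) ≤ n := by exact_mod_cast hn
        calc (1 + n : ℝ) ^ p ≤ (2 * n) ^ p := by gcongr; linarith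
          _ = 2 ^ p * (n : ℝ) ^ p := mul_pow _ _ _
          _ ≤ _ := mul_le_mul_of_nonneg_left (by linarith) (by positivity)
    have h2 : (z : ℝ) = r * z' := by rw [hr]; field_simp
    rw [h2, mul_pow, ← mul_assoc]
    refine mul_le_mul_of_nonneg_right ?_ (by positivity)
    calc _ ≤ 2 ^ p * ((n : ℝ) ^ p + 1) * r ^ n := mul_le_mul_of_nonneg_right h1 (by positivity)
      _ = 2 ^ p * ((n : ℝ) ^ p * r ^ n + r ^ n) := by ring
      _ ≤ _ := mul_le_mul_of_nonneg_left
        (add_le_add (hM' n) (pow_le_one₀ hr0 (abs_of_nonneg hr0 ▸ hr1).le)) (by positivity)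
  rw [wz, wz, pow_zero, one_mul]
  have h3 : ((1 + n) ^ p * z ^ n : ℝ≥0) ≤ (2 ^ p * (M + 1)).toNNReal * z' ^ n := by
    rw [← NNReal.coe_le_coe]
    push_cast
    rw [Real.coe_toNNReal _ (by positivity)]
    exact hreal
  exact_mod_cast h3

theorem rho_Gk_lt_top (hl : 0 ≤ lam) (hd : 1 ≤ d) {z : ℝ≥0} (hz : z < zcN d lam) (p : ℕ) :
    rho (wz p z) (Gk lam ∅ (0 : Pt d)) < ⊤ := by
  obtain ⟨z', h, h'⟩ := exists_chi_lt lam hl hd hz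
  obtain ⟨C, hC⟩ := exists_poly_bound p h
  refine (ENNReal.tsum_le_tsum fun n => mul_le_mul' (hC n) le_rfl).trans_lt ?_
  simp only [mul_assoc]
  rw [ENNReal.tsum_mul_left]
  exact ENNReal.mul_lt_top ENNReal.coe_lt_top h'

theorem two_d_mul_le (hl : 0 ≤ lam) (hd : 1 ≤ d) {z : ℝ≥0} (hz : z ≤ zcN d lam) :
    (z : ℝ≥0∞) * (2 * d) ≤ 2 := by
  have h1 : zc (constLam d lam) ≤ 1 / d := by
    refine csSup_le (chi_finite_nonempty lam hl) (fun y hy => ?_)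
    have := mul_lt_one_of_chi lam hl hy.2
    have hd' : (0 : ℝ) < d := by exact_mod_cast hd
    rw [le_div_iff₀ hd']
    have h3 : ENNReal.ofReal (d * y) < 1 := by
      rwa [ENNReal.ofReal_mul hd'.le, ENNReal.ofReal_natCast]
    rw [ENNReal.ofReal_lt_one] at h3
    linarith
  have h2 : (z : ℝ) * d ≤ 1 := by
    have hd' : (0 : ℝ) < d := by exact_mod_cast hd
    rw [← le_div_iff₀ hd']
    exact le_trans (by exact_mod_cast hz) ((coe_zcN lam hl hd).trans_le h1)
  have h3 : z * (2 * d) ≤ (2 : ℝ≥0) := by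
    rw [← NNReal.coe_le_coe]
    push_cast
    linarith
  exact_mod_cast h3

end Critical

section Bootstrap

/-- Functions given by a power series with coefficients in `[0,∞]`. -/
def IsPS (f : ℝ≥0 → ℝ≥0∞) : Prop := ∃ b : ℕ → ℝ≥0∞, ∀ z, f z = ∑' n, b n * (z : ℝ≥0∞) ^ n

theorem IsPS.tsum {ι : Type*} {f : ι → ℝ≥0 → ℝ≥0∞} (h : ∀ i, IsPS (f i)) :
    IsPS fun z => ∑' i, f i z := by
  choose b hb using h
  refine ⟨fun n => ∑' i, b i n, fun z => ?_⟩
  simp only [hb, ← ENNReal.tsum_mul_right]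
  exact ENNReal.tsum_comm

theorem IsPS.mul {f g : ℝ≥0 → ℝ≥0∞} (hf : IsPS f) (hg : IsPS g) : IsPS fun z => f z * g z := by
  obtain ⟨a, ha⟩ := hf
  obtain ⟨b, hb⟩ := hg
  refine ⟨fun n => ∑ p ∈ Finset.HasAntidiagonal.antidiagonal n, a p.1 * b p.2, fun z => ?_⟩
  have : ∀ n, (∑ p ∈ Finset.HasAntidiagonal.antidiagonal n, a p.1 * b p.2) * (z : ℝ≥0∞) ^ n =
      ∑ p ∈ Finset.HasAntidiagonal.antidiagonal n,
        (a p.1 * (z : ℝ≥0∞) ^ p.1) * (b p.2 * (z : ℝ≥0∞) ^ p.2) := by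
    intro n
    rw [Finset.sum_mul]
    refine Finset.sum_congr rfl fun p hp => ?_
    rw [← Finset.HasAntidiagonal.mem_antidiagonal.1 hp, pow_add]
    ring
  simp only [this]
  rw [tsum_antidiagonal (fun p => (a p.1 * (z : ℝ≥0∞) ^ p.1) * (b p.2 * (z : ℝ≥0∞) ^ p.2)),
    ENNReal.tsum_prod (f := fun i j => (a i * (z : ℝ≥0∞) ^ i) * (b j * (z : ℝ≥0∞) ^ j)), ha, hb, ← ENNReal.tsum_mul_right]
  exact tsum_congr fun i => ENNReal.tsum_mul_left.symm

theorem IsPS.monomial (c : ℝ≥0∞) (m : ℕ) : IsPS fun z => c * (z : ℝ≥0∞) ^ m :=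
  ⟨fun n => if n = m then c else 0, fun z => by
    rw [tsum_eq_single m fun n hn => by simp [hn]]; simp⟩

theorem IsPS.const (c : ℝ≥0∞) : IsPS fun _ => c := by
  simpa using IsPS.monomial c 0

theorem IsPS.mono {f : ℝ≥0 → ℝ≥0∞} (hf : IsPS f) {z z' : ℝ≥0} (h : z ≤ z') : f z ≤ f z' := by
  obtain ⟨b, hb⟩ := hf
  rw [hb, hb]
  exact ENNReal.tsum_le_tsum fun n => by gcongr

theorem IsPS.le_of_lt {f : ℝ≥0 → ℝ≥0∞} (hf : IsPS f) {z₀ : ℝ≥0} (h0 : 0 < z₀) {K : ℝ≥0∞}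
    (h : ∀ z < z₀, f z ≤ K) : f z₀ ≤ K := by
  obtain ⟨b, hb⟩ := hf
  rw [hb]
  refine ENNReal.tsum_le_of_sum_range_le fun n => ?_
  by_cases htop : ∃ i, b i = ⊤
  · obtain ⟨i, hi⟩ := htop
    have h1 := h (z₀ / 2) (NNReal.half_lt_self h0.ne')
    rw [hb] at h1
    have h2 : b i * ((z₀ / 2 : ℝ≥0) : ℝ≥0∞) ^ i = ⊤ := by
      rw [hi, ENNReal.top_mul]
      exact pow_ne_zero _ (by simpa using h0.ne')
    have h3 := (ENNReal.le_tsum i).trans h1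
    rw [h2] at h3
    rw [top_le_iff.1 h3]
    exact le_top
  · push Not at htop
    have hc : Continuous fun z : ℝ≥0 => ∑ i ∈ Finset.range n, b i * (z : ℝ≥0∞) ^ i := by
      refine continuous_finsetSum _ fun i _ => ?_
      refine (ENNReal.continuous_const_mul (htop i)).comp ?_
      exact (ENNReal.continuous_pow i).comp ENNReal.continuous_coe
    have hmem : z₀ ∈ closure (Set.Iio z₀) := by
      rw [closure_Iio' (a := z₀) ⟨(0 : ℝ≥0), h0⟩]; exact Set.mem_Iic.2 (le_refl z₀)
    exact le_on_closure (f := fun z : ℝ≥0 => ∑ i ∈ Finset.range n, b i * (z : ℝ≥0∞) ^ i)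
      (g := fun _ => K) (fun z hz => (ENNReal.sum_le_tsum _).trans ((hb z).symm.le.trans (h z hz)))
      hc.continuousOn continuousOn_const hmem

theorem IsPS.continuousOn {f : ℝ≥0 → ℝ≥0∞} (hf : IsPS f) {z₀ : ℝ≥0} (h : f z₀ < ⊤) :
    ContinuousOn f (Set.Icc 0 z₀) := by
  rcases eq_or_ne z₀ 0 with rfl | hz0
  · simp
  obtain ⟨b, hb⟩ := hf
  have hne : ∑' n, b n * (z₀ : ℝ≥0∞) ^ n ≠ ⊤ := by rw [← hb]; exact h.ne
  have hbt : ∀ n, b n ≠ ⊤ := fun n hn => by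
    refine hne (top_le_iff.1 (le_trans (le_of_eq ?_) (ENNReal.le_tsum n)))
    rw [hn, ENNReal.top_mul (pow_ne_zero _ (by simpa using hz0))]
  have hs : Summable fun n => (b n).toReal * (z₀ : ℝ) ^ n := by
    simpa using ENNReal.summable_toReal hne
  have hc : ContinuousOn (fun z : ℝ≥0 => ENNReal.ofReal (∑' n, (b n).toReal * (z : ℝ) ^ n))
      (Set.Icc 0 z₀) := by
    refine ENNReal.continuous_ofReal.comp_continuousOn (continuousOn_tsum (fun n => ?_) hs
      fun n z hz => ?_)
    · exact (continuous_const.mul (NNReal.continuous_coe.pow n)).continuousOn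
    · rw [Real.norm_of_nonneg (by positivity)]
      gcongr
      exact hz.2
  refine hc.congr fun z hz => ?_
  beta_reduce
  rw [hb, ENNReal.ofReal_tsum_of_nonneg (fun n => by positivity)]
  · refine tsum_congr fun n => ?_
    rw [ENNReal.ofReal_mul (by positivity), ENNReal.ofReal_toReal (hbt n),
      ENNReal.ofReal_pow (by positivity), ENNReal.ofReal_coe_nnreal]
  · refine hs.of_nonneg_of_le (fun n => by positivity) fun n => ?_
    gcongr
    exact hz.2

theorem IsPS.bootstrap {f : ℝ≥0 → ℝ≥0∞} (hf : IsPS f) {z₀ : ℝ≥0} (h0 : 0 < z₀) {a b : ℝ≥0∞}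
    (hab : a < b) (hf0 : f 0 ≤ b) (hfin : ∀ z < z₀, f z < ⊤) (himp : ∀ z < z₀, f z ≤ b → f z ≤ a) :
    f z₀ ≤ a := by
  refine hf.le_of_lt h0 fun z hz => himp z hz ?_
  by_contra! hlt
  obtain ⟨t, ht, hft⟩ := intermediate_value_Icc (zero_le : 0 ≤ z) (hf.continuousOn (hfin z hz))
    (⟨hf0, hlt.le⟩ : b ∈ Set.Icc (f 0) (f z))
  have := himp t (ht.2.trans_lt hz) hft.le
  rw [hft] at this
  exact absurd this (not_le.2 hab)

theorem isPS_rho (p : ℕ) (F : PowerSeries ℝ) : IsPS fun z => rho (wz p z) F :=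
  ⟨fun n => (1 + n : ℝ≥0∞) ^ p * L1.nm (PowerSeries.coeff n F), fun z => tsum_congr fun n => by
    rw [wz]; ring⟩

variable {d : ℕ}

theorem IsPS.cf_mul {F H : ℝ≥0 → CF d} (hF : ∀ v, IsPS fun z => F z v) (hH : ∀ v, IsPS fun z => H z v)
    (v : Pt d) : IsPS fun z => (F z * H z) v :=
  IsPS.tsum fun w => (hF w).mul (hH (v - w))

theorem IsPS.cf_pow {F : ℝ≥0 → CF d} (hF : ∀ v, IsPS fun z => F z v) (n : ℕ)
    (v : Pt d) : IsPS fun z => (F z ^ n) v := by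
  induction n generalizing v with
  | zero => simp only [pow_zero]; exact IsPS.const _
  | succ n ih => simp only [pow_succ]; exact IsPS.cf_mul ih hF v

variable (d) in
/-- The bootstrap function. -/
def bet (lam : ℝ) (z : ℝ≥0) : ℝ≥0∞ := (z : ℝ≥0∞) ^ 2 * (CF.N * CF.N * Gw d lam z 3 ^ 4 : CF d) 0

theorem isPS_bet (lam : ℝ) : IsPS (bet d lam) := by
  refine IsPS.mul ?_ ?_
  · simpa using IsPS.monomial 1 2
  · exact IsPS.cf_mul (F := fun _ => CF.N * CF.N) (H := fun z => Gw d lam z 3 ^ 4) (fun v => IsPS.const _) (IsPS.cf_pow (F := fun z => Gw d lam z 3) (fun v => isPS_rho 3 _) 4) 0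

theorem bet_lt_top {lam : ℝ} (hl : 0 ≤ lam) (hd : 1 ≤ d) {z : ℝ≥0} (hz : z < zcN d lam) :
    bet d lam z < ⊤ := by
  refine ENNReal.mul_lt_top (by simp) ((CF.le_mass _ _).trans_lt ?_)
  have h4 : Gw d lam z 3 ^ 4 = Gw d lam z 3 * Gw d lam z 3 * (Gw d lam z 3 * Gw d lam z 3) := by ring
  have hm : CF.mass (Gw d lam z 3) < ⊤ := by
    rw [mass_Gw]; exact rho_Gk_lt_top lam hl hd hz 3
  have hN : CF.mass (CF.N : CF d) < ⊤ := by
    rw [CF.mass_N]; exact ENNReal.mul_lt_top (by simp) (by simp)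
  rw [h4]
  simp only [CF.mass_mul]
  exact ENNReal.mul_lt_top (ENNReal.mul_lt_top hN hN) (ENNReal.mul_lt_top
    (ENNReal.mul_lt_top hm hm) (ENNReal.mul_lt_top hm hm))

theorem bub_of_bet {lam : ℝ} {z s : ℝ≥0} (h : bet d lam z ≤ (s : ℝ≥0∞) ^ 2) (v : Pt d) :
    (z : ℝ≥0∞) * (CF.N * (Gw d lam z 3 * Gw d lam z 3) : CF d) v ≤ s := by
  have hE : CF.Ev (CF.K (z : ℝ≥0∞) * (CF.N * (Gw d lam z 3 * Gw d lam z 3)) : CF d) := by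
    intro w
    rw [CF.K_mul, CF.K_mul, (CF.Ev_N.mul ((Ev_Gw lam z 3).mul (Ev_Gw lam z 3))) w]
  have h1 := hE.sq_le v
  rw [CF.K_mul, show (CF.K (z : ℝ≥0∞) * (CF.N * (Gw d lam z 3 * Gw d lam z 3)) *
    (CF.K (z : ℝ≥0∞) * (CF.N * (Gw d lam z 3 * Gw d lam z 3))) : CF d) =
    CF.K (z * z : ℝ≥0∞) * (CF.N * CF.N * Gw d lam z 3 ^ 4) by rw [← CF.K_mul_K]; ring,
    CF.K_mul, ← sq (z : ℝ≥0∞)] at h1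
  exact (ENNReal.pow_le_pow_left_iff two_ne_zero).1 (h1.trans h)

end Bootstrap

section Characters
open PowerSeries L1

variable {d : ℕ}

/-- The spectral gap function of the nearest-neighbour step distribution. -/
def gap (k : Fin d → ℝ) : ℝ := (∑ j, (1 - Real.cos (k j))) / d

theorem gap_nonneg (k : Fin d → ℝ) : 0 ≤ gap k :=
  div_nonneg (Finset.sum_nonneg fun _ _ => sub_nonneg.2 (Real.cos_le_one _)) (Nat.cast_nonneg _)

theorem gap_le_two (k : Fin d → ℝ) : gap k ≤ 2 := by
  refine div_le_of_le_mul₀ (Nat.cast_nonneg _) zero_le_two ?_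
  calc ∑ j, (1 - Real.cos (k j)) ≤ ∑ _ : Fin d, (2 : ℝ) :=
        Finset.sum_le_sum fun i _ => by linarith [Real.neg_one_le_cos (k i)]
    _ = 2 * d := by simp [mul_comm]

/-- The pairing of a frequency with a lattice point. -/
def dt (k : Fin d → ℝ) (v : Pt d) : ℝ := ∑ j, k j * v j

theorem dt_add (k : Fin d → ℝ) (v w : Pt d) : dt k (v + w) = dt k v + dt k w := by
  simp [dt, mul_add, Finset.sum_add_distrib]

theorem abs_sin_nat_mul_le (n : ℕ) (x : ℝ) : |Real.sin (n * x)| ≤ n * |Real.sin x| := by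
  induction n with
  | zero => simp
  | succ n ih =>
    push_cast
    rw [add_mul, one_mul, Real.sin_add, add_mul, one_mul]
    refine (abs_add_le _ _).trans (add_le_add ?_ ?_)
    · rw [abs_mul]
      exact (mul_le_of_le_one_right (abs_nonneg _) (Real.abs_cos_le_one _)).trans ih
    · rw [abs_mul]
      exact mul_le_of_le_one_left (abs_nonneg _) (Real.abs_cos_le_one _)

theorem abs_sin_mul_int_le (n : ℤ) (x : ℝ) : |Real.sin (x * n)| ≤ n.natAbs * |Real.sin x| := by
  obtain ⟨m, rfl | rfl⟩ := Int.eq_nat_or_neg n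
  · rw [mul_comm, Int.cast_natCast, Int.natAbs_natCast]
    exact abs_sin_nat_mul_le m x
  · rw [Int.cast_neg, mul_neg, Real.sin_neg, abs_neg, mul_comm, Int.cast_natCast, Int.natAbs_neg,
      Int.natAbs_natCast]
    exact abs_sin_nat_mul_le m x

theorem abs_sin_sum_le {ι : Type*} (s : Finset ι) (f : ι → ℝ) :
    |Real.sin (∑ i ∈ s, f i)| ≤ ∑ i ∈ s, |Real.sin (f i)| := by
  induction s using Finset.induction_on with
  | empty => simp
  | insert a s ha ih =>
    rw [Finset.sum_insert ha, Finset.sum_insert ha, Real.sin_add]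
    refine (abs_add_le _ _).trans (add_le_add ?_ ?_)
    · rw [abs_mul]
      exact mul_le_of_le_one_right (abs_nonneg _) (Real.abs_cos_le_one _)
    · rw [abs_mul]
      exact (mul_le_of_le_one_left (abs_nonneg _) (Real.abs_cos_le_one _)).trans ih

theorem one_sub_cos_eq (x : ℝ) : 1 - Real.cos x = 2 * Real.sin (x / 2) ^ 2 := by
  have := Real.cos_two_mul (x / 2)
  rw [mul_div_cancel₀ x two_ne_zero] at this
  rw [this, Real.cos_sq']; ring

theorem one_sub_cos_dt_le (k : Fin d → ℝ) (v : Pt d) :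
    1 - Real.cos (dt k v) ≤ dist1 0 v * ∑ j, ((v j).natAbs : ℝ) * (1 - Real.cos (k j)) := by
  have h1 : |Real.sin (dt k v / 2)| ≤ ∑ j, ((v j).natAbs : ℝ) * |Real.sin (k j / 2)| := by
    have : dt k v / 2 = ∑ j, k j / 2 * v j := by
      rw [dt, Finset.sum_div]; exact Finset.sum_congr rfl fun j _ => by ring
    rw [this]
    exact (abs_sin_sum_le _ _).trans (Finset.sum_le_sum fun j _ => abs_sin_mul_int_le _ _)
  have h2 : (∑ j, ((v j).natAbs : ℝ) * |Real.sin (k j / 2)|) ^ 2 ≤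
      (∑ j, ((v j).natAbs : ℝ)) * ∑ j, ((v j).natAbs : ℝ) * Real.sin (k j / 2) ^ 2 := by
    refine Finset.sum_sq_le_sum_mul_sum_of_sq_le_mul _ (fun j _ => by positivity)
      (fun j _ => by positivity) fun j _ => le_of_eq ?_
    rw [mul_pow, sq_abs]; ring
  have h3 : (dist1 0 v : ℝ) = ∑ j, ((v j).natAbs : ℝ) := by
    simp [dist1]
  simp only [one_sub_cos_eq]
  rw [h3]
  calc 2 * Real.sin (dt k v / 2) ^ 2 = 2 * |Real.sin (dt k v / 2)| ^ 2 := by rw [sq_abs]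
    _ ≤ 2 * (∑ j, ((v j).natAbs : ℝ) * |Real.sin (k j / 2)|) ^ 2 := by gcongr
    _ ≤ _ := mul_le_mul_of_nonneg_left h2 zero_le_two
    _ = _ := by rw [mul_left_comm, Finset.mul_sum]; simp only [mul_left_comm]

/-- A lattice-indexed coefficient family invariant under coordinate permutations. -/
def PermInv (a : LA d) : Prop :=
  ∀ (π : Equiv.Perm (Fin d)) (v : Pt d), a.coeff (Equiv.piCongrLeft (fun _ => ℤ) π v) = a.coeff v

theorem sum_coord_eq {a : LA d} (ha : PermInv a) (i j : Fin d) :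
    ∑' v, |a.coeff v| * ((v i).natAbs : ℝ) = ∑' v, |a.coeff v| * ((v j).natAbs : ℝ) := by
  rw [← (Equiv.piCongrLeft (fun _ => ℤ) (Equiv.swap i j)).tsum_eq
    fun v : Pt d => |a.coeff v| * ((v i).natAbs : ℝ)]
  refine tsum_congr fun v => ?_
  rw [ha]
  congr 3
  have := Equiv.piCongrLeft_apply_apply (fun _ : Fin d => ℤ) (Equiv.swap i j) v j
  rw [Equiv.swap_apply_right] at this
  rw [this]

theorem tv_toReal (a : LA d) : (tv a).toReal = ∑ v ∈ a.coeff.support, |a.coeff v| := by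
  rw [tv_eq_sum, ENNReal.toReal_sum (by simp)]
  simp

theorem sum_one_sub_cos_le {a : LA d} (ha : PermInv a) {n : ℕ}
    (hs : ∀ v, n < dist1 0 v → a.coeff v = 0) (k : Fin d → ℝ) :
    ∑ v ∈ a.coeff.support, |a.coeff v| * (1 - Real.cos (dt k v)) ≤
      (n : ℝ) ^ 2 * (tv a).toReal * gap k := by
  rcases Nat.eq_zero_or_pos d with rfl | hd
  · have : ∀ v : Pt 0, dt k v = 0 := fun v => by simp [dt]
    simp [this, gap]
  have hd' : (0 : ℝ) < d := by exact_mod_cast hd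
  have hle : ∀ v ∈ a.coeff.support, dist1 0 v ≤ n := fun v hv => by
    by_contra! h; exact (Finsupp.mem_support_iff.1 hv) (hs v h)
  set M : Fin d → ℝ := fun j => ∑ v ∈ a.coeff.support, |a.coeff v| * ((v j).natAbs : ℝ) with hM
  have hMt : ∀ j, M j = ∑' v, |a.coeff v| * ((v j).natAbs : ℝ) := fun j =>
    (tsum_eq_sum fun v hv => by rw [Finsupp.notMem_support_iff.1 hv]; simp).symm
  have hMs : ∑ j, M j ≤ n * (tv a).toReal := by
    simp only [hM]
    rw [Finset.sum_comm, tv_toReal, Finset.mul_sum]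
    refine Finset.sum_le_sum fun v hv => ?_
    rw [← Finset.mul_sum, mul_comm]
    refine mul_le_mul_of_nonneg_right ?_ (abs_nonneg _)
    have := hle v hv
    simp only [dist1, Pi.zero_apply, zero_sub, Int.natAbs_neg] at this
    exact_mod_cast this
  have hMj : ∀ j, M j ≤ n * (tv a).toReal / d := fun j => by
    rw [le_div_iff₀ hd']
    refine le_trans (le_of_eq ?_) hMs
    rw [Finset.sum_congr rfl fun i _ => (hMt i).trans ((sum_coord_eq ha i j).trans (hMt j).symm)]
    simp [mul_comm]
  calc ∑ v ∈ a.coeff.support, |a.coeff v| * (1 - Real.cos (dt k v))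
      ≤ ∑ v ∈ a.coeff.support, n * ∑ j, |a.coeff v| * (((v j).natAbs : ℝ) * (1 - Real.cos (k j))) := by
        refine Finset.sum_le_sum fun v hv => ?_
        rw [← Finset.mul_sum, mul_left_comm]
        refine mul_le_mul_of_nonneg_left ((one_sub_cos_dt_le k v).trans ?_) (abs_nonneg _)
        refine mul_le_mul_of_nonneg_right (by exact_mod_cast hle v hv) ?_
        exact Finset.sum_nonneg fun j _ =>
          mul_nonneg (Nat.cast_nonneg _) (sub_nonneg.2 (Real.cos_le_one _))
    _ = n * ∑ j, M j * (1 - Real.cos (k j)) := by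
        rw [← Finset.mul_sum, Finset.sum_comm]
        simp only [hM, Finset.sum_mul, mul_assoc]
    _ ≤ n * ∑ j, (n * (tv a).toReal / d) * (1 - Real.cos (k j)) := by
        refine mul_le_mul_of_nonneg_left (Finset.sum_le_sum fun j _ => ?_) (Nat.cast_nonneg _)
        exact mul_le_mul_of_nonneg_right (hMj j) (sub_nonneg.2 (Real.cos_le_one _))
    _ = _ := by rw [← Finset.mul_sum, gap]; ring

/-- The character with frequency `k`. -/
def chk (k : Fin d → ℝ) : Multiplicative (Pt d) →* ℂ where
  toFun v := Complex.exp (dt k v.toAdd * Complex.I)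
  map_one' := by simp [dt]
  map_mul' v w := by
    rw [toAdd_mul, dt_add, ← Complex.exp_add]; push_cast; ring_nf

theorem norm_chk (k : Fin d → ℝ) (v) : ‖chk k v‖ = 1 := by
  simp only [chk, MonoidHom.coe_mk, OneHom.coe_mk]
  exact Complex.norm_exp_ofReal_mul_I _

theorem chk_re (k : Fin d → ℝ) (v : Pt d) : (chk k (.ofAdd v)).re = Real.cos (dt k v) := by
  simp only [chk, MonoidHom.coe_mk, OneHom.coe_mk, toAdd_ofAdd]
  exact Complex.exp_ofReal_mul_I_re _

theorem chk_zero (v) : chk (0 : Fin d → ℝ) v = 1 := by simp [chk, dt]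

/-- Fourier evaluation. -/
def phk (k : Fin d → ℝ) : LA d →ₐ[ℝ] ℂ := AddMonoidAlgebra.lift ℝ ℂ (Pt d) (chk k)

theorem phk_single (k : Fin d → ℝ) (v : Pt d) (c : ℝ) :
    phk k (AddMonoidAlgebra.single v c) = c * chk k (.ofAdd v) := by
  rw [phk, AddMonoidAlgebra.lift_single]; simp

theorem phk_apply (k : Fin d → ℝ) (a : LA d) :
    phk k a = ∑ v ∈ a.coeff.support, (a.coeff v : ℂ) * chk k (.ofAdd v) := by
  conv_lhs => rw [LA_eq_sum a]
  rw [map_sum]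
  exact Finset.sum_congr rfl fun v _ => phk_single k v _

theorem norm_phk_le (k : Fin d → ℝ) (a : LA d) : ‖phk k a‖ ≤ (tv a).toReal := by
  rw [phk_apply, tv_toReal]
  refine (norm_sum_le _ _).trans (Finset.sum_le_sum fun v _ => ?_)
  rw [norm_mul, norm_chk, mul_one, Complex.norm_real, Real.norm_eq_abs]

theorem phk_re (k : Fin d → ℝ) (a : LA d) :
    (phk k a).re = ∑ v ∈ a.coeff.support, a.coeff v * Real.cos (dt k v) := by
  rw [phk_apply, Complex.re_sum]
  refine Finset.sum_congr rfl fun v _ => ?_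
  rw [Complex.re_ofReal_mul, chk_re]

theorem phk_re_sub_le {a : LA d} (ha : PermInv a) {n : ℕ}
    (hs : ∀ v, n < dist1 0 v → a.coeff v = 0) (k : Fin d → ℝ) :
    |(phk 0 a).re - (phk k a).re| ≤ (n : ℝ) ^ 2 * (tv a).toReal * gap k := by
  refine le_trans ?_ (sum_one_sub_cos_le ha hs k)
  rw [phk_re, phk_re, ← Finset.sum_sub_distrib]
  refine (Finset.abs_sum_le_sum_abs _ _).trans (Finset.sum_le_sum fun v _ => le_of_eq ?_)
  have : dt (0 : Fin d → ℝ) v = 0 := by simp [dt]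
  rw [this, Real.cos_zero, ← mul_sub, abs_mul, abs_of_nonneg (sub_nonneg.2 (Real.cos_le_one _))]

/-- Evaluation of a power series at frequency `k` and at `z`. -/
def ev (k : Fin d → ℝ) (z : ℝ≥0) (F : PS d) : ℂ := ∑' n, phk k (coeff n F) * (z : ℂ) ^ n

theorem hasSum_toReal {z : ℝ≥0} {p : ℕ} {F : PS d} (h : rho (wz p z) F ≠ ⊤) :
    HasSum (fun n : ℕ => (1 + n : ℝ) ^ p * (z : ℝ) ^ n * (tv (coeff n F)).toReal)
      (rho (wz p z) F).toReal := by
  have := ENNReal.hasSum_toReal h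
  rw [rho, ENNReal.tsum_toReal_eq (fun n => ENNReal.ne_top_of_tsum_ne_top h n)]
  convert this using 2 with n
  rw [ENNReal.toReal_mul, wz, ENNReal.toReal_mul, nm_LA, ENNReal.toReal_pow, ENNReal.toReal_pow,
    ENNReal.toReal_add (by simp) (by simp)]
  simp

theorem norm_ev_term_le (k : Fin d → ℝ) (z : ℝ≥0) (F : PS d) (n : ℕ) :
    ‖phk k (coeff n F) * (z : ℂ) ^ n‖ ≤ (1 + n : ℝ) ^ 0 * (z : ℝ) ^ n * (tv (coeff n F)).toReal := by
  have hz : ‖(z : ℂ)‖ = z := by simp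
  rw [norm_mul, norm_pow, hz, pow_zero, one_mul, mul_comm]
  exact mul_le_mul_of_nonneg_left (norm_phk_le _ _) (by positivity)

theorem summable_ev {z : ℝ≥0} {F : PS d} (h : rho (wz 0 z) F ≠ ⊤) (k : Fin d → ℝ) :
    Summable fun n => ‖phk k (coeff n F) * (z : ℂ) ^ n‖ :=
  (hasSum_toReal h).summable.of_nonneg_of_le (fun _ => norm_nonneg _) (norm_ev_term_le k z F)

theorem norm_ev_le {z : ℝ≥0} {F : PS d} (h : rho (wz 0 z) F ≠ ⊤) (k : Fin d → ℝ) :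
    ‖ev k z F‖ ≤ (rho (wz 0 z) F).toReal :=
  tsum_of_norm_bounded (hasSum_toReal h) (norm_ev_term_le k z F)

theorem ev_mul {z : ℝ≥0} {F H : PS d} (hF : rho (wz 0 z) F ≠ ⊤) (hH : rho (wz 0 z) H ≠ ⊤)
    (k : Fin d → ℝ) : ev k z (F * H) = ev k z F * ev k z H := by
  rw [ev, ev, ev, tsum_mul_tsum_eq_tsum_sum_antidiagonal_of_summable_norm (summable_ev hF k)
    (summable_ev hH k)]
  refine tsum_congr fun n => ?_
  rw [coeff_mul, map_sum, Finset.sum_mul]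
  refine Finset.sum_congr rfl fun p hp => ?_
  rw [← Finset.HasAntidiagonal.mem_antidiagonal.1 hp, pow_add, map_mul]
  ring

theorem ev_add {z : ℝ≥0} {F H : PS d} (hF : rho (wz 0 z) F ≠ ⊤) (hH : rho (wz 0 z) H ≠ ⊤)
    (k : Fin d → ℝ) : ev k z (F + H) = ev k z F + ev k z H := by
  rw [ev, ev, ev, ← (summable_ev hF k).of_norm.tsum_add (summable_ev hH k).of_norm]
  refine tsum_congr fun n => ?_
  rw [map_add, map_add, add_mul]

theorem ev_sub {z : ℝ≥0} {F H : PS d} (hF : rho (wz 0 z) F ≠ ⊤) (hH : rho (wz 0 z) H ≠ ⊤)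
    (k : Fin d → ℝ) : ev k z (F - H) = ev k z F - ev k z H := by
  rw [ev, ev, ev, ← (summable_ev hF k).of_norm.tsum_sub (summable_ev hH k).of_norm]
  refine tsum_congr fun n => ?_
  rw [map_sub, map_sub, sub_mul]

theorem ev_one (z : ℝ≥0) (k : Fin d → ℝ) : ev k z 1 = 1 := by
  rw [ev, tsum_eq_single 0]
  · simp
  · intro n hn
    rw [coeff_one, if_neg hn]; simp

theorem ev_re_sub_le {z : ℝ≥0} {F : PS d} (hF : rho (wz 3 z) F ≠ ⊤)
    (hp : ∀ n, PermInv (coeff n F)) (hs : ∀ n v, n < dist1 0 v → (coeff n F).coeff v = 0)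
    (k : Fin d → ℝ) :
    |(ev 0 z F).re - (ev k z F).re| ≤ (rho (wz 3 z) F).toReal * gap k := by
  have hF0 : rho (wz 0 z) F ≠ ⊤ := ne_top_of_le_ne_top hF
    (ENNReal.tsum_le_tsum fun n => mul_le_mul' (wz_mono_left z (by norm_num) n) le_rfl)
  have h1 : ∀ k : Fin d → ℝ, (ev k z F).re = ∑' n, (phk k (coeff n F) * (z : ℂ) ^ n).re := fun k =>
    Complex.re_tsum (summable_ev hF0 k).of_norm
  have h2 : ∀ k : Fin d → ℝ, Summable fun n => (phk k (coeff n F) * (z : ℂ) ^ n).re := fun k =>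
    (Complex.hasSum_re (summable_ev hF0 k).of_norm.hasSum).summable
  rw [h1, h1, ← (h2 0).tsum_sub (h2 k), ← Real.norm_eq_abs]
  refine tsum_of_norm_bounded ((hasSum_toReal hF).mul_right (gap k)) fun n => ?_
  have h3 : ∀ w : ℂ, (w * (z : ℂ) ^ n).re = w.re * (z : ℝ) ^ n := fun w => by
    have : (z : ℂ) ^ n = (((z : ℝ) ^ n : ℝ) : ℂ) := by push_cast; rfl
    rw [this, Complex.re_mul_ofReal]
  rw [h3, h3, ← sub_mul, norm_mul, Real.norm_eq_abs, Real.norm_of_nonneg (by positivity)]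
  calc _ ≤ (n : ℝ) ^ 2 * (tv (coeff n F)).toReal * gap k * (z : ℝ) ^ n :=
        mul_le_mul_of_nonneg_right (phk_re_sub_le (hp n) (hs n) k) (by positivity)
    _ = (n : ℝ) ^ 2 * ((z : ℝ) ^ n * (tv (coeff n F)).toReal * gap k) := by ring
    _ ≤ (1 + n : ℝ) ^ 3 * ((z : ℝ) ^ n * (tv (coeff n F)).toReal * gap k) := by
        refine mul_le_mul_of_nonneg_right ?_ (mul_nonneg (by positivity) (gap_nonneg k))
        have : (0 : ℝ) ≤ n := Nat.cast_nonneg n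
        nlinarith [pow_nonneg this 2, pow_nonneg this 3]
    _ = _ := by ring

end Characters

section PhiSymmetry
open PowerSeries L1

variable {d : ℕ} (lam : ℝ)

/-- The action of an additive lattice automorphism on coefficient series. -/
def act (R : Pt d ≃+ Pt d) : PS d →+* PS d :=
  PowerSeries.map (AddMonoidAlgebra.mapDomainRingHom ℝ (R : Pt d →+ Pt d))

theorem coeff_act (R : Pt d ≃+ Pt d) (F : PS d) (n : ℕ) (v : Pt d) :
    (coeff n (act R F)).coeff (R v) = (coeff n F).coeff v := by
  rw [act, PowerSeries.coeff_map]
  conv_lhs => rw [LA_eq_sum (coeff n F)]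
  conv_rhs => rw [LA_eq_sum (coeff n F)]
  simp only [map_sum, AddMonoidAlgebra.coeff_sum, Finsupp.finsetSum_apply]
  refine Finset.sum_congr rfl fun w _ => ?_
  rw [AddMonoidAlgebra.mapDomainRingHom_apply, AddMonoidAlgebra.mapDomain_single]
  simp [Finsupp.single_apply]

theorem act_eq_iff (R : Pt d ≃+ Pt d) (F : PS d) :
    act R F = F ↔ ∀ v, cX (R v) F = cX v F := by
  constructor
  · intro h v
    ext n
    rw [coeff_cX, coeff_cX, ← coeff_act R F n v, h]
  · intro h
    refine PS_ext fun v => ?_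
    obtain ⟨w, rfl⟩ := R.surjective v
    rw [h]
    ext n
    rw [coeff_cX, coeff_cX, coeff_act]

theorem act_Tk {R : Pt d ≃+ Pt d} {σ : Stp d ≃ Stp d} (h : StepPerm R.toEquiv σ) :
    act R (Tk lam {0} 0) = Tk lam {0} 0 := by
  rw [act_eq_iff]
  intro v
  rw [Tk, map_add, map_add, cX_X_mul, cX_X_mul, map_sum, map_sum, cX_sg, cX_sg]
  refine congrArg₂ (· + ·) ?_ ?_
  · have : (0 : Pt d) = R v ↔ (0 : Pt d) = v := by
      rw [eq_comm, EmbeddingLike.map_eq_zero_iff, eq_comm]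
    simp only [this]
  · refine congrArg (X * ·) ?_
    rw [← σ.sum_comp]
    refine Finset.sum_congr rfl fun e _ => ?_
    have h0 : R.toEquiv 0 = 0 := R.map_zero
    have h1 := S_cov lam h {0} (stp e) v
    have h2 := h 0 e
    rw [h0, zero_add, zero_add] at h2
    rw [Finset.map_singleton, h2] at h1
    rw [zero_add, zero_add]
    exact (congrArg (fun w => S lam {w} (stp (σ e)) (R v)) h0).symm.trans h1

theorem act_Phi {R : Pt d ≃+ Pt d} {σ : Stp d ≃ Stp d} (h : StepPerm R.toEquiv σ) :
    act R (Phi d lam) = Phi d lam := by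
  have h1 := congrArg (act R) (one_sub_Phi_mul (d := d) (lam := lam))
  rw [map_mul, act_Tk lam h, map_sub, map_one] at h1
  have h2 : 1 - act R (Phi d lam) = 1 - Phi d lam := by
    calc 1 - act R (Phi d lam) = (1 - act R (Phi d lam)) * ((1 - Phi d lam) * Tk lam {0} 0) := by
          rw [one_sub_Phi_mul, mul_one]
      _ = (1 - act R (Phi d lam)) * Tk lam {0} 0 * (1 - Phi d lam) := by ring
      _ = _ := by rw [h1, one_mul]
  exact sub_right_injective h2

/-- Coordinate permutations as additive automorphisms. -/
def permAdd (π : Equiv.Perm (Fin d)) : Pt d ≃+ Pt d where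
  toEquiv := Equiv.piCongrLeft (fun _ => ℤ) π
  map_add' v w := by
    ext i
    obtain ⟨j, rfl⟩ := π.surjective i
    simp [Equiv.piCongrLeft_apply_apply]

theorem cX_Phi_perm (π : Equiv.Perm (Fin d)) (v : Pt d) :
    cX (Equiv.piCongrLeft (fun _ => ℤ) π v) (Phi d lam) = cX v (Phi d lam) :=
  (act_eq_iff (permAdd π) _).1 (act_Phi lam (R := permAdd π) (stepPerm_perm π)) v

theorem cX_Phi_neg (v : Pt d) : cX (-v) (Phi d lam) = cX v (Phi d lam) :=
  (act_eq_iff (AddEquiv.neg (Pt d)) _).1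
    (act_Phi lam (R := AddEquiv.neg (Pt d)) (σ := nstEquiv) stepPerm_neg) v

/-- Series whose `n`-th coefficient is supported in the `ℓ¹` ball of radius `n`. -/
def Supp (F : PS d) : Prop := ∀ n v, n < dist1 0 v → (coeff n F).coeff v = 0

theorem dist1_zero_add_le (v w : Pt d) : dist1 0 (v + w) ≤ dist1 0 v + dist1 0 w := by
  simp only [dist1, ← Finset.sum_add_distrib]
  refine Finset.sum_le_sum fun i _ => ?_
  simp only [Pi.zero_apply, Pi.add_apply, zero_sub, Int.natAbs_neg]
  exact Int.natAbs_add_le _ _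

theorem Supp.mul {F H : PS d} (hF : Supp F) (hH : Supp H) : Supp (F * H) := by
  intro n v hv
  rw [coeff_mul, AddMonoidAlgebra.coeff_sum, Finsupp.finsetSum_apply]
  refine Finset.sum_eq_zero fun p hp => ?_
  rw [Finset.HasAntidiagonal.mem_antidiagonal] at hp
  conv_lhs => rw [LA_eq_sum (coeff p.1 F), Finset.sum_mul]
  rw [AddMonoidAlgebra.coeff_sum, Finsupp.finsetSum_apply]
  refine Finset.sum_eq_zero fun w hw => ?_
  have h1 : dist1 0 w ≤ p.1 := by
    by_contra! h
    exact Finsupp.mem_support_iff.1 hw (hF _ _ h)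
  have h2 : p.2 < dist1 0 (v - w) := by
    have := dist1_zero_add_le (v - w) w
    rw [sub_add_cancel] at this
    omega
  rw [AddMonoidAlgebra.coeff_single_mul_eq_mul_coeff (v - w)
    (fun m' _ => by rw [eq_sub_iff_add_eq, add_comm]), hH _ _ h2, mul_zero]

theorem Supp_Tk_sub : Supp (Tk lam {0} (0 : Pt d) - 1) := by
  intro n v hv
  rw [Tk, sg_zero, add_sub_cancel_left]
  cases n with
  | zero => simp
  | succ n =>
    rw [coeff_succ_X_mul, map_sum, AddMonoidAlgebra.coeff_sum, Finsupp.finsetSum_apply]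
    refine Finset.sum_eq_zero fun e _ => ?_
    have := S_support lam (B := {0}) (x := 0 + stp e) (v := v) (n := n) ?_
    · rwa [S, coeff_cX] at this
    · have h1 : dist1 0 v ≤ dist1 0 (stp e) + dist1 (stp e) v := by
        have := dist1_zero_add_le (stp e) (v - stp e)
        rw [add_sub_cancel] at this
        refine this.trans (add_le_add le_rfl (le_of_eq ?_))
        simp only [dist1, Pi.sub_apply, Pi.zero_apply, zero_sub, Int.natAbs_neg]
        exact Finset.sum_congr rfl fun i _ => by rw [← Int.natAbs_neg, neg_sub]
      have h2 : dist1 0 (stp e) = 1 := by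
        have := dist1_add_stp (0 : Pt d) e
        rwa [zero_add] at this
      rw [zero_add]
      omega

theorem Supp_Phi : Supp (Phi d lam) := by
  have h0 := Supp_Tk_sub (d := d) lam
  set U := Tk lam {0} (0 : Pt d) - 1 with hU
  have hPhi : Phi d lam = U + -1 * (U * Phi d lam) := by
    have h1 : (1 - Phi d lam) * (U + 1) = 1 := by rw [hU, sub_add_cancel, one_sub_Phi_mul]
    linear_combination -h1
  have hXU : coeff 0 U = 0 := by
    rw [coeff_zero_eq_constantCoeff_apply, hU, map_sub, constantCoeff_Tk]
    simp [AddMonoidAlgebra.one_def]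
  intro n
  induction n using Nat.strong_induction_on with
  | _ n ih =>
    intro v hv
    set P : PS d := PowerSeries.mk fun m => if m < n then coeff m (Phi d lam) else 0 with hP
    have hPs : Supp P := fun m w hw => by
      rw [hP, coeff_mk]
      split_ifs with h
      · exact ih m h w hw
      · simp
    have hc : coeff n (U * Phi d lam) = coeff n (U * P) := by
      rw [coeff_mul, coeff_mul]
      refine Finset.sum_congr rfl fun p hp => ?_
      rw [Finset.HasAntidiagonal.mem_antidiagonal] at hp
      rcases Nat.eq_zero_or_pos p.1 with h | h
      · rw [h, hXU, zero_mul, zero_mul]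
      · rw [hP, coeff_mk, if_pos (by omega)]
    rw [hPhi, map_add, AddMonoidAlgebra.coeff_add, Finsupp.add_apply, h0 n v hv, zero_add, neg_mul,
      one_mul, map_neg, hc]
    have := (h0.mul hPs) n v hv
    simp [this]

end PhiSymmetry

section Infrared
open PowerSeries L1

variable {d : ℕ} {lam : ℝ} {z s : ℝ≥0}

theorem ev_zero_eq {F : PS d} (h : ∀ n v, 0 ≤ (coeff n F).coeff v) (hF : rho (wz 0 z) F ≠ ⊤) :
    ev 0 z F = ((rho (wz 0 z) F).toReal : ℂ) := by
  rw [ev, ← (hasSum_toReal hF).tsum_eq, Complex.ofReal_tsum]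
  refine tsum_congr fun n => ?_
  rw [phk_apply, tv_toReal]
  push_cast
  rw [pow_zero, one_mul, mul_comm]
  refine congrArg ((z : ℂ) ^ n * ·) (Finset.sum_congr rfl fun v _ => ?_)
  rw [chk_zero, mul_one, abs_of_nonneg (h n v)]

theorem coeff_Gk_nonneg (hl : 0 ≤ lam) (n : ℕ) (v : Pt d) :
    0 ≤ (coeff n (Gk lam ∅ 0)).coeff v := by
  have := NN_S lam hl ∅ 0 v n
  rwa [S, coeff_cX] at this

theorem coeff_io (f : PowerSeries ℝ) (n : ℕ) :
    coeff n (io d f) = AddMonoidAlgebra.single 0 (coeff n f) := by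
  rw [io, PowerSeries.coeff_map]; rfl

theorem Gk_mul_one_sub_Phi : Gk lam ∅ (0 : Pt d) * (1 - Phi d lam) = io d (gg lam ∅ (0 : Pt d)) := by
  rw [Gk_eq', mul_assoc, mul_comm (Tk _ _ _)]
  have : (insert (0 : Pt d) ∅ : Finset (Pt d)) = {0} := by simp
  rw [this, one_sub_Phi_mul, mul_one]

theorem dt_stp (k : Fin d → ℝ) (e : Stp d) : Real.cos (dt k (stp e)) = Real.cos (k e.1) := by
  obtain ⟨i, b⟩ := e
  have : dt k (stp (i, b)) = k i * (if b then 1 else -1) := by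
    rw [dt, Finset.sum_eq_single i]
    · cases b <;> simp [stp]
    · intro j _ hj; simp [stp, hj]
    · simp
  rw [this]
  cases b <;> simp

theorem sum_cos_stp (k : Fin d → ℝ) (hd : 1 ≤ d) :
    ∑ e : Stp d, Real.cos (dt k (stp e)) = 2 * d * (1 - gap k) := by
  have hd' : (d : ℝ) ≠ 0 := by positivity
  simp only [dt_stp, Fintype.sum_prod_type, gap, Finset.sum_sub_distrib]
  simp only [Finset.sum_const, Finset.card_univ, Fintype.card_bool, Fintype.card_fin, nsmul_eq_mul,
    mul_one, ← Finset.mul_sum]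
  push_cast
  field_simp
  ring

theorem ev_X_mul_sum_sg (k : Fin d → ℝ) (hd : 1 ≤ d) :
    (ev k z (X * ∑ e : Stp d, sg (stp e))).re = z * (2 * d) * (1 - gap k) := by
  rw [ev, tsum_eq_single 1]
  · have hc : coeff 1 (X * ∑ e : Stp d, sg (stp e) : PS d) = coeff 0 (∑ e : Stp d, sg (stp e)) :=
      coeff_succ_X_mul 0 _
    rw [hc, map_sum, map_sum]
    have h1 : ∀ e : Stp d, phk k (coeff 0 (sg (stp e))) = chk k (.ofAdd (stp e)) := fun e => by
      rw [sg, coeff_zero_C, phk_single]; simp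
    simp only [h1, pow_one]
    rw [Complex.re_mul_ofReal, Complex.re_sum]
    simp only [chk_re]
    rw [sum_cos_stp k hd]; ring
  · intro n hn
    rcases n with _ | n
    · simp
    · rw [coeff_succ_X_mul, map_sum]
      have h1 : ∀ e : Stp d, coeff n (sg (stp e)) = 0 := fun e => by
        rw [sg, coeff_C, if_neg (by omega)]
      simp [h1]

theorem rho_wz_mono_left {R : Type*} [CommRing R] [L1 R] {p q : ℕ} (h : p ≤ q) (F : PowerSeries R) :
    rho (wz p z) F ≤ rho (wz q z) F :=
  ENNReal.tsum_le_tsum fun n => mul_le_mul' (wz_mono_left z h n) le_rfl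

theorem rho_X_sum_sg (p : ℕ) :
    rho (wz p z) (X * ∑ e : Stp d, sg (stp e)) ≤ 2 ^ p * (z * (2 * d)) := by
  refine (rho_X_mul_le (wz_subM p z) _).trans ?_
  have : rho (wz p z) (∑ e : Stp d, sg (stp e)) ≤ 2 * d := by
    refine (rho_sum_le _ _ _).trans ?_
    simp only [rho_sg, wz_zero]
    simp [mul_comm]
  refine (mul_le_mul' le_rfl this).trans (le_of_eq ?_)
  rw [wz]; norm_num [mul_assoc]

theorem Small.ev_phi (h : Small d lam z s) (hl : 0 ≤ lam) (hd : 1 ≤ d) (k : Fin d → ℝ)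
    (h0 : 0 ≤ (1 - ev 0 z (Phi d lam)).re) :
    gap k / 5 ≤ (1 - ev k z (Phi d lam)).re := by
  set Xi : PS d := Phi d lam - X * ∑ e : Stp d, sg (stp e) with hXi
  have hb := h.phi_le hl
  rw [← hXi] at hb
  have hXi3 : rho (wz 3 z) Xi ≠ ⊤ := ne_top_of_le_ne_top ENNReal.coe_ne_top hb
  have hXi0 : rho (wz 0 z) Xi ≠ ⊤ := ne_top_of_le_ne_top hXi3 (rho_wz_mono_left (by norm_num) _)
  have hX0 : rho (wz 0 z) (X * ∑ e : Stp d, sg (stp e) : PS d) ≠ ⊤ := by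
    refine ne_top_of_le_ne_top ?_ (rho_X_sum_sg 0)
    exact ENNReal.mul_ne_top (by simp) (ne_top_of_le_ne_top (by simp) h.p_le)
  have hPhi : Phi d lam = X * ∑ e : Stp d, sg (stp e) + Xi := by rw [hXi]; ring
  have hev : ∀ k, (ev k z (Phi d lam)).re = z * (2 * d) * (1 - gap k) + (ev k z Xi).re := fun k => by
    rw [hPhi, ev_add hX0 hXi0, Complex.add_re, ev_X_mul_sum_sg k hd]
  have hb' : (rho (wz 3 z) Xi).toReal ≤ 1 / 100 := by
    refine (ENNReal.toReal_mono ENNReal.coe_ne_top hb).trans (le_of_eq ?_)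
    simp
  have hXperm : ∀ (π : Equiv.Perm (Fin d)) (v : Pt d),
      cX (Equiv.piCongrLeft (fun _ => ℤ) π v) (X * ∑ e : Stp d, sg (stp e)) =
        cX v (X * ∑ e : Stp d, sg (stp e)) := by
    intro π v
    rw [cX_X_mul, cX_X_mul, map_sum, map_sum]
    refine congrArg (X * ·) ?_
    rw [← (Equiv.prodCongr π (Equiv.refl Bool)).sum_comp]
    refine Finset.sum_congr rfl fun e _ => ?_
    have h2 := stepPerm_perm π (0 : Pt d) e
    have h0 : Equiv.piCongrLeft (fun _ : Fin d => ℤ) π 0 = 0 := (permAdd π).map_zero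
    rw [zero_add, h0, zero_add] at h2
    rw [cX_sg, cX_sg, ← h2]
    simp only [EmbeddingLike.apply_eq_iff_eq]
  have hp : ∀ n, PermInv (coeff n Xi) := fun n π v => by
    have : cX (Equiv.piCongrLeft (fun _ => ℤ) π v) Xi = cX v Xi := by
      rw [hXi, map_sub, map_sub, cX_Phi_perm, hXperm]
    rw [← coeff_cX, this, coeff_cX]
  have hs : ∀ n v, n < dist1 0 v → (coeff n Xi).coeff v = 0 := fun n v hv => by
    rw [hXi, map_sub, AddMonoidAlgebra.coeff_sub, Finsupp.sub_apply, Supp_Phi lam n v hv]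
    rcases n with _ | n
    · simp
    · rw [coeff_succ_X_mul, map_sum, AddMonoidAlgebra.coeff_sum, Finsupp.finsetSum_apply,
        Finset.sum_eq_zero, sub_zero]
      intro e _
      rw [← coeff_cX, cX_sg, if_neg]
      · simp
      · rintro rfl
        have := dist1_add_stp (0 : Pt d) e
        rw [zero_add] at this
        omega
  have hdiff := ev_re_sub_le hXi3 hp hs k
  have hg0 := gap_nonneg k
  have hg2 := gap_le_two k
  have hdiff' : (ev k z Xi).re ≤ (ev 0 z Xi).re + gap k / 100 := by
    have h1 := (abs_le.1 hdiff).1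
    have h2 := mul_le_mul_of_nonneg_right hb' hg0
    linarith
  have hp2 : (z : ℝ) * (2 * d) ≤ 2 := by
    have := h.p_le
    have h2 : z * (2 * d) ≤ (2 : ℝ≥0) := by exact_mod_cast this
    exact_mod_cast h2
  have hp0 : 0 ≤ (z : ℝ) * (2 * d) := by positivity
  have hgz : gap (0 : Fin d → ℝ) = 0 := by simp [gap]
  rw [Complex.sub_re, Complex.one_re] at h0 ⊢
  rw [hev] at h0 ⊢
  rw [hgz] at h0
  by_cases hcase : (1 / 2 : ℝ) ≤ z * (2 * d)
  · nlinarith [mul_le_mul_of_nonneg_right hcase hg0]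
  · have h3 : ‖ev k z Xi‖ ≤ 1 / 100 := (norm_ev_le hXi0 k).trans
      ((ENNReal.toReal_mono hXi3 (rho_wz_mono_left (by norm_num) _)).trans hb')
    have h4 := (Complex.re_le_norm (ev k z Xi)).trans h3
    nlinarith [mul_nonneg hp0 hg0]

theorem Small.gap_mul_ev_le (h : Small d lam z s) (hl : 0 ≤ lam) (hd : 1 ≤ d)
    (hfin : rho (wz 0 z) (Gk lam ∅ (0 : Pt d)) ≠ ⊤) (k : Fin d → ℝ) :
    gap k * ‖ev k z (Gk lam ∅ 0)‖ ≤ 10 := by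
  have hPhi0 : rho (wz 0 z) (Phi d lam) ≠ ⊤ := by
    have h1 : Phi d lam = (Phi d lam - X * ∑ e : Stp d, sg (stp e)) + X * ∑ e : Stp d, sg (stp e) := by
      ring
    rw [h1]
    refine ne_top_of_le_ne_top (ENNReal.add_ne_top.2 ⟨?_, ?_⟩) (rho_add_le _ _ _)
    · exact ne_top_of_le_ne_top ENNReal.coe_ne_top
        ((rho_wz_mono_left (by norm_num) _).trans (h.phi_le hl))
    · refine ne_top_of_le_ne_top ?_ (rho_X_sum_sg 0)
      exact ENNReal.mul_ne_top (by simp) (ne_top_of_le_ne_top (by simp) h.p_le)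
  have hone : rho (wz 0 z) (1 : PS d) ≠ ⊤ := by
    rw [← sg_zero, rho_sg, wz_zero]; simp
  have h1P : rho (wz 0 z) (1 - Phi d lam) ≠ ⊤ :=
    ne_top_of_le_ne_top (ENNReal.add_ne_top.2 ⟨hone, hPhi0⟩) (rho_sub_le _ _ _)
  have hg2 : rho (wz 0 z) (io d (gg lam ∅ (0 : Pt d))) ≤ 2 := by
    rw [rho_io]; exact (rho_wz_mono_left (by norm_num) _).trans (h.gw_le hl)
  have hgt : rho (wz 0 z) (io d (gg lam ∅ (0 : Pt d))) ≠ ⊤ := ne_top_of_le_ne_top (by simp) hg2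
  have hmul : ∀ k, ev k z (Gk lam ∅ 0) * (1 - ev k z (Phi d lam)) = ev k z (io d (gg lam ∅ (0 : Pt d))) := by
    intro k
    rw [← Gk_mul_one_sub_Phi, ev_mul hfin h1P, ev_sub hone hPhi0, ev_one]
  have hg1 : 1 ≤ rho (wz 0 z) (io d (gg lam ∅ (0 : Pt d))) := by
    rw [rho_io]; exact one_le_gw lam z hl 0
  have hG1 : 1 ≤ rho (wz 0 z) (Gk lam ∅ (0 : Pt d)) := by
    rw [← mass_Gw]
    exact (one_le_gw lam z hl 0).trans (CF.le_mass _ 0)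
  have h0 : 0 ≤ (1 - ev 0 z (Phi d lam)).re := by
    have h2 := hmul 0
    rw [ev_zero_eq (coeff_Gk_nonneg hl) hfin, ev_zero_eq (fun n v => by
      rw [coeff_io, AddMonoidAlgebra.coeff_single, Finsupp.single_apply]
      split_ifs
      exacts [NN_gg lam hl _ _ n, le_rfl]) hgt] at h2
    have h3 := congrArg Complex.re h2
    rw [Complex.re_ofReal_mul, Complex.ofReal_re] at h3
    have h4 : 0 < (rho (wz 0 z) (Gk lam ∅ (0 : Pt d))).toReal :=
      ENNReal.toReal_pos (by positivity) hfin
    by_contra! hneg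
    have := mul_neg_of_pos_of_neg h4 hneg
    rw [h3] at this
    exact absurd ENNReal.toReal_nonneg (not_le.2 this)
  have h5 := h.ev_phi hl hd k h0
  have h6 : ‖ev k z (io d (gg lam ∅ (0 : Pt d)))‖ ≤ 2 :=
    (norm_ev_le hgt k).trans (ENNReal.toReal_mono (by simp) hg2)
  rw [← hmul, norm_mul] at h6
  have h7 : gap k / 5 ≤ ‖1 - ev k z (Phi d lam)‖ := h5.trans (Complex.re_le_norm _)
  have h8 := mul_le_mul_of_nonneg_left h7 (norm_nonneg (ev k z (Gk lam ∅ 0)))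
  linarith

end Infrared

section Fourier
open MeasureTheory

variable {d : ℕ}

/-- The uniform distribution on the circle. -/
def circ : Measure ℝ :=
  ENNReal.ofReal (2 * Real.pi)⁻¹ • volume.restrict (Set.Ioc (-Real.pi) Real.pi)

instance : IsProbabilityMeasure circ := ⟨by
  have hp : 0 < 2 * Real.pi := by positivity
  rw [circ, Measure.smul_apply, Measure.restrict_apply_univ, Real.volume_Ioc, smul_eq_mul,
    ← ENNReal.ofReal_mul (by positivity), ← ENNReal.ofReal_one]
  congr 1
  field_simp
  ring⟩

variable (d) in
/-- The uniform distribution on the torus. -/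
def torus : Measure (Fin d → ℝ) := Measure.pi fun _ => circ

instance : IsProbabilityMeasure (torus d) := by unfold torus; infer_instance

theorem integral_circ_exp (m : ℤ) :
    ∫ x, Complex.exp ((x * m : ℝ) * Complex.I) ∂circ = if m = 0 then 1 else 0 := by
  split_ifs with h
  · subst h; simp
  · rw [circ, integral_smul_measure,
      ← intervalIntegral.integral_of_le (by linarith [Real.pi_pos])]
    have hc : (m : ℂ) * Complex.I ≠ 0 := mul_ne_zero (by exact_mod_cast h) Complex.I_ne_zero
    have h1 : ∀ x : ℝ, Complex.exp ((x * m : ℝ) * Complex.I) =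
        Complex.exp ((m : ℂ) * Complex.I * x) := fun x => by
      congr 1; push_cast; ring
    simp only [h1]
    rw [integral_exp_mul_complex hc]
    have h2 : Complex.exp ((m : ℂ) * Complex.I * (Real.pi : ℝ)) =
        Complex.exp ((m : ℂ) * Complex.I * ((-Real.pi : ℝ) : ℂ)) := by
      rw [Complex.exp_eq_exp_iff_exists_int]
      exact ⟨m, by push_cast; ring⟩
    rw [h2, sub_self, zero_div, smul_zero]

theorem continuous_chk (v) : Continuous fun k : Fin d → ℝ => chk k v := by
  simp only [chk, MonoidHom.coe_mk, OneHom.coe_mk, dt]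
  fun_prop

theorem integral_chk (v : Pt d) :
    ∫ k, chk k (.ofAdd v) ∂(torus d) = if v = 0 then 1 else 0 := by
  have h1 : ∀ k : Fin d → ℝ, chk k (.ofAdd v) =
      ∏ j, Complex.exp ((k j * v j : ℝ) * Complex.I) := fun k => by
    simp only [chk, MonoidHom.coe_mk, OneHom.coe_mk, toAdd_ofAdd, dt]
    rw [← Complex.exp_sum, ← Finset.sum_mul]
    push_cast
    rfl
  simp only [h1, torus]
  rw [integral_fintype_prod_eq_prod (fun j (x : ℝ) => Complex.exp ((x * v j : ℝ) * Complex.I))]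
  simp only [integral_circ_exp]
  split_ifs with h
  · subst h; simp
  · obtain ⟨j, hj⟩ := Function.ne_iff.1 h
    exact Finset.prod_eq_zero (Finset.mem_univ j) (if_neg hj)

/-- The Fourier transform. -/
def fh (k : Fin d → ℝ) (F : CF d) : ℂ := ∑' v, ((F v).toReal : ℂ) * chk k (.ofAdd v)

theorem CF.hasSum_toReal {F : CF d} (h : CF.mass F ≠ ⊤) :
    HasSum (fun v => (F v).toReal) (CF.mass F).toReal := by
  rw [CF.mass, ENNReal.tsum_toReal_eq (fun v => ENNReal.ne_top_of_tsum_ne_top h v)]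
  exact (ENNReal.summable_toReal h).hasSum

theorem norm_fh_term (k : Fin d → ℝ) (F : CF d) (v : Pt d) :
    ‖((F v).toReal : ℂ) * chk k (.ofAdd v)‖ = (F v).toReal := by
  rw [norm_mul, norm_chk, mul_one, Complex.norm_real, Real.norm_eq_abs,
    abs_of_nonneg ENNReal.toReal_nonneg]

theorem summable_fh {F : CF d} (h : CF.mass F ≠ ⊤) (k : Fin d → ℝ) :
    Summable fun v => ‖((F v).toReal : ℂ) * chk k (.ofAdd v)‖ := by
  simp only [norm_fh_term]
  exact (CF.hasSum_toReal h).summable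

theorem fh_mul {F H : CF d} (hF : CF.mass F ≠ ⊤) (hH : CF.mass H ≠ ⊤) (k : Fin d → ℝ) :
    fh k (F * H) = fh k F * fh k H := by
  have hs := summable_mul_of_summable_norm (summable_fh hF k) (summable_fh hH k)
  let e : Pt d × Pt d ≃ Pt d × Pt d :=
    { toFun := fun p => (p.2, p.1 - p.2)
      invFun := fun p => (p.1 + p.2, p.1)
      left_inv := fun p => by simp
      right_inv := fun p => by simp }
  rw [fh, fh, fh, tsum_mul_tsum_of_summable_norm (summable_fh hF k) (summable_fh hH k),
    ← e.tsum_eq]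
  refine Eq.trans ?_ (Summable.tsum_prod ((e.summable_iff).2 hs)).symm
  refine tsum_congr fun v => ?_
  have ht : ∀ w, F w * H (v - w) ≠ ⊤ := fun w => ENNReal.mul_ne_top
    (ENNReal.ne_top_of_tsum_ne_top hF w) (ENNReal.ne_top_of_tsum_ne_top hH _)
  rw [CF.mul_apply, ENNReal.tsum_toReal_eq ht, Complex.ofReal_tsum, ← tsum_mul_right]
  refine tsum_congr fun w => ?_
  simp only [e, Function.comp_apply, Equiv.coe_fn_mk]
  have : Multiplicative.ofAdd v = .ofAdd w * .ofAdd (v - w) := by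
    rw [← ofAdd_add, add_sub_cancel]
  rw [this, map_mul, ENNReal.toReal_mul]
  push_cast
  ring

theorem CF.mass_pow_ne_top {F : CF d} (hF : CF.mass F ≠ ⊤) (n : ℕ) : CF.mass (F ^ n) ≠ ⊤ := by
  induction n with
  | zero =>
    rw [pow_zero, CF.mass, tsum_eq_single 0]
    · simp [CF.one_apply]
    · intro v hv; simp [CF.one_apply, hv]
  | succ n ih => rw [pow_succ, CF.mass_mul]; exact ENNReal.mul_ne_top ih hF

theorem fh_one (k : Fin d → ℝ) : fh k 1 = 1 := by
  rw [fh, tsum_eq_single 0]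
  · simp [CF.one_apply]
  · intro v hv; simp [CF.one_apply, hv]

theorem fh_pow {F : CF d} (hF : CF.mass F ≠ ⊤) (k : Fin d → ℝ) (n : ℕ) :
    fh k (F ^ n) = fh k F ^ n := by
  induction n with
  | zero => rw [pow_zero, pow_zero, fh_one]
  | succ n ih => rw [pow_succ, pow_succ, fh_mul (CF.mass_pow_ne_top hF n) hF, ih]

theorem integral_fh {F : CF d} (hF : CF.mass F ≠ ⊤) : ∫ k, fh k F ∂(torus d) = (F 0).toReal := by
  have hint : ∀ v : Pt d, Integrable (fun k => ((F v).toReal : ℂ) * chk k (.ofAdd v)) (torus d) :=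
    fun v => by
      refine Integrable.of_bound (C := (F v).toReal) ?_ ?_
      · exact ((continuous_chk _).const_smul ((F v).toReal : ℂ)).aestronglyMeasurable
      · exact Filter.Eventually.of_forall fun k => (norm_fh_term k F v).le
  unfold fh
  rw [← integral_tsum_of_summable_integral_norm hint]
  · simp only [integral_const_mul, integral_chk]
    rw [tsum_eq_single 0]
    · simp
    · intro v hv; simp [hv]
  · simp only [norm_fh_term, integral_const, probReal_univ, one_smul]
    exact (CF.hasSum_toReal hF).summable

theorem apply_zero_le {F : CF d} (hF : CF.mass F ≠ ⊤) : F 0 ≤ ∫⁻ k, ‖fh k F‖ₑ ∂(torus d) := by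
  have h := enorm_integral_le_lintegral_enorm (μ := torus d) fun k => fh k F
  rw [integral_fh hF] at h
  refine le_trans (le_of_eq ?_) h
  rw [← ofReal_norm, Complex.norm_real, Real.norm_eq_abs, abs_of_nonneg ENNReal.toReal_nonneg,
    ENNReal.ofReal_toReal (ENNReal.ne_top_of_tsum_ne_top hF 0)]

theorem fh_N (k : Fin d → ℝ) (hd : 1 ≤ d) : fh k CF.N = ((2 * d * (1 - gap k) : ℝ) : ℂ) := by
  have h1 : fh k CF.N = ∑ e : Stp d, chk k (.ofAdd (stp e)) := by
    have : ∀ v : Pt d, (((CF.N : CF d) v).toReal : ℂ) * chk k (.ofAdd v) =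
        ∑ e : Stp d, if stp e = v then chk k (.ofAdd v) else 0 := fun v => by
      rw [CF.N, ENNReal.toReal_sum fun e _ => by split_ifs <;> simp, Complex.ofReal_sum,
        Finset.sum_mul]
      refine Finset.sum_congr rfl fun e _ => ?_
      split_ifs <;> simp
    rw [fh, tsum_congr this, Summable.tsum_finsetSum]
    · refine Finset.sum_congr rfl fun e _ => ?_
      rw [tsum_eq_single (stp e)]
      · simp
      · intro v hv; rw [if_neg hv.symm]
    · intro e _
      refine summable_of_ne_finset_zero (s := {stp e}) fun v hv => if_neg ?_
      simpa [eq_comm] using hv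
  have h2 : ∑ e : Stp d, chk k (.ofAdd (stp e)) = (starRingEnd ℂ) (∑ e : Stp d, chk k (.ofAdd (stp e))) := by
    rw [map_sum, ← nstEquiv.sum_comp]
    refine Finset.sum_congr rfl fun e _ => ?_
    change chk k (.ofAdd (stp (nst e))) = _
    simp only [chk, MonoidHom.coe_mk, OneHom.coe_mk, toAdd_ofAdd, stp_nst]
    rw [← Complex.exp_conj, map_mul, Complex.conj_I, Complex.conj_ofReal]
    simp [dt]
  rw [h1]
  apply Complex.ext
  · rw [Complex.re_sum, Complex.ofReal_re, ← sum_cos_stp k hd]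
    simp only [chk_re]
  · have := congrArg Complex.im h2
    rw [Complex.conj_im] at this
    rw [Complex.ofReal_im]
    linarith

theorem CF.N_mul_N_zero : (CF.N * CF.N : CF d) 0 = 2 * d := by
  rw [CF.N_mul]
  have : ∀ e : Stp d, (CF.N : CF d) (0 - stp e) = 1 := fun e => by
    rw [CF.N]
    change (∑ e' : Stp d, if stp e' = 0 - stp e then (1 : ℝ≥0∞) else 0) = 1
    rw [Finset.sum_eq_single (nst e)]
    · rw [stp_nst, zero_sub, if_pos rfl]
    · intro e' _ he
      refine if_neg fun h => he (stp_injective ?_)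
      rw [stp_nst, h, zero_sub]
    · simp
  rw [Finset.sum_congr rfl fun e _ => this e]
  simp [mul_comm]

theorem lintegral_fh_N_sq (hd : 1 ≤ d) : ∫⁻ k, ‖fh k (CF.N : CF d)‖ₑ ^ 2 ∂(torus d) = 2 * d := by
  have hN : CF.mass (CF.N : CF d) ≠ ⊤ := by
    rw [CF.mass_N]; exact ENNReal.mul_ne_top (by simp) (by simp)
  have hm : CF.mass (CF.N * CF.N : CF d) ≠ ⊤ := by
    rw [CF.mass_mul]; exact ENNReal.mul_ne_top hN hN
  have hcont : Continuous fun k : Fin d → ℝ => (2 * d * (1 - gap k)) ^ 2 := by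
    unfold gap; fun_prop
  have h1 := integral_fh hm
  simp only [fh_mul hN hN, fh_N _ hd, CF.N_mul_N_zero] at h1
  have h2 : ∫ k, ((2 * d * (1 - gap k)) ^ 2 : ℝ) ∂(torus d) = 2 * d := by
    have h3 : ∀ k : Fin d → ℝ, ((2 * d * (1 - gap k) : ℝ) : ℂ) * ((2 * d * (1 - gap k) : ℝ) : ℂ) =
      (((2 * d * (1 - gap k)) ^ 2 : ℝ) : ℂ) := fun k => by push_cast; ring
    simp only [h3] at h1
    rw [integral_complex_ofReal] at h1
    have := Complex.ofReal_injective h1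
    rw [this]; simp
  have h4 : ∀ k : Fin d → ℝ, ‖fh k (CF.N : CF d)‖ₑ ^ 2 = ENNReal.ofReal ((2 * d * (1 - gap k)) ^ 2) :=
    fun k => by
      rw [fh_N k hd, ← ofReal_norm, Complex.norm_real, Real.norm_eq_abs, ← ENNReal.ofReal_pow (abs_nonneg _), sq_abs]
  simp only [h4]
  rw [← ofReal_integral_eq_lintegral_ofReal, h2]
  · simp [ENNReal.ofReal_mul]
  · refine Integrable.of_bound (C := (2 * d) ^ 2) hcont.aestronglyMeasurable
      (Filter.Eventually.of_forall fun k => ?_)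
    have h5 := gap_nonneg k
    have h6 := gap_le_two k
    have h7 : |1 - gap k| ≤ 1 := abs_le.2 ⟨by linarith, by linarith⟩
    rw [Real.norm_eq_abs, abs_of_nonneg (sq_nonneg _), mul_pow]
    have h8 := (sq_le_one_iff_abs_le_one _).2 h7
    nlinarith [sq_nonneg (2 * d : ℝ)]
  · exact Filter.Eventually.of_forall fun k => sq_nonneg _

end Fourier

section Singularity
open MeasureTheory ProbabilityTheory

variable {d : ℕ}

/-- The one-dimensional singular weight. -/
def sing (x : ℝ) : ℝ≥0∞ := (ENNReal.ofReal (1 - Real.cos x))⁻¹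

theorem measurable_sing : Measurable sing := by unfold sing; fun_prop

theorem lintegral_sing_lt_top : ∫⁻ x, sing x ^ (1 / 4 : ℝ) ∂circ < ⊤ := by
  have hpi := Real.pi_pos
  have hint : IntervalIntegrable (fun x : ℝ => |x| ^ (-(1 / 2) : ℝ)) volume (-Real.pi) Real.pi := by
    refine intervalIntegrable_of_even (fun x => by rw [abs_neg]) fun x hx => ?_
    refine (intervalIntegral.intervalIntegrable_rpow' (r := -(1 / 2)) (by norm_num)).congr ?_
    intro y hy
    rw [Set.uIoc_of_le hx.le] at hy
    simp only [abs_of_pos hy.1]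
  rw [intervalIntegrable_iff_integrableOn_Ioc_of_le (by linarith)] at hint
  have h1 : ∫⁻ x in Set.Ioc (-Real.pi) Real.pi, ENNReal.ofReal (|x| ^ (-(1 / 2) : ℝ)) < ⊤ :=
    hint.lintegral_lt_top
  rw [circ, lintegral_smul_measure, smul_eq_mul]
  refine ENNReal.mul_lt_top ENNReal.ofReal_lt_top ?_
  set c : ℝ≥0∞ := (ENNReal.ofReal (2 / Real.pi ^ 2))⁻¹ ^ (1 / 4 : ℝ) with hc
  have hct : c ≠ ⊤ := by
    rw [hc]
    refine ENNReal.rpow_ne_top_of_nonneg (by norm_num) (ENNReal.inv_ne_top.2 ?_)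
    rw [Ne, ENNReal.ofReal_eq_zero, not_le]
    positivity
  refine lt_of_le_of_lt ?_ (ENNReal.mul_lt_top hct.lt_top h1)
  rw [← lintegral_const_mul' _ _ hct]
  refine lintegral_mono_ae ?_
  have hne : ∀ᵐ x : ℝ ∂(volume.restrict (Set.Ioc (-Real.pi) Real.pi)), x ≠ 0 :=
    ae_restrict_of_ae (by simp [ae_iff])
  filter_upwards [ae_restrict_mem measurableSet_Ioc, hne] with x hx hx0
  have hx' : |x| ≤ Real.pi := abs_le.2 ⟨hx.1.le, hx.2⟩
  have hxp : 0 < |x| := abs_pos.2 hx0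
  have h2 := Real.cos_le_one_sub_mul_cos_sq hx'
  have h3 : 2 / Real.pi ^ 2 * |x| ^ (2 : ℝ) ≤ 1 - Real.cos x := by
    rw [Real.rpow_two, sq_abs]; linarith
  have h4 : ENNReal.ofReal (|x| ^ (-(1 / 2) : ℝ)) = (ENNReal.ofReal (|x| ^ (2 : ℝ)))⁻¹ ^ (1 / 4 : ℝ) := by
    rw [ENNReal.inv_rpow, ENNReal.ofReal_rpow_of_pos (by positivity), ← Real.rpow_mul hxp.le,
      ← ENNReal.ofReal_inv_of_pos (by positivity), ← Real.rpow_neg hxp.le]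
    norm_num
  rw [h4, hc, ← ENNReal.mul_rpow_of_nonneg _ _ (by norm_num), ← ENNReal.mul_inv (by simp) (by simp),
    ← ENNReal.ofReal_mul (by positivity)]
  unfold sing
  gcongr

/-- A dimension-free bound for moments of the inverse gap. -/
def gapC : ℝ≥0∞ := (∫⁻ x, sing x ^ (1 / 4 : ℝ) ∂circ) ^ 256

theorem gapC_lt_top : gapC < ⊤ := ENNReal.pow_lt_top lintegral_sing_lt_top

theorem lintegral_sing_le {p : ℝ} (hp : 0 < p) (hp4 : p ≤ 1 / 4) :
    (∫⁻ x, sing x ^ p ∂circ) ^ p⁻¹ ≤ (∫⁻ x, sing x ^ (1 / 4 : ℝ) ∂circ) ^ (4 : ℝ) := by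
  have h := eLpNorm'_le_eLpNorm'_of_exponent_le hp hp4 circ measurable_sing.aestronglyMeasurable
  simp only [eLpNorm', enorm_eq_self, one_div, inv_inv] at h
  simpa using h

theorem inv_gap_le (k : Fin d → ℝ) (hd : 1 ≤ d) :
    (ENNReal.ofReal (gap k))⁻¹ ≤ ∏ j, sing (k j) ^ ((1 : ℝ) / d) := by
  have hd' : (0 : ℝ) < d := by positivity
  have h0 : ∀ j, 0 ≤ 1 - Real.cos (k j) := fun j => sub_nonneg.2 (Real.cos_le_one _)
  have h1 := Real.geom_mean_le_arith_mean_weighted Finset.univ (fun _ : Fin d => (1 : ℝ) / d)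
    (fun j => 1 - Real.cos (k j)) (fun _ _ => by positivity)
    (by simp only [Finset.sum_const, Finset.card_univ, Fintype.card_fin, nsmul_eq_mul]; field_simp)
    (fun j _ => h0 j)
  have h2 : ∑ j, (1 : ℝ) / d * (1 - Real.cos (k j)) = gap k := by
    rw [gap, ← Finset.mul_sum]; ring
  beta_reduce at h1
  rw [h2] at h1
  have h3 : ∏ j, sing (k j) ^ ((1 : ℝ) / d) =
      (ENNReal.ofReal (∏ j, (1 - Real.cos (k j)) ^ ((1 : ℝ) / d)))⁻¹ := by
    rw [ENNReal.ofReal_prod_of_nonneg fun j _ => Real.rpow_nonneg (h0 j) _,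
      ENNReal.prod_inv_distrib fun _ _ _ _ _ => Or.inr ENNReal.ofReal_ne_top]
    refine Finset.prod_congr rfl fun j _ => ?_
    rw [sing, ENNReal.inv_rpow, ENNReal.ofReal_rpow_of_nonneg (h0 j) (by positivity)]
  rw [h3]
  exact ENNReal.inv_le_inv.2 (ENNReal.ofReal_le_ofReal h1)

theorem lintegral_inv_gap_le (hd : 256 ≤ d) :
    ∫⁻ k, (ENNReal.ofReal (gap k))⁻¹ ^ 64 ∂(torus d) ≤ gapC := by
  have hd' : (256 : ℝ) ≤ d := by exact_mod_cast hd
  set p : ℝ := 64 / d with hp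
  have hp0 : 0 < p := by positivity
  have hp4 : p ≤ 1 / 4 := by rw [hp, div_le_iff₀ (by linarith)]; linarith
  have h1 : ∀ k : Fin d → ℝ, (ENNReal.ofReal (gap k))⁻¹ ^ 64 ≤ ∏ j, sing (k j) ^ p := fun k => by
    refine (pow_le_pow_left' (inv_gap_le k (by omega)) 64).trans (le_of_eq ?_)
    rw [← Finset.prod_pow]
    refine Finset.prod_congr rfl fun j _ => ?_
    rw [← ENNReal.rpow_natCast, ← ENNReal.rpow_mul, hp]
    congr 1
    push_cast
    ring
  refine (lintegral_mono h1).trans ?_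
  have hind : iIndepFun (fun (j : Fin d) (k : Fin d → ℝ) => sing (k j) ^ p) (torus d) :=
    iIndepFun_pi (X := fun _ x => sing x ^ p) fun _ => (measurable_sing.pow_const p).aemeasurable
  rw [lintegral_prod_eq_prod_lintegral_of_indepFun Finset.univ
    (fun (j : Fin d) (k : Fin d → ℝ) => sing (k j) ^ p) hind
    fun j => (measurable_sing.comp (measurable_pi_apply j)).pow_const p]
  have h2 : ∀ j : Fin d, ∫⁻ k, sing (k j) ^ p ∂(torus d) = ∫⁻ x, sing x ^ p ∂circ := fun j =>
    (measurePreserving_eval (fun _ : Fin d => circ) j).lintegral_comp (measurable_sing.pow_const p)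
  simp only [h2, Finset.prod_const, Finset.card_univ, Fintype.card_fin]
  have h3 := pow_le_pow_left' (lintegral_sing_le hp0 hp4) 64
  rw [← ENNReal.rpow_natCast, ← ENNReal.rpow_mul, ← ENNReal.rpow_natCast, ← ENNReal.rpow_mul] at h3
  have h4 : p⁻¹ * (64 : ℕ) = d := by rw [hp]; push_cast; field_simp
  rw [h4, ENNReal.rpow_natCast] at h3
  refine h3.trans (le_of_eq ?_)
  rw [gapC, ← ENNReal.rpow_natCast]
  norm_num

theorem fh_Gw {lam : ℝ} {z : ℝ≥0} (hl : 0 ≤ lam)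
    (hfin : rho (wz 0 z) (Gk lam ∅ (0 : Pt d)) ≠ ⊤) (k : Fin d → ℝ) :
    fh k (Gw d lam z 0) = ev k z (Gk lam ∅ 0) := by
  have hc := coeff_Gk_nonneg (d := d) hl
  set a : ℕ → Pt d → ℝ := fun n v => (PowerSeries.coeff n (Gk lam ∅ (0 : Pt d))).coeff v with ha
  have hG : ∀ v, Gw d lam z 0 v = ∑' n, ENNReal.ofReal (a n v * (z : ℝ) ^ n) := fun v => by
    rw [Gw_apply, S, rho]
    refine tsum_congr fun n => ?_
    rw [coeff_cX, nm_real, wz, pow_zero, one_mul, mul_comm, ENNReal.ofReal_mul (hc n v), ENNReal.ofReal_pow (NNReal.coe_nonneg z),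
      ← ofReal_norm, Real.norm_eq_abs, abs_of_nonneg (hc n v)]
    congr 2
    simp
  have ht : ∀ n (v : Pt d), 0 ≤ a n v * (z : ℝ) ^ n := fun n v =>
    mul_nonneg (hc n v) (by positivity)
  have hm : ∑' p : ℕ × Pt d, ENNReal.ofReal (a p.1 p.2 * (z : ℝ) ^ p.1) ≠ ⊤ := by
    rw [ENNReal.tsum_prod (f := fun n v => ENNReal.ofReal (a n v * (z : ℝ) ^ n)), ENNReal.tsum_comm]
    refine ne_of_eq_of_ne ?_ hfin
    rw [← mass_Gw]
    exact tsum_congr fun v => (hG v).symm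
  have hs : Summable fun p : ℕ × Pt d => a p.1 p.2 * (z : ℝ) ^ p.1 := by
    have := ENNReal.summable_toReal hm
    refine this.congr fun p => ENNReal.toReal_ofReal (ht _ _)
  have hs' : Summable fun p : ℕ × Pt d => ((a p.1 p.2 * (z : ℝ) ^ p.1 : ℝ) : ℂ) *
      chk k (.ofAdd p.2) := by
    refine Summable.of_norm (hs.congr fun p => ?_)
    rw [norm_mul, norm_chk, mul_one, Complex.norm_real, Real.norm_eq_abs, abs_of_nonneg (ht _ _)]
  have hleft : ∀ v, (((Gw d lam z 0 v).toReal : ℝ) : ℂ) * chk k (.ofAdd v) =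
      ∑' n, ((a n v * (z : ℝ) ^ n : ℝ) : ℂ) * chk k (.ofAdd v) := fun v => by
    rw [hG, ENNReal.tsum_toReal_eq fun _ => ENNReal.ofReal_ne_top, Complex.ofReal_tsum,
      ← tsum_mul_right]
    exact tsum_congr fun n => by rw [ENNReal.toReal_ofReal (ht _ _)]
  have hright : ∀ n, phk k (PowerSeries.coeff n (Gk lam ∅ (0 : Pt d))) * (z : ℂ) ^ n =
      ∑' v, ((a n v * (z : ℝ) ^ n : ℝ) : ℂ) * chk k (.ofAdd v) := fun n => by
    rw [phk_apply, tsum_eq_sum (s := (PowerSeries.coeff n (Gk lam ∅ (0 : Pt d))).coeff.support),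
      Finset.sum_mul]
    · refine Finset.sum_congr rfl fun v _ => ?_
      simp only [ha]
      push_cast
      ring
    · intro v hv
      rw [Finsupp.notMem_support_iff] at hv
      simp [ha, hv]
  rw [fh, ev, tsum_congr hleft, tsum_congr hright]
  exact (Summable.tsum_comm
    (f := fun n v => ((a n v * (z : ℝ) ^ n : ℝ) : ℂ) * chk k (.ofAdd v)) hs')

end Singularity

section Bootstrap
open MeasureTheory

variable {d : ℕ} {lam : ℝ} {z s : ℝ≥0}

theorem Small.enorm_fh_le (h : Small d lam z s) (hl : 0 ≤ lam) (hd : 1 ≤ d)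
    (hfin : rho (wz 0 z) (Gk lam ∅ (0 : Pt d)) ≠ ⊤) (k : Fin d → ℝ) :
    ‖fh k (Gw d lam z 0)‖ₑ ≤ 10 * (ENNReal.ofReal (gap k))⁻¹ := by
  have h1 := h.gap_mul_ev_le hl hd hfin k
  rw [fh_Gw hl hfin, ← div_eq_mul_inv]
  refine (ENNReal.le_div_iff_mul_le (Or.inr (by simp)) (Or.inl ENNReal.ofReal_ne_top)).2 ?_
  rw [← ofReal_norm, ← ENNReal.ofReal_mul (norm_nonneg _), mul_comm]
  exact (ENNReal.ofReal_le_ofReal h1).trans (by simp)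

theorem mul_pow_le_split (a y : ℝ≥0∞) {L b : ℝ≥0∞} (hL : L ≠ 0) (hL' : L ≠ ⊤) (hab : a ≤ b) :
    a * y ^ 32 ≤ L * a + b * L⁻¹ * y ^ 64 := by
  rcases le_total (y ^ 32) L with h | h
  · rw [mul_comm a]
    exact (mul_le_mul' h le_rfl).trans le_self_add
  · refine le_trans ?_ le_add_self
    have h1 : y ^ 32 ≤ L⁻¹ * y ^ 64 := by
      calc y ^ 32 = L⁻¹ * (L * y ^ 32) := by
            rw [← mul_assoc, ENNReal.inv_mul_cancel hL hL', one_mul]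
        _ ≤ L⁻¹ * (y ^ 32 * y ^ 32) := by gcongr
        _ = L⁻¹ * y ^ 64 := by rw [← pow_add]
    rw [mul_assoc]
    exact mul_le_mul' hab h1

theorem Small.conv_le (h : Small d lam z s) (hl : 0 ≤ lam) (hd : 256 ≤ d)
    (hfin : rho (wz 0 z) (Gk lam ∅ (0 : Pt d)) ≠ ⊤) {L : ℝ≥0∞} (hL : L ≠ 0) (hL' : L ≠ ⊤) :
    (CF.N * CF.N * Gw d lam z 0 ^ 32 : CF d) 0 ≤
      10 ^ 32 * (L * (2 * d) + (2 * d) ^ 2 * L⁻¹ * gapC) := by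
  have hG : CF.mass (Gw d lam z 0) ≠ ⊤ := by rw [mass_Gw]; exact hfin
  have hN : CF.mass (CF.N : CF d) ≠ ⊤ := by
    rw [CF.mass_N]; exact ENNReal.mul_ne_top (by simp) (by simp)
  have hNN : CF.mass (CF.N * CF.N : CF d) ≠ ⊤ := by
    rw [CF.mass_mul]; exact ENNReal.mul_ne_top hN hN
  have hF : CF.mass (CF.N * CF.N * Gw d lam z 0 ^ 32 : CF d) ≠ ⊤ := by
    rw [CF.mass_mul]; exact ENNReal.mul_ne_top hNN (CF.mass_pow_ne_top hG 32)
  have hm : Measurable fun k : Fin d → ℝ => gap k := by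
    unfold gap
    fun_prop
  refine (apply_zero_le hF).trans ?_
  have hpt : ∀ k : Fin d → ℝ, ‖fh k (CF.N * CF.N * Gw d lam z 0 ^ 32 : CF d)‖ₑ ≤
      10 ^ 32 * (L * ‖fh k (CF.N : CF d)‖ₑ ^ 2 +
        (2 * d) ^ 2 * L⁻¹ * (ENNReal.ofReal (gap k))⁻¹ ^ 64) := fun k => by
    have h1 : ‖fh k (CF.N : CF d)‖ₑ ≤ 2 * d := by
      rw [fh_N k (by omega), ← ofReal_norm, Complex.norm_real, Real.norm_eq_abs]
      have h5 := gap_nonneg k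
      have h6 := gap_le_two k
      have h7 : |1 - gap k| ≤ 1 := abs_le.2 ⟨by linarith, by linarith⟩
      refine (ENNReal.ofReal_le_ofReal (q := 2 * d) ?_).trans (by simp [ENNReal.ofReal_mul])
      rw [abs_mul, abs_of_nonneg (by positivity)]
      exact mul_le_of_le_one_right (by positivity) h7
    rw [fh_mul hNN (CF.mass_pow_ne_top hG 32), fh_mul hN hN, fh_pow hG, enorm_mul, enorm_mul,
      enorm_pow, ← sq]
    refine (mul_le_mul' le_rfl (pow_le_pow_left' (h.enorm_fh_le hl (by omega) hfin k) 32)).trans ?_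
    rw [mul_pow, mul_left_comm]
    exact mul_le_mul' le_rfl (mul_pow_le_split _ _ hL hL' (pow_le_pow_left' h1 2))
  refine (lintegral_mono hpt).trans ?_
  have hgm : Measurable fun k : Fin d → ℝ => (ENNReal.ofReal (gap k))⁻¹ ^ 64 := by fun_prop
  rw [lintegral_const_mul' _ _ (by simp), lintegral_add_right _ (hgm.const_mul _),
    lintegral_const_mul' _ _ hL', lintegral_fh_N_sq (by omega), lintegral_const_mul _ hgm]
  exact mul_le_mul' le_rfl (add_le_add le_rfl (mul_le_mul' le_rfl (lintegral_inv_gap_le hd)))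

theorem Small.bet_le (h : Small d lam z s) (hl : 0 ≤ lam) (hd : 256 ≤ d)
    (hfin : rho (wz 0 z) (Gk lam ∅ (0 : Pt d)) ≠ ⊤) {L : ℝ≥0∞} (hL : L ≠ 0) (hL' : L ≠ ⊤) :
    bet d lam z ≤ 2 ^ 30 * 10 ^ 32 * (L * (2 * d : ℝ≥0∞)⁻¹ + L⁻¹ * gapC) := by
  have hd0 : (2 * d : ℝ≥0∞) ≠ 0 := by simp; omega
  have hdt : (2 * d : ℝ≥0∞) ≠ ⊤ := ENNReal.mul_ne_top (by simp) (by simp)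
  have h1 : (CF.N * CF.N * Gw d lam z 3 ^ 4 : CF d) ≤
      CF.N * CF.N * (CF.K (gw d lam z 3 ^ 7) * Gw d lam z 0 ^ 8) ^ 4 :=
    mul_le_mul' le_rfl (pow_le_pow_left' (Gw_three_le lam z hl) 4)
  have h2 : (CF.N * CF.N * (CF.K (gw d lam z 3 ^ 7) * Gw d lam z 0 ^ 8) ^ 4 : CF d) =
      CF.K ((gw d lam z 3 ^ 7) ^ 4) * (CF.N * CF.N * Gw d lam z 0 ^ 32) := by
    rw [mul_pow, CF.K_pow]; ring
  have h3 : (gw d lam z 3 ^ 7) ^ 4 ≤ 2 ^ 28 := by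
    rw [← pow_mul]; exact pow_le_pow_left' (h.gw_le hl) 28
  have h4 : ((z : ℝ≥0∞) * (2 * d)) ^ 2 ≤ 2 ^ 2 := pow_le_pow_left' h.p_le 2
  calc bet d lam z ≤ (z : ℝ≥0∞) ^ 2 * (2 ^ 28 *
        (10 ^ 32 * (L * (2 * d) + (2 * d) ^ 2 * L⁻¹ * gapC))) := by
        refine mul_le_mul' le_rfl ((h1 0).trans ?_)
        rw [h2, CF.K_mul]
        exact mul_le_mul' h3 (h.conv_le hl hd hfin hL hL')
    _ = 2 ^ 28 * 10 ^ 32 * (((z : ℝ≥0∞) * (2 * d)) ^ 2 * (L * (2 * d : ℝ≥0∞)⁻¹ + L⁻¹ * gapC)) := by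
        have : (2 * d : ℝ≥0∞) = (2 * d) ^ 2 * (2 * d : ℝ≥0∞)⁻¹ := by
          rw [sq, mul_assoc, ENNReal.mul_inv_cancel hd0 hdt, mul_one]
        have h5 : L * (2 * d) + (2 * d) ^ 2 * L⁻¹ * gapC =
            (2 * d) ^ 2 * (L * (2 * d : ℝ≥0∞)⁻¹ + L⁻¹ * gapC) := by
          conv_lhs => enter [1, 2]; rw [this]
          ring
        rw [h5]
        ring
    _ ≤ 2 ^ 28 * 10 ^ 32 * (2 ^ 2 * (L * (2 * d : ℝ≥0∞)⁻¹ + L⁻¹ * gapC)) :=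
        mul_le_mul' le_rfl (mul_le_mul' h4 le_rfl)
    _ = _ := by ring

theorem exists_small (hl : 0 ≤ lam) : ∃ (s : ℝ≥0) (d₀ : ℕ), ∀ d, d₀ ≤ d →
    1 ≤ d ∧ ∀ z ≤ zcN d lam, Small d lam z s := by
  set s : ℝ≥0 := (1 / 1000000) / (1 + lam.toNNReal) with hs
  have hs0 : 0 < s := by positivity
  have hs1 : s ≤ 1 / 1000000 := div_le_self (by positivity) le_self_add
  have hs2 : lam.toNNReal * s ≤ 1 / 1000000 := by
    rw [hs, ← mul_div_assoc, mul_comm, mul_div_assoc]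
    refine mul_le_of_le_one_right (by positivity) (div_le_one_of_le₀ le_add_self (by positivity))
  lift gapC to ℝ≥0 using gapC_lt_top.ne with c hc
  set K : ℝ≥0 := 2 ^ 30 * 10 ^ 32 with hK
  have hK0 : 0 < K := by positivity
  set L : ℝ≥0 := 8 * K * c / s ^ 2 + 1 with hL
  have hL0 : 0 < L := by positivity
  obtain ⟨m, hm⟩ := exists_nat_ge (8 * K * L / s ^ 2)
  refine ⟨s, m + 256, fun d hd => ⟨by omega, ?_⟩⟩
  have hd1 : 1 ≤ d := by omega
  have hnum : K * (L * (2 * d : ℝ≥0)⁻¹ + L⁻¹ * c) ≤ (s / 2) ^ 2 := by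
    have hs2' : 0 < s ^ 2 := by positivity
    have hd0 : (0 : ℝ≥0) < 2 * d := by positivity
    have hdm : 8 * K * L / s ^ 2 ≤ 2 * d := by
      refine hm.trans ?_
      have : m ≤ 2 * d := by omega
      exact_mod_cast this
    have e1 : K * (L * (2 * d : ℝ≥0)⁻¹) ≤ s ^ 2 / 8 := by
      rw [div_le_iff₀ hs2'] at hdm
      rw [← mul_assoc, ← div_eq_mul_inv, div_le_iff₀ hd0, div_mul_eq_mul_div, le_div_iff₀ (by norm_num)]
      calc K * L * 8 = 8 * K * L := by ring
        _ ≤ _ := hdm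
        _ = _ := by ring
    have e2 : K * (L⁻¹ * c) ≤ s ^ 2 / 8 := by
      have h8 : 8 * K * c / s ^ 2 ≤ L := le_self_add
      rw [div_le_iff₀ hs2'] at h8
      rw [mul_left_comm, mul_comm, ← div_eq_mul_inv, div_le_iff₀ hL0, div_mul_eq_mul_div,
        le_div_iff₀ (by norm_num)]
      calc K * c * 8 = 8 * K * c := by ring
        _ ≤ _ := h8
        _ = _ := by ring
    rw [mul_add]
    refine (add_le_add e1 e2).trans (le_of_eq ?_)
    rw [← NNReal.coe_inj]
    push_cast
    ring
  have hcrit : bet d lam (zcN d lam) ≤ ((s / 2 : ℝ≥0) : ℝ≥0∞) ^ 2 := by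
    have hz0 : 0 < zcN d lam := by
      rw [← NNReal.coe_pos, coe_zcN lam hl hd1]; exact zc_pos lam hl hd1
    refine (isPS_bet lam).bootstrap (b := (s : ℝ≥0∞) ^ 2) hz0 ?_ ?_ (fun z hz => bet_lt_top hl hd1 hz) ?_
    · rw [← ENNReal.coe_pow, ← ENNReal.coe_pow, ENNReal.coe_lt_coe]
      exact pow_lt_pow_left₀ (half_lt_self hs0) zero_le two_ne_zero
    · simp [bet]
    · intro z hz hb
      have hsm : Small d lam z s := ⟨two_d_mul_le lam hl hd1 hz.le, bub_of_bet hb, hs1, hs2⟩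
      refine (hsm.bet_le hl (by omega) (rho_Gk_lt_top lam hl hd1 hz 0).ne (L := L)
        (by exact_mod_cast hL0.ne') ENNReal.coe_ne_top).trans ?_
      have hd0 : (2 * d : ℝ≥0) ≠ 0 := by positivity
      have := ENNReal.coe_le_coe.2 hnum
      rw [← hc]
      refine le_trans (le_of_eq ?_) (this.trans (le_of_eq ?_))
      · rw [hK]
        push_cast [ENNReal.coe_inv hd0, ENNReal.coe_inv hL0.ne']
        rfl
      · push_cast; rfl
  intro z hz
  refine ⟨two_d_mul_le lam hl hd1 hz, bub_of_bet (((isPS_bet lam).mono hz).trans (hcrit.trans ?_)), hs1, hs2⟩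
  rw [← ENNReal.coe_pow, ← ENNReal.coe_pow, ENNReal.coe_le_coe]
  exact pow_le_pow_left' (half_le_self zero_le) 2

end Bootstrap

section Divergence
open PowerSeries L1

theorem tsum_trunc (n : ℕ) (u a : ℕ → ℝ≥0∞) :
    ∑' m, trunc n u m * a m = ∑ m ∈ Finset.range n, u m * a m := by
  rw [tsum_eq_sum (s := Finset.range n)]
  · refine Finset.sum_congr rfl fun m hm => ?_
    rw [trunc, if_pos (Finset.mem_range.1 hm)]
  · intro m hm
    rw [trunc, if_neg (by simpa using hm), zero_mul]

theorem exists_gt_of_deriv_le {a : ℕ → ℝ≥0∞} (ha : ∀ m, a m ≠ ⊤) {z₀ L : ℝ≥0} (h0 : 0 < z₀)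
    (h : ∀ n (z : ℝ≥0), z ≤ 2 * z₀ → ∑' m, trunc n (wz 0 z) m * a m ≤ 3 →
      ∑' m, trunc n (wz 1 z) m * a m ≤ L)
    (hle : ∑' m, wz 0 z₀ m * a m ≤ 2) : ∃ z₁ > z₀, ∑' m, wz 0 z₁ m * a m ≤ 3 := by
  set f : ℕ → ℝ → ℝ := fun n z => ∑ m ∈ Finset.range n, (a m).toReal * z ^ m
  set f' : ℕ → ℝ → ℝ := fun n z => ∑ m ∈ Finset.range n, (a m).toReal * (m * z ^ (m - 1))
  have hf : ∀ n z, HasDerivAt (f n) (f' n z) z := fun n z =>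
    HasDerivAt.fun_sum fun m _ => (hasDerivAt_pow m z).const_mul _
  have hE0 : ∀ n (z : ℝ≥0), ∑' m, trunc n (wz 0 z) m * a m = ENNReal.ofReal (f n z) := by
    intro n z
    rw [tsum_trunc, ENNReal.ofReal_sum_of_nonneg fun m _ => by positivity]
    refine Finset.sum_congr rfl fun m _ => ?_
    rw [wz, pow_zero, one_mul, ENNReal.ofReal_mul ENNReal.toReal_nonneg, ENNReal.ofReal_toReal (ha m),
      ENNReal.ofReal_pow z.coe_nonneg, ENNReal.ofReal_coe_nnreal, mul_comm]
  have hE1 : ∀ n (z : ℝ≥0), ENNReal.ofReal (z * f' n z) ≤ ∑' m, trunc n (wz 1 z) m * a m := by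
    intro n z
    rw [tsum_trunc, Finset.mul_sum, ENNReal.ofReal_sum_of_nonneg fun m _ => by positivity]
    refine Finset.sum_le_sum fun m _ => ?_
    have : (z : ℝ) * ((a m).toReal * (m * (z : ℝ) ^ (m - 1))) = (a m).toReal * (m * (z : ℝ) ^ m) := by
      rcases m with _ | m
      · simp
      · rw [pow_succ]; simp; ring
    rw [this, wz, pow_one, ENNReal.ofReal_mul ENNReal.toReal_nonneg, ENNReal.ofReal_toReal (ha m),
      ENNReal.ofReal_mul (by positivity), ENNReal.ofReal_natCast,
      ENNReal.ofReal_pow z.coe_nonneg, ENNReal.ofReal_coe_nnreal, mul_comm]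
    gcongr
    exact le_add_self
  set K : ℝ := L / z₀ + 1
  have hz0 : (0 : ℝ) < z₀ := h0
  have hK : 0 < K := by positivity
  set η : ℝ≥0 := min z₀ ⟨1 / K, by positivity⟩
  have hη0 : 0 < η := lt_min h0 (by change (0 : ℝ) < 1 / K; positivity)
  have hη1 : (η : ℝ) ≤ z₀ := NNReal.coe_le_coe.2 (min_le_left _ _)
  have hη2 : (η : ℝ) ≤ 1 / K := NNReal.coe_le_coe.2 (min_le_right _ _)
  have hKη : K * η ≤ 1 := by
    rw [le_div_iff₀ hK] at hη2; linarith
  have key : ∀ n, f n (z₀ + η : ℝ) ≤ 3 := by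
    intro n
    have := image_le_of_deriv_right_lt_deriv_boundary (f := f n) (f' := f' n)
      (a := (z₀ : ℝ)) (b := z₀ + η) (fun z _ => (hf n z).continuousAt.continuousWithinAt)
      (fun z _ => (hf n z).hasDerivWithinAt) (B := fun z => 2 + K * (z - z₀)) (B' := fun _ => K) ?_
      ?_ ?_ (x := z₀ + η) ⟨by simp, le_rfl⟩
    · refine this.trans ?_
      simp only [add_sub_cancel_left]
      linarith
    · simp only [sub_self, mul_zero, add_zero]
      have h1 : ENNReal.ofReal (f n z₀) ≤ 2 := by
        rw [← hE0]
        exact (ENNReal.tsum_le_tsum fun m => mul_le_mul' (trunc_le n _ m) le_rfl).trans hle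
      rw [show (2 : ℝ≥0∞) = ENNReal.ofReal 2 by simp] at h1
      exact (ENNReal.ofReal_le_ofReal_iff (by norm_num)).1 h1
    · intro z
      have := (((hasDerivAt_id z).sub_const (z₀ : ℝ)).const_mul K).const_add 2
      simpa using this
    · intro z ⟨hz1, hz2⟩ hfz
      have hz : 0 < z := hz0.trans_le hz1
      lift z to ℝ≥0 using hz.le
      have h3 : f n z ≤ 3 := by
        rw [hfz]
        have : K * ((z : ℝ) - z₀) ≤ K * η := by gcongr; linarith
        linarith
      have h4 := (hE1 n z).trans (h n z (by
        rw [← NNReal.coe_le_coe]; push_cast; linarith) (by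
        rw [hE0]
        exact (ENNReal.ofReal_le_ofReal h3).trans (by simp)))
      rw [← ENNReal.ofReal_coe_nnreal] at h4
      have h4 := (ENNReal.ofReal_le_ofReal_iff L.coe_nonneg).1 h4
      have h5 : f' n z ≤ L / z := by rw [le_div_iff₀ hz]; linarith
      have h6 : (L : ℝ) / z ≤ L / z₀ := by gcongr
      linarith
  refine ⟨z₀ + η, lt_add_of_pos_right _ hη0, ENNReal.tsum_le_of_sum_range_le fun n => ?_⟩
  have := hE0 n (z₀ + η)
  rw [tsum_trunc] at this
  rw [this]
  push_cast
  exact (ENNReal.ofReal_le_ofReal (key n)).trans (by simp)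

variable {d : ℕ} {lam : ℝ}

theorem rho_trunc_Th (n p : ℕ) (z : ℝ≥0) (f : PowerSeries ℝ) :
    rho (trunc n (wz p z)) (Th f) = rho (trunc n (wz (p + 1) z)) f := by
  unfold rho
  refine tsum_congr fun m => ?_
  rw [trunc, trunc]
  split_ifs
  · rw [coeff_Th, nm_real, nm_real, enorm_mul]
    have : ‖(m + 1 : ℝ)‖ₑ = 1 + m := by
      rw [Real.enorm_of_nonneg (by positivity), ENNReal.ofReal_add (by positivity) (by norm_num)]
      simp [add_comm]
    rw [this, wz, wz, pow_succ]
    ring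
  · simp

theorem Th_mul_cle {f g : PowerSeries ℝ} (hf : NN f) (hg : NN g) :
    cle (Th (f * g)) (Th f * g + f * Th g) := fun n => by
  rw [coeff_Th, map_add, coeff_mul, coeff_mul, coeff_mul, Finset.mul_sum, ← Finset.sum_add_distrib]
  refine Finset.sum_le_sum fun p hp => ?_
  rw [coeff_Th, coeff_Th]
  have h1 : (n : ℝ) = p.1 + p.2 := by
    exact_mod_cast (Finset.HasAntidiagonal.mem_antidiagonal.1 hp).symm
  have h2 := mul_nonneg (hf p.1) (hg p.2)
  rw [h1]
  nlinarith

theorem Th_C_mul (a : ℝ) (f : PowerSeries ℝ) : Th (C a * f) = C a * Th f := by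
  ext n; rw [coeff_Th, coeff_C_mul, coeff_C_mul, coeff_Th]; ring

theorem Th_X_sq_mul_cle {f : PowerSeries ℝ} (hf : NN f) : cle (Th (X ^ 2 * f)) (C 3 * (X ^ 2 * Th f)) := fun n => by
  rw [coeff_Th, coeff_C_mul, coeff_X_pow_mul', coeff_X_pow_mul']
  split_ifs with h
  · rw [coeff_Th]
    obtain ⟨k, rfl⟩ := Nat.exists_eq_add_of_le h
    have := hf k
    have hk : (0 : ℝ) ≤ k := k.cast_nonneg
    simp only [Nat.add_sub_cancel_left]
    push_cast
    nlinarith [mul_nonneg hk this]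
  · simp

variable (d lam) in
/-- The weighted triangle-type diagram controlling the derivative of the diagonal series. -/
def Qd (u : ℕ → ℝ≥0∞) : ℝ≥0∞ := ENNReal.ofReal lam * ∑ e : Stp d, ∑ e' : Stp d, ∑' b : Pt d,
  rho u (X ^ 2 * (S lam ∅ (0 + stp e) b * S lam ∅ b (0 + stp e')))

theorem rho_trunc_Gk_le (hl : 0 ≤ lam) (n : ℕ) (z : ℝ≥0) :
    rho (trunc n (wz 1 z)) (Gk lam ∅ (0 : Pt d)) ≤
      rho (trunc n (wz 1 z)) (gg lam ∅ (0 : Pt d)) * rho (trunc n (wz 0 z)) (Gk lam ∅ (0 : Pt d)) ^ 2 := by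
  set u := trunc n (wz 0 z)
  have hm : ∀ F H : PowerSeries ℝ, rho u (F * H) ≤ rho u F * rho u H :=
    rho_trunc_mul_le (wz_subM 0 z) n
  set G : CF d := ⟨fun v => rho u (S lam ∅ 0 v)⟩ with hG
  have hmass : CF.mass G = rho u (Gk lam ∅ (0 : Pt d)) := by rw [rho_eq_tsum_cX]; rfl
  rw [rho_eq_tsum_cX, sq, ← hmass, ← CF.mass_mul, CF.mass, ← ENNReal.tsum_mul_left]
  refine ENNReal.tsum_le_tsum fun v => ?_
  change rho _ (S lam ∅ 0 v) ≤ _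
  rw [← rho_trunc_Th, ← rho_trunc_Th, CF.mul_apply, ← ENNReal.tsum_mul_left]
  refine (rho_Th_S_le lam hl _ _ _).trans (ENNReal.tsum_le_tsum fun b => ?_)
  refine (hm _ _).trans ?_
  calc _ ≤ rho u (S lam ∅ 0 b) * (rho u (Th (gg lam ∅ (0 : Pt d))) * rho u (S lam ∅ b v)) := by
        gcongr; exact hm _ _
    _ = rho u (Th (gg lam ∅ (0 : Pt d))) * (rho u (S lam ∅ 0 b) * rho u (S lam ∅ 0 (v - b))) := by
        rw [S_empty_sub _ b v]; ring
    _ = _ := rfl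

theorem rho_rr_le_Qd (hl : 0 ≤ lam) (u : ℕ → ℝ≥0∞) : rho u (rr lam ∅ (0 : Pt d)) ≤ Qd d lam u := by
  rw [rr, mul_assoc, rho_C_mul, Real.enorm_of_nonneg hl, Qd]
  simp only [Finset.mul_sum (R := PowerSeries ℝ)]
  refine mul_le_mul' le_rfl ?_
  refine (rho_sum_le _ _ _).trans (Finset.sum_le_sum fun e _ => (rho_sum_le _ _ _).trans
    (Finset.sum_le_sum fun e' _ => ?_))
  refine le_trans ?_ (ENNReal.le_tsum (0 + stp e))
  have hX : NN (X ^ 2 : PowerSeries ℝ) := by rw [pow_two]; exact NN_X.mul NN_X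
  refine rho_mono u (hX.mul (NN_S lam hl _ _ _)) (cle.mul_left ?_ hX)
  refine (S_anti lam hl (Finset.empty_subset _) _ _).trans ?_
  have := (one_cle_gg lam hl (Finset.notMem_empty (0 + stp e : Pt d))).mul_right
    (NN_S lam hl ∅ (0 + stp e) (0 + stp e'))
  rwa [one_mul] at this

theorem rho_Th_rr_le (hl : 0 ≤ lam) (n : ℕ) (z : ℝ≥0) :
    rho (trunc n (wz 0 z)) (Th (rr lam ∅ (0 : Pt d))) ≤
      3 * (Qd d lam (trunc n (wz 0 z)) * rho (trunc n (wz 1 z)) (gg lam ∅ (0 : Pt d))) := by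
  set u := trunc n (wz 0 z)
  have hm : ∀ F H : PowerSeries ℝ, rho u (F * H) ≤ rho u F * rho u H :=
    rho_trunc_mul_le (wz_subM 0 z) n
  have hX : NN (X ^ 2 : PowerSeries ℝ) := by rw [pow_two]; exact NN_X.mul NN_X
  rw [rr, mul_assoc, Th_C_mul, rho_C_mul, Real.enorm_of_nonneg hl, Qd]
  rw [show ∀ a b c : ℝ≥0∞, 3 * (a * b * c) = a * (b * (3 * c)) by intro a b c; ring]
  refine mul_le_mul' le_rfl ?_
  simp only [Finset.mul_sum, Finset.sum_mul, Th_sum]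
  refine (rho_sum_le _ _ _).trans (Finset.sum_le_sum fun e _ => (rho_sum_le _ _ _).trans
    (Finset.sum_le_sum fun e' _ => ?_))
  have hX2 : ∀ F : PowerSeries ℝ, rho u (X ^ 2 * F) = rho (fun m => u (m + 2)) F := fun F => by
    rw [pow_two, mul_assoc, rho_X_mul, rho_X_mul]
  calc rho u (Th (X ^ 2 * S lam (insert 0 ∅) (0 + stp e) (0 + stp e')))
      ≤ rho u (C 3 * (X ^ 2 * Th (S lam (insert 0 ∅) (0 + stp e) (0 + stp e')))) :=
        rho_mono u (hX.mul (NN_S lam hl _ _ _)).Th (Th_X_sq_mul_cle (NN_S lam hl _ _ _))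
    _ ≤ 3 * rho u (X ^ 2 * Th (S lam ∅ (0 + stp e) (0 + stp e'))) := by
        rw [rho_C_mul, Real.enorm_of_nonneg (by norm_num), ENNReal.ofReal_ofNat]
        exact mul_le_mul' le_rfl (rho_mono u (hX.mul (NN_S lam hl _ _ _).Th)
          ((S_anti lam hl (Finset.empty_subset _) _ _).Th.mul_left hX))
    _ ≤ 3 * ∑' b, rho u (X ^ 2 * (S lam ∅ (0 + stp e) b *
          (Th (gg lam ∅ (0 : Pt d)) * S lam ∅ b (0 + stp e')))) := by
        simp only [hX2]
        exact mul_le_mul' le_rfl (rho_Th_S_le lam hl _ _ _)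
    _ ≤ 3 * ∑' b, rho u (X ^ 2 * (S lam ∅ (0 + stp e) b * S lam ∅ b (0 + stp e'))) *
          rho (trunc n (wz 1 z)) (gg lam ∅ (0 : Pt d)) := by
        refine mul_le_mul' le_rfl (ENNReal.tsum_le_tsum fun b => ?_)
        rw [← rho_trunc_Th n 0]
        refine le_trans (le_of_eq (congrArg (rho u) ?_)) (hm _ _)
        ring
    _ = _ := by rw [ENNReal.tsum_mul_right]; ring

theorem rho_trunc_lt_top (n p : ℕ) (z : ℝ≥0) (f : PowerSeries ℝ) :
    rho (trunc n (wz p z)) f < ⊤ := by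
  rw [rho, tsum_trunc]
  refine ENNReal.sum_lt_top.2 fun m _ => ENNReal.mul_lt_top ?_ (by rw [nm_real]; exact enorm_lt_top)
  rw [wz]
  exact ENNReal.mul_lt_top (ENNReal.pow_lt_top (by simp)) (ENNReal.pow_lt_top ENNReal.coe_lt_top)

theorem le_of_le_one_add_mul {x a : ℝ≥0∞} (hx : x < ⊤) {c K : ℝ≥0} (h : x ≤ 1 + a * x) (ha : a ≤ c)
    (hK : 1 + c * K ≤ K) (hc : c < 1) :
    x ≤ K := by
  have h := h.trans (add_le_add le_rfl (mul_le_mul' ha le_rfl))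
  lift x to ℝ≥0 using hx.ne
  norm_cast at h ⊢
  rw [← NNReal.coe_le_coe] at h hK ⊢
  rw [← NNReal.coe_lt_coe] at hc
  push_cast at h hK hc
  nlinarith

theorem rho_trunc_gg_le (hl : 0 ≤ lam) (n : ℕ) (z : ℝ≥0)
    (hQ : Qd d lam (trunc n (wz 0 z)) ≤ ((1 / 12 : ℝ≥0) : ℝ≥0∞)) :
    rho (trunc n (wz 1 z)) (gg lam ∅ (0 : Pt d)) ≤ 2 := by
  set u := trunc n (wz 0 z) with hu
  set g := gg lam ∅ (0 : Pt d) with hg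
  set r := rr lam ∅ (0 : Pt d)
  have hm : ∀ F H : PowerSeries ℝ, rho u (F * H) ≤ rho u F * rho u H :=
    rho_trunc_mul_le (wz_subM 0 z) n
  have hr : rho u r ≤ ((1 / 12 : ℝ≥0) : ℝ≥0∞) := (rho_rr_le_Qd hl u).trans hQ
  have hren : g = 1 + r * g := gg_renewal lam (Finset.notMem_empty (0 : Pt d))
  have hone : rho u (1 : PowerSeries ℝ) ≤ 1 := by
    rw [← map_one C, rho_C_one, nm_one, mul_one]
    exact (trunc_le _ _ _).trans (wz_zero z 0).le
  have hg1 : rho u g ≤ ((12 / 11 : ℝ≥0) : ℝ≥0∞) := by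
    refine le_of_le_one_add_mul (rho_trunc_lt_top n 0 z g) (a := rho u r) (c := 1 / 12) ?_ hr ?_ ?_
    · conv_lhs => rw [hren]
      exact (rho_add_le _ _ _).trans (add_le_add hone (hm _ _))
    · rw [← NNReal.coe_le_coe]; push_cast; norm_num
    · rw [← NNReal.coe_lt_coe]; push_cast; norm_num
  have hrN : NN r := NN_rr lam hl _ _
  have hgN : NN g := NN_gg lam hl _ _
  have hT1 : Th (1 : PowerSeries ℝ) = 1 := by
    ext m; rw [coeff_Th, coeff_one]; split_ifs with h <;> simp [h]
  refine (le_of_le_one_add_mul (rho_trunc_lt_top n 1 z g)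
    (a := 3 * (((1 / 12 : ℝ≥0) : ℝ≥0∞) * ((12 / 11 : ℝ≥0) : ℝ≥0∞)) + ((1 / 12 : ℝ≥0) : ℝ≥0∞))
    (c := 1 / 2) (K := 2) ?_ ?_ ?_ ?_).trans_eq (by norm_cast)
  · calc rho (trunc n (wz 1 z)) g = rho u (Th g) := (rho_trunc_Th n 0 z g).symm
      _ = rho u (Th 1 + Th (r * g)) := by
          congr 1
          conv_lhs => rw [hren]
          ext m; simp only [coeff_Th, map_add]; ring
      _ ≤ 1 + (rho u (Th r) * rho u g + rho u r * rho u (Th g)) := by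
          refine (rho_add_le _ _ _).trans (add_le_add (by rwa [hT1]) ?_)
          exact (rho_mono u (hrN.mul hgN).Th (Th_mul_cle hrN hgN)).trans
            ((rho_add_le _ _ _).trans (add_le_add (hm _ _) (hm _ _)))
      _ ≤ 1 + ((3 * (((1 / 12 : ℝ≥0) : ℝ≥0∞) * rho (trunc n (wz 1 z)) g)) * ((12 / 11 : ℝ≥0) : ℝ≥0∞) +
          ((1 / 12 : ℝ≥0) : ℝ≥0∞) * rho (trunc n (wz 1 z)) g) := by
          rw [rho_trunc_Th n 0 z g]
          refine add_le_add le_rfl (add_le_add (mul_le_mul' ?_ hg1) (mul_le_mul' hr le_rfl))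
          exact (rho_Th_rr_le hl n z).trans (mul_le_mul' le_rfl (mul_le_mul' hQ le_rfl))
      _ = _ := by ring
  · norm_cast; rw [← NNReal.coe_le_coe]; push_cast; norm_num
  · rw [← NNReal.coe_le_coe]; push_cast; norm_num
  · rw [← NNReal.coe_lt_coe]; push_cast; norm_num

theorem Qd_eq (u : ℕ → ℝ≥0∞) : Qd d lam u = ∑' m, u m * Qd d lam (Pi.single m 1) := by
  have h : ∀ (f : PowerSeries ℝ) m, rho (Pi.single m 1) f = nm (coeff m f) := fun f m => by
    rw [rho, tsum_eq_single m]
    · simp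
    · intro k hk; rw [Pi.single_eq_of_ne hk, zero_mul]
  simp only [Qd, h]
  simp only [rho]
  rw [tsum_congr fun m => mul_left_comm _ _ _, ENNReal.tsum_mul_left]
  congr 1
  simp only [Finset.mul_sum, ← ENNReal.tsum_mul_left]
  rw [Summable.tsum_finsetSum (fun i _ => ENNReal.summable)]
  refine Finset.sum_congr rfl fun e _ => ?_
  rw [Summable.tsum_finsetSum (fun i _ => ENNReal.summable)]
  refine Finset.sum_congr rfl fun e' _ => ?_
  exact ENNReal.tsum_comm

theorem Qd_trunc_le (n : ℕ) (z : ℝ≥0) : Qd d lam (trunc n (wz 1 z)) ≤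
    ENNReal.ofReal lam * ((2 * d) ^ 2 * ((2 * z) ^ 2 * rho (trunc n (wz 1 z)) (Gk lam ∅ (0 : Pt d)) ^ 2)) := by
  set u := trunc n (wz 1 z)
  have hm : ∀ F H : PowerSeries ℝ, rho u (F * H) ≤ rho u F * rho u H :=
    rho_trunc_mul_le (wz_subM 1 z) n
  have hX : rho u (X : PowerSeries ℝ) ≤ 2 * z := by
    refine (rho_trunc_le _ _ _).trans_eq ?_
    rw [rho_wz_X, pow_one]
  have key : ∀ e e' : Stp d, ∑' b : Pt d, rho u (X ^ 2 * (S lam ∅ (0 + stp e) b * S lam ∅ b (0 + stp e'))) ≤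
      (2 * z) ^ 2 * rho u (Gk lam ∅ (0 : Pt d)) ^ 2 := by
    intro e e'
    have h1 : ∀ b : Pt d, rho u (X ^ 2 * (S lam ∅ (0 + stp e) b * S lam ∅ b (0 + stp e'))) ≤
        (2 * z) ^ 2 * rho u (Gk lam ∅ (0 : Pt d)) * rho u (S lam ∅ 0 (b - (0 + stp e))) := by
      intro b
      have h2 : rho u (S lam ∅ b (0 + stp e')) ≤ rho u (Gk lam ∅ (0 : Pt d)) := by
        rw [S_empty_sub, rho_eq_tsum_cX]
        exact ENNReal.le_tsum (f := fun v => rho u (cX v (Gk lam ∅ (0 : Pt d)))) _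
      calc _ ≤ rho u X * (rho u X * (rho u (S lam ∅ (0 + stp e) b) * rho u (S lam ∅ b (0 + stp e')))) := by
            rw [pow_two, mul_assoc]
            exact (hm _ _).trans (mul_le_mul' le_rfl ((hm _ _).trans (mul_le_mul' le_rfl (hm _ _))))
        _ ≤ (2 * z) * ((2 * z) * (rho u (S lam ∅ (0 + stp e) b) * rho u (Gk lam ∅ (0 : Pt d)))) := by gcongr
        _ = _ := by rw [S_empty_sub]; ring
    refine (ENNReal.tsum_le_tsum h1).trans (le_of_eq ?_)
    have h3 := (Equiv.subRight (0 + stp e : Pt d)).tsum_eq (fun b => rho u (S lam ∅ 0 b))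
    simp only [Equiv.subRight_apply] at h3
    rw [ENNReal.tsum_mul_left, h3, rho_eq_tsum_cX u (Gk lam ∅ 0)]
    simp only [S]
    ring
  rw [Qd]
  refine mul_le_mul' le_rfl ?_
  refine (Finset.sum_le_sum fun e _ => Finset.sum_le_sum fun e' _ => key e e').trans (le_of_eq ?_)
  have hcard : (Fintype.card (Stp d) : ℝ≥0∞) = 2 * d := by
    simp [mul_comm]
  simp only [Finset.sum_const, Finset.card_univ, nsmul_eq_mul, hcard]
  ring

theorem Small.Qd_le {z s : ℝ≥0} (h : Small d lam z s) :
    Qd d lam (wz 0 z) ≤ ((1 / 36 : ℝ≥0) : ℝ≥0∞) := by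
  refine le_trans (b := ((54 * (lam.toNNReal * s) : ℝ≥0) : ℝ≥0∞)) ?_ ?_
  · calc _ ≤ ENNReal.ofReal lam * (27 * (z ^ 2 * (CF.N * (CF.N * (Gw d lam z 3 * Gw d lam z 3)) : CF d) 0)) := by
          rw [Qd]
          refine mul_le_mul' le_rfl ?_
          rw [← mul_assoc, ← sum_Gw, Finset.mul_sum]
          refine Finset.sum_le_sum fun e _ => ?_
          rw [Finset.mul_sum]
          refine Finset.sum_le_sum fun e' _ => ?_
          rw [CF.mul_apply, ← ENNReal.tsum_mul_left]
          refine le_trans ?_ (le_of_eq ((Equiv.subRight (0 + stp e : Pt d)).tsum_eq _))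
          refine ENNReal.tsum_le_tsum fun b => ?_
          refine (rho_mono_weight (wz_mono_left z (show 0 ≤ 3 by norm_num)) _).trans ?_
          refine (rho_mul_le' (wz_subM 3 z) _ _).trans ?_
          rw [rho_wz_X_sq]
          refine mul_le_mul' le_rfl ((rho_mul_le' (wz_subM 3 z) _ _).trans ?_)
          rw [rho_S_empty, rho_S_empty]
          refine le_of_eq ?_
          simp only [Equiv.subRight_apply]
          congr 2
          abel
      _ ≤ ENNReal.ofReal lam * (27 * (2 * s)) :=
        mul_le_mul' le_rfl (mul_le_mul' le_rfl (N_iter_le h.p_le h.bub 0))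
      _ = _ := by
        rw [ENNReal.ofReal]
        push_cast; ring
  · have := h.ls_le
    norm_cast
    rw [← NNReal.coe_le_coe] at this ⊢
    push_cast at this ⊢
    linarith

theorem chi_zcN_eq_top (hl : 0 ≤ lam) (hd : 1 ≤ d) {s : ℝ≥0} (h : Small d lam (zcN d lam) s) :
    rho (wz 0 (zcN d lam)) (Gk lam ∅ (0 : Pt d)) = ⊤ := by
  by_contra hne
  set z₀ := zcN d lam with hz
  have hz0 : 0 < z₀ := by rw [← NNReal.coe_pos, coe_zcN lam hl hd]; exact zc_pos lam hl hd
  obtain ⟨M, hM⟩ : ∃ M : ℝ≥0, (M : ℝ≥0∞) = rho (wz 0 z₀) (Gk lam ∅ (0 : Pt d)) :=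
    ⟨_, ENNReal.coe_toNNReal hne⟩
  set N : ℝ≥0 := M + 1
  have hN0 : (N : ℝ≥0∞) ≠ 0 := by simp [N]
  have hNt : (N : ℝ≥0∞) ≠ ⊤ := ENNReal.coe_ne_top
  set a : ℕ → ℝ≥0∞ := fun m => nm (coeff m (Gk lam ∅ (0 : Pt d))) * (N : ℝ≥0∞)⁻¹ +
    36 * Qd d lam (Pi.single m 1)
  have hsum : ∀ u : ℕ → ℝ≥0∞, ∑' m, u m * a m =
      rho u (Gk lam ∅ (0 : Pt d)) * (N : ℝ≥0∞)⁻¹ + 36 * Qd d lam u := by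
    intro u
    rw [Qd_eq u, rho, ← ENNReal.tsum_mul_right, ← ENNReal.tsum_mul_left, ← ENNReal.tsum_add]
    refine tsum_congr fun m => ?_
    simp only [a]; ring
  have hle : ∑' m, wz 0 z₀ m * a m ≤ 2 := by
    rw [hsum, ← one_add_one_eq_two]
    refine add_le_add ?_ ?_
    · rw [← hM, ← div_eq_mul_inv, ENNReal.div_le_iff hN0 hNt, one_mul]
      exact ENNReal.coe_le_coe.2 le_self_add
    · refine (mul_le_mul' le_rfl h.Qd_le).trans (le_of_eq ?_)
      norm_cast
      rw [← NNReal.coe_inj]; push_cast; norm_num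
  have ha : ∀ m, a m ≠ ⊤ := by
    intro m hm
    have h1 := (ENNReal.le_tsum (f := fun m => wz 0 z₀ m * a m) m).trans hle
    simp only [hm] at h1
    rw [ENNReal.mul_top] at h1
    · simp at h1
    · simp [wz, hz0.ne']
  obtain ⟨z₁, hz1, h1⟩ : ∃ z₁ > z₀, ∑' m, wz 0 z₁ m * a m ≤ 3 := by
    refine exists_gt_of_deriv_le ha (L := 18 * N + 36 * (lam.toNNReal *
      ((2 * d) ^ 2 * ((2 * (2 * z₀)) ^ 2 * (18 * N ^ 2) ^ 2)))) hz0 ?_ hle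
    intro n z hz2 h3
    rw [hsum] at h3
    have hx : rho (trunc n (wz 0 z)) (Gk lam ∅ (0 : Pt d)) ≤ 3 * N := by
      have := le_self_add.trans h3
      rwa [← div_eq_mul_inv, ENNReal.div_le_iff hN0 hNt] at this
    have hq : Qd d lam (trunc n (wz 0 z)) ≤ ((1 / 12 : ℝ≥0) : ℝ≥0∞) := by
      have := le_add_self.trans h3
      rw [mul_comm, ← ENNReal.le_div_iff_mul_le (by simp) (by simp)] at this
      refine this.trans (ENNReal.div_le_of_le_mul (le_of_eq ?_))
      norm_cast
      rw [← NNReal.coe_inj]; push_cast; norm_num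
    have hG : rho (trunc n (wz 1 z)) (Gk lam ∅ (0 : Pt d)) ≤ 18 * N ^ 2 := by
      refine (rho_trunc_Gk_le hl n z).trans ((mul_le_mul' (rho_trunc_gg_le hl n z hq)
        (pow_le_pow_left' hx 2)).trans (le_of_eq ?_))
      ring
    rw [hsum]
    push_cast
    refine add_le_add ?_ (mul_le_mul' le_rfl ((Qd_trunc_le n z).trans ?_))
    · rw [← div_eq_mul_inv, ENNReal.div_le_iff hN0 hNt]
      exact hG.trans (le_of_eq (by ring))
    · rw [ENNReal.ofReal]
      gcongr
      simpa using ENNReal.coe_le_coe.2 hz2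
  rw [hsum] at h1
  have h2 : rho (wz 0 z₁) (Gk lam ∅ (0 : Pt d)) = ⊤ := by
    have := chi_eq_top lam hl hd (z := z₁) (by rw [← coe_zcN lam hl hd]; exact_mod_cast hz1) z₁.coe_nonneg
    rwa [chi_eq lam hl, Real.toNNReal_coe] at this
  rw [h2, ENNReal.top_mul (ENNReal.inv_ne_zero.2 hNt)] at h1
  simp at h1

end Divergence

section Renewal
open PowerSeries L1 Filter Topology

/-- The sum of the coefficients of a real power series. -/
def E1 (f : PowerSeries ℝ) : ℝ := ∑' n, coeff n f

/-- The series of tails of a real power series. -/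
def Tl (f : PowerSeries ℝ) : PowerSeries ℝ := PowerSeries.mk fun n => ∑' k, coeff (k + (n + 1)) f

theorem rho_zero_one (f : PowerSeries ℝ) : rho (wz 0 1) f = ∑' n, ‖coeff n f‖ₑ := by
  simp [rho, wz, nm_real]

theorem rho_wz_mono {p q : ℕ} (h : p ≤ q) (z : ℝ≥0) (f : PowerSeries ℝ) :
    rho (wz p z) f ≤ rho (wz q z) f := rho_mono_weight (wz_mono_left z h) f

theorem summable_coeff_norm {p : ℕ} {f : PowerSeries ℝ} (h : rho (wz p 1) f < ⊤) :
    Summable fun n => ‖coeff n f‖ := by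
  have h0 := (rho_wz_mono (Nat.zero_le p) 1 f).trans_lt h
  rw [rho_zero_one] at h0
  have := ENNReal.summable_toReal h0.ne
  simpa using this

theorem summable_coeff {p : ℕ} {f : PowerSeries ℝ} (h : rho (wz p 1) f < ⊤) :
    Summable fun n => coeff n f := (summable_coeff_norm h).of_norm

theorem E1_mul {f g : PowerSeries ℝ} (hf : rho (wz 0 1) f < ⊤) (hg : rho (wz 0 1) g < ⊤) :
    E1 (f * g) = E1 f * E1 g := by
  unfold E1
  rw [tsum_mul_tsum_eq_tsum_sum_antidiagonal_of_summable_norm (summable_coeff_norm hf)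
    (summable_coeff_norm hg)]
  exact tsum_congr fun n => coeff_mul _ _ _

theorem E1_add {f g : PowerSeries ℝ} (hf : rho (wz 0 1) f < ⊤) (hg : rho (wz 0 1) g < ⊤) :
    E1 (f + g) = E1 f + E1 g := by
  unfold E1
  rw [← (summable_coeff hf).tsum_add (summable_coeff hg)]
  simp

theorem E1_sub {f g : PowerSeries ℝ} (hf : rho (wz 0 1) f < ⊤) (hg : rho (wz 0 1) g < ⊤) :
    E1 (f - g) = E1 f - E1 g := by
  unfold E1
  rw [← (summable_coeff hf).tsum_sub (summable_coeff hg)]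
  simp

theorem E1_C (a : ℝ) : E1 (C a) = a := by
  unfold E1
  rw [tsum_eq_single 0]
  · simp
  · intro n hn; simp [coeff_C, hn]

theorem E1_C_mul_X (a : ℝ) : E1 (C a * X) = a := by
  unfold E1
  rw [tsum_eq_single 1]
  · simp
  · intro n hn; simp [coeff_X, hn]

theorem rho_wz_one (p : ℕ) (z : ℝ≥0) : rho (wz p z) (1 : PowerSeries ℝ) = 1 := by
  rw [← map_one C, rho_C_one, nm_one, mul_one, wz_zero]

theorem abs_E1_le {f : PowerSeries ℝ} {c : ℝ≥0} (h : rho (wz 0 1) f ≤ c) : |E1 f| ≤ c := by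
  have hs := summable_coeff_norm (h.trans_lt ENNReal.coe_lt_top)
  rw [rho_zero_one] at h
  refine (norm_tsum_le_tsum_norm hs).trans ?_
  have := ENNReal.toReal_mono ENNReal.coe_ne_top h
  rw [ENNReal.tsum_toReal_eq fun _ => enorm_ne_top] at this
  simpa using this

theorem rho_Tl_le (p : ℕ) (f : PowerSeries ℝ) : rho (wz p 1) (Tl f) ≤ rho (wz (p + 1) 1) f := by
  have h1 : ∀ n, wz p 1 n * nm (coeff n (Tl f)) ≤
      ∑' k, if n < k then wz p 1 n * ‖coeff k f‖ₑ else 0 := by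
    intro n
    rw [← ENNReal.summable.sum_add_tsum_nat_add' (k := n + 1), Finset.sum_eq_zero, zero_add,
      nm_real, Tl, coeff_mk]
    · refine (mul_le_mul' le_rfl (enorm_tsum_le_tsum_enorm)).trans ?_
      rw [← ENNReal.tsum_mul_left]
      refine ENNReal.tsum_le_tsum fun k => ?_
      rw [if_pos (by omega)]
    · intro i hi
      rw [Finset.mem_range] at hi
      rw [if_neg (by omega)]
  refine (ENNReal.tsum_le_tsum h1).trans ?_
  rw [ENNReal.tsum_comm, rho]
  refine ENNReal.tsum_le_tsum fun k => ?_
  rw [tsum_eq_sum (s := Finset.range k)]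
  · refine (Finset.sum_le_card_nsmul _ _ (wz p 1 k * ‖coeff k f‖ₑ) fun n hn => ?_).trans ?_
    · rw [Finset.mem_range] at hn
      rw [if_pos hn]
      simp only [wz, ENNReal.coe_one, one_pow, mul_one]
      gcongr
    · rw [Finset.card_range, nsmul_eq_mul, nm_real]
      simp only [wz, ENNReal.coe_one, one_pow, mul_one]
      rw [pow_succ, mul_comm _ (1 + (k : ℝ≥0∞)), mul_assoc (1 + (k : ℝ≥0∞))]
      gcongr
      exact le_add_self
  · intro n hn
    rw [if_neg (by simpa using hn)]

theorem eq_C_sub_Tl {f : PowerSeries ℝ} (h : rho (wz 0 1) f < ⊤) :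
    f = C (E1 f) - (1 - X) * Tl f := by
  have hs := summable_coeff h
  ext n
  rw [sub_mul, one_mul, map_sub, map_sub, coeff_C]
  rcases n with _ | n
  · rw [if_pos rfl, coeff_zero_X_mul, sub_zero, Tl, coeff_mk, E1, hs.tsum_eq_zero_add]
    simp
  · rw [if_neg (by omega), coeff_succ_X_mul, Tl, coeff_mk, coeff_mk,
      ((summable_nat_add_iff (n + 1)).2 hs).tsum_eq_zero_add]
    simp only [zero_add]
    have : ∀ k, k + (n + 1 + 1) = k + 1 + (n + 1) := fun k => by omega
    simp only [this]
    ring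

theorem coeff_eq_sum {f g : PowerSeries ℝ} (h : (1 - X) * f = g) (n : ℕ) :
    coeff n f = ∑ k ∈ Finset.range (n + 1), coeff k g := by
  induction n with
  | zero => rw [← h, sub_mul]; simp
  | succ n ih =>
    rw [Finset.sum_range_succ, ← ih, ← h, sub_mul, one_mul, map_sub, coeff_succ_X_mul]
    ring

theorem coeff_eq_sub_Tl {f g : PowerSeries ℝ} (h : (1 - X) * f = g) (hg : rho (wz 0 1) g < ⊤) (n : ℕ) :
    coeff n f = E1 g - coeff n (Tl g) := by
  have h1 : (1 - X) * (f + Tl g) = C (E1 g) := by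
    rw [mul_add, h]
    nth_rewrite 1 [eq_C_sub_Tl hg]
    ring
  have h2 := coeff_eq_sum h1 n
  rw [map_add, Finset.sum_eq_single 0 (fun k _ hk => by simp [coeff_C, hk]) (by simp)] at h2
  rw [coeff_zero_C] at h2
  linarith

theorem exists_inv {B : PowerSeries ℝ} {p : ℕ} {c : ℝ≥0} (hc : c < 1)
    (hB : rho (wz p 1) B ≤ c) (hX : X ∣ B) :
    ∃ V : PowerSeries ℝ, (1 + B) * V = 1 ∧ rho (wz p 1) V < ⊤ := by
  have hcc : constantCoeff (1 + B) = 1 := by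
    rw [map_add, X_dvd_iff.1 hX]; simp
  refine ⟨invOfUnit (1 + B) 1, mul_invOfUnit _ _ (by rw [hcc]; rfl), ?_⟩
  set V := invOfUnit (1 + B) 1
  have hV : V = 1 + -B * V := by
    have : (1 + B) * V = 1 := mul_invOfUnit _ _ (by rw [hcc]; rfl)
    linear_combination this
  refine (rho_le_of_trunc (K := ((1 / (1 - c) : ℝ≥0) : ℝ≥0∞)) fun n => ?_).trans_lt ENNReal.coe_lt_top
  induction n with
  | zero => rw [rho_trunc_zero]; simp
  | succ n ih =>
    rw [hV]
    calc _ ≤ rho (trunc (n + 1) (wz p 1)) (1 : PowerSeries ℝ) + rho (trunc (n + 1) (wz p 1)) (-B * V) :=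
          rho_add_le _ _ _
      _ ≤ 1 + c * ((1 / (1 - c) : ℝ≥0) : ℝ≥0∞) := by
          refine add_le_add ((rho_trunc_le _ _ _).trans (rho_wz_one p 1).le) ?_
          refine (rho_trunc_succ_mul_le (wz_subM p 1) n _ _ ((dvd_neg).2 hX)).trans ?_
          rw [rho_neg]
          exact mul_le_mul' hB ih
      _ ≤ _ := by
          norm_cast
          rw [← NNReal.coe_le_coe]
          push_cast [NNReal.coe_sub hc.le]
          have : (c : ℝ) < 1 := hc
          have h2 : (0 : ℝ) < 1 - c := by linarith
          field_simp
          linarith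

theorem rho_rescale (p : ℕ) (t : ℝ≥0) (f : PowerSeries ℝ) :
    rho (wz p 1) (rescale (t : ℝ) f) = rho (wz p t) f := by
  unfold rho
  refine tsum_congr fun n => ?_
  rw [coeff_rescale, nm_real, nm_real, enorm_mul, wz, wz, Real.enorm_of_nonneg (by positivity),
    ENNReal.ofReal_pow t.coe_nonneg, ENNReal.ofReal_coe_nnreal]
  simp [mul_assoc]

theorem rho_wz_le_one (p : ℕ) {t : ℝ≥0} (ht : t ≤ 1) (f : PowerSeries ℝ) :
    rho (wz p t) f ≤ rho (wz p 1) f := by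
  refine rho_mono_weight (fun n => ?_) f
  unfold wz
  gcongr

theorem tendsto_E1_rescale {f : PowerSeries ℝ} (h : rho (wz 0 1) f < ⊤) :
    Tendsto (fun t : ℝ => E1 (rescale t f)) (𝓝[<] 1) (𝓝 (E1 f)) := by
  have hs := summable_coeff_norm h
  have hc : ContinuousOn (fun t : ℝ => ∑' n, coeff n (rescale t f)) (Set.Icc 0 1) := by
    refine continuousOn_tsum (fun n => ?_) hs fun n t ht => ?_
    · simp only [coeff_rescale]; fun_prop
    · rw [coeff_rescale, norm_mul, norm_pow]
      refine mul_le_of_le_one_left (norm_nonneg _) (pow_le_one₀ (norm_nonneg _) ?_)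
      rw [Real.norm_of_nonneg ht.1]; exact ht.2
  have h1 := hc 1 ⟨zero_le_one, le_rfl⟩
  have h2 : 𝓝[<] (1 : ℝ) ≤ 𝓝[Set.Icc 0 1] 1 := by
    rw [nhdsWithin_le_iff]
    filter_upwards [Ioo_mem_nhdsLT (zero_lt_one' ℝ)] with t ht using ⟨ht.1.le, ht.2.le⟩
  have h3 := h1.tendsto.mono_left h2
  simp only [rescale_one, RingHom.id_apply] at h3
  exact h3

end Renewal

section RenewalAsymptotics
open PowerSeries L1 Filter Topology

theorem rho_one_sub_lt_top {p : ℕ} {a : PowerSeries ℝ} (ha : rho (wz p 1) a < ⊤) :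
    rho (wz p 1) (1 - a) < ⊤ :=
  (rho_sub_le _ _ _).trans_lt (ENNReal.add_lt_top.2 ⟨by rw [rho_wz_one]; simp, ha⟩)

theorem E1_rescale_mul {a b c : PowerSeries ℝ} (hc : c * (1 - a) = b) (ha : rho (wz 0 1) a < ⊤)
    {t : ℝ≥0} (ht : t ≤ 1) (hct : rho (wz 0 t) c < ⊤) :
    E1 (rescale (t : ℝ) c) * (1 - E1 (rescale (t : ℝ) a)) = E1 (rescale (t : ℝ) b) := by
  have h1 : rho (wz 0 1) (rescale (t : ℝ) a) < ⊤ := by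
    rw [rho_rescale]; exact (rho_wz_le_one 0 ht a).trans_lt ha
  rw [← hc, map_mul, map_sub, map_one, E1_mul (by rwa [rho_rescale]) (rho_one_sub_lt_top h1),
    E1_sub (by rw [rho_wz_one]; simp) h1, ← map_one C, E1_C]

theorem E1_eq_one {a b c : PowerSeries ℝ} (hc : c * (1 - a) = b) (ha : rho (wz 0 1) a < ⊤)
    (hb : rho (wz 0 1) b < ⊤) (hcN : NN c) (hct : ∀ t : ℝ≥0, t < 1 → rho (wz 0 t) c < ⊤)
    (hinf : rho (wz 0 1) c = ⊤) : E1 a = 1 := by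
  obtain ⟨M, hM⟩ : ∃ M : ℝ≥0, (M : ℝ≥0∞) = rho (wz 0 1) b := ⟨_, ENNReal.coe_toNNReal hb.ne⟩
  have key : ∀ N : ℕ, (∑ n ∈ Finset.range N, coeff n c) * |1 - E1 a| ≤ M := by
    intro N
    have hl : Tendsto (fun t : ℝ => (∑ n ∈ Finset.range N, t ^ n * coeff n c) *
        |1 - E1 (rescale t a)|) (𝓝[<] 1) (𝓝 ((∑ n ∈ Finset.range N, 1 ^ n * coeff n c) * |1 - E1 a|)) := by
      refine Tendsto.mul ?_ ((tendsto_E1_rescale ha).const_sub 1).abs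
      have : Continuous fun t : ℝ => ∑ n ∈ Finset.range N, t ^ n * coeff n c := by fun_prop
      exact (this.tendsto 1).mono_left nhdsWithin_le_nhds
    simp only [one_pow, one_mul] at hl
    refine le_of_tendsto hl ?_
    filter_upwards [Ioo_mem_nhdsLT (zero_lt_one' ℝ)] with t ht
    lift t to ℝ≥0 using ht.1.le
    have ht1 : t < 1 := ht.2
    have hs : Summable fun n => coeff n (rescale (t : ℝ) c) :=
      summable_coeff (p := 0) (by rw [rho_rescale]; exact hct t ht1)
    have h0 : ∀ n, 0 ≤ coeff n (rescale (t : ℝ) c) := fun n => by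
      rw [coeff_rescale]; exact mul_nonneg (by positivity) (hcN n)
    calc _ ≤ E1 (rescale (t : ℝ) c) * |1 - E1 (rescale (t : ℝ) a)| := by
          gcongr
          have := hs.sum_le_tsum (Finset.range N) fun n _ => h0 n
          simpa only [E1, coeff_rescale] using this
      _ = |E1 (rescale (t : ℝ) b)| := by
          rw [← E1_rescale_mul hc ha ht1.le (hct t ht1), abs_mul,
            abs_of_nonneg (show 0 ≤ E1 (rescale (t : ℝ) c) from tsum_nonneg h0)]
      _ ≤ M := by
          refine abs_E1_le ?_
          rw [rho_rescale, hM]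
          exact rho_wz_le_one 0 ht1.le b
  by_contra hne
  have hpos : 0 < |1 - E1 a| := abs_pos.2 (sub_ne_zero.2 (Ne.symm hne))
  have : rho (wz 0 1) c ≤ ENNReal.ofReal (M / |1 - E1 a|) := by
    rw [rho_zero_one]
    refine ENNReal.tsum_le_of_sum_range_le fun N => ?_
    rw [Finset.sum_congr rfl fun n _ => Real.enorm_of_nonneg (hcN n),
      ← ENNReal.ofReal_sum_of_nonneg fun n _ => hcN n]
    refine ENNReal.ofReal_le_ofReal ?_
    rw [le_div_iff₀ hpos]
    exact key N
  rw [hinf] at this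
  simp at this

theorem renewal_asymptotics {a b c p q : PowerSeries ℝ} {α : ℝ} (hc : c * (1 - a) = b)
    (hp : p * (1 - a) = c * q) (ha0 : constantCoeff a = 0)
    (ha : rho (wz 3 1) (a - C α * X) ≤ ((1 / 100 : ℝ≥0) : ℝ≥0∞))
    (hq : rho (wz 1 1) (q - C α * X) ≤ ((1 / 100 : ℝ≥0) : ℝ≥0∞))
    (hb : rho (wz 2 1) b < ⊤) (hcN : NN c) (hct : ∀ t : ℝ≥0, t < 1 → rho (wz 0 t) c < ⊤)
    (hinf : rho (wz 0 1) c = ⊤) :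
    ∃ A F K : ℝ, 0 < A ∧ 0 < F ∧
      Tendsto (fun t : ℝ => E1 (rescale t c) * (1 - t)) (𝓝[<] 1) (𝓝 A) ∧
      (∀ n : ℕ, (1 + n) * |coeff n c - A| ≤ K) ∧ (∀ n : ℕ, |coeff n p - F * n| ≤ K) := by
  have hαX : ∀ k, rho (wz k 1) (C α * X : PowerSeries ℝ) < ⊤ := fun k => by
    rw [rho_C_mul, rho_wz_X]
    exact ENNReal.mul_lt_top enorm_lt_top (ENNReal.mul_lt_top (by simp) (by simp))
  have hat : rho (wz 3 1) a < ⊤ := by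
    rw [← sub_add_cancel a (C α * X)]
    exact (rho_add_le _ _ _).trans_lt (ENNReal.add_lt_top.2 ⟨ha.trans_lt ENNReal.coe_lt_top, hαX 3⟩)
  have hqt : rho (wz 1 1) q < ⊤ := by
    rw [← sub_add_cancel q (C α * X)]
    exact (rho_add_le _ _ _).trans_lt (ENNReal.add_lt_top.2 ⟨hq.trans_lt ENNReal.coe_lt_top, hαX 1⟩)
  have h03 : ∀ f : PowerSeries ℝ, rho (wz 3 1) f < ⊤ → rho (wz 0 1) f < ⊤ := fun f h =>
    (rho_wz_mono (by norm_num) 1 f).trans_lt h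
  have h01 : ∀ f : PowerSeries ℝ, rho (wz 1 1) f < ⊤ → rho (wz 0 1) f < ⊤ := fun f h =>
    (rho_wz_mono (by norm_num) 1 f).trans_lt h
  have h02 : ∀ f : PowerSeries ℝ, rho (wz 2 1) f < ⊤ → rho (wz 0 1) f < ⊤ := fun f h =>
    (rho_wz_mono (by norm_num) 1 f).trans_lt h
  have h12 : ∀ f : PowerSeries ℝ, rho (wz 2 1) f < ⊤ → rho (wz 1 1) f < ⊤ := fun f h =>
    (rho_wz_mono (by norm_num) 1 f).trans_lt h
  have hmul : ∀ k (f g : PowerSeries ℝ), rho (wz k 1) f < ⊤ → rho (wz k 1) g < ⊤ →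
      rho (wz k 1) (f * g) < ⊤ := fun k f g hf hg =>
    (rho_mul_le' (wz_subM k 1) f g).trans_lt (ENNReal.mul_lt_top hf hg)
  have ha1 : E1 a = 1 := E1_eq_one hc (h03 a hat) (h02 b hb) hcN hct hinf
  have hα : |1 - α| ≤ 1 / 100 := by
    have := abs_E1_le (f := a - C α * X) (c := 1 / 100)
      ((rho_wz_mono (show 0 ≤ 3 by norm_num) 1 _).trans ha)
    rw [E1_sub (h03 a hat) (hαX 0), ha1, E1_C_mul_X] at this
    simpa using this
  -- factorisation of `1 - a`
  set B := -Tl (X - a) with hBdef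
  have hXa : rho (wz 3 1) (X - a) ≤ ((9 / 100 : ℝ≥0) : ℝ≥0∞) := by
    have : X - a = C (1 - α) * X + -(a - C α * X) := by rw [map_sub, map_one]; ring
    rw [this]
    refine (rho_add_le _ _ _).trans ?_
    rw [rho_neg, rho_C_mul, rho_wz_X]
    have h1 : ‖1 - α‖ₑ ≤ ((1 / 100 : ℝ≥0) : ℝ≥0∞) := by
      rw [Real.enorm_eq_ofReal_abs]
      refine ENNReal.ofReal_le_of_le_toReal ?_
      simpa using hα
    refine (add_le_add (mul_le_mul' h1 le_rfl) ha).trans (le_of_eq ?_)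
    norm_cast
    rw [← NNReal.coe_inj]; push_cast; norm_num
  have hXat : rho (wz 3 1) (X - a) < ⊤ := hXa.trans_lt ENNReal.coe_lt_top
  have hE1Xa : E1 (X - a) = 0 := by
    have h1 : rho (wz 0 1) (X : PowerSeries ℝ) < ⊤ := by rw [rho_wz_X]; simp
    have h2 := E1_C_mul_X 1
    rw [map_one, one_mul] at h2
    rw [E1_sub h1 (h03 a hat), h2, ha1, sub_self]
  have hfac : 1 - a = (1 - X) * (1 + B) := by
    have := eq_C_sub_Tl (h03 _ hXat)
    rw [hE1Xa, map_zero] at this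
    rw [hBdef]
    linear_combination this
  have hB2 : rho (wz 2 1) B ≤ ((9 / 100 : ℝ≥0) : ℝ≥0∞) := by
    rw [hBdef, rho_neg]; exact (rho_Tl_le 2 _).trans hXa
  have hBX : X ∣ B := by
    rw [X_dvd_iff]
    have := congrArg constantCoeff hfac
    simp [ha0] at this
    exact this
  obtain ⟨V, hV, hV2⟩ := exists_inv (by rw [← NNReal.coe_lt_coe]; push_cast; norm_num) hB2 hBX
  have hB2t : rho (wz 2 1) B < ⊤ := hB2.trans_lt ENNReal.coe_lt_top
  have h1B2 : rho (wz 2 1) (1 + B) < ⊤ :=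
    (rho_add_le _ _ _).trans_lt (ENNReal.add_lt_top.2 ⟨by rw [rho_wz_one]; simp, hB2t⟩)
  have hV1 : 0 < E1 V := by
    have h1 := E1_mul (h02 _ h1B2) (h02 _ hV2)
    have hone : E1 (1 : PowerSeries ℝ) = 1 := by rw [← map_one C, E1_C]
    rw [hV, hone, E1_add (by rw [rho_wz_one]; simp) (h02 _ hB2t), hone] at h1
    have h2 := abs_E1_le ((rho_wz_mono (show 0 ≤ 2 by norm_num) 1 _).trans hB2)
    push_cast at h2
    have h3 := (abs_le.1 h2).1
    have h4 : 0 < 1 + E1 B := by linarith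
    by_contra h5
    nlinarith
  -- asymptotics of `c`
  set E := b * V with hE
  have hE2 : rho (wz 2 1) E < ⊤ := hmul 2 _ _ hb hV2
  have hcE : (1 - X) * c = E := by
    rw [hE, ← hc, hfac]
    linear_combination (-(1 - X) * c) * hV
  have hcn := coeff_eq_sub_Tl hcE (h02 _ hE2)
  obtain ⟨K₁, hK₁⟩ : ∃ K : ℝ≥0, (K : ℝ≥0∞) = rho (wz 2 1) E := ⟨_, ENNReal.coe_toNNReal hE2.ne⟩
  have hTE : rho (wz 1 1) (Tl E) ≤ K₁ := hK₁ ▸ rho_Tl_le 1 E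
  have hcA : ∀ n : ℕ, (1 + n) * |coeff n c - E1 E| ≤ K₁ := by
    intro n
    have h1 := (ENNReal.le_tsum (f := fun n => wz 1 1 n * nm (coeff n (Tl E))) n).trans hTE
    have h2 := ENNReal.toReal_mono ENNReal.coe_ne_top h1
    rw [hcn n, sub_sub_cancel_left, abs_neg]
    simpa [wz, nm_real, ENNReal.toReal_add] using h2
  have hAbel : Tendsto (fun t : ℝ => E1 (rescale t c) * (1 - t)) (𝓝[<] 1) (𝓝 (E1 E)) := by
    refine (tendsto_E1_rescale (h02 _ hE2)).congr' ?_
    filter_upwards [Ioo_mem_nhdsLT (zero_lt_one' ℝ)] with t ht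
    lift t to ℝ≥0 using ht.1.le
    have ht1 : t < 1 := ht.2
    have hX : E1 (rescale (t : ℝ) X) = t := by
      have : rescale (t : ℝ) X = C (t : ℝ) * X := by
        ext n
        rw [coeff_rescale, coeff_C_mul, coeff_X]
        split_ifs with h <;> simp [h]
      rw [this, E1_C_mul_X]
    rw [← E1_rescale_mul (a := X) (c := c) (b := E) (by rw [← hcE, mul_comm]) (by rw [rho_wz_X]; simp)
      ht1.le (hct t ht1), hX]
  have hA0 : 0 ≤ E1 E := by
    refine ge_of_tendsto hAbel ?_
    filter_upwards [Ioo_mem_nhdsLT (zero_lt_one' ℝ)] with t ht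
    refine mul_nonneg (tsum_nonneg fun n => ?_) (by linarith [ht.2])
    rw [coeff_rescale]
    exact mul_nonneg (pow_nonneg ht.1.le n) (hcN n)
  have hA : 0 < E1 E := by
    refine lt_of_le_of_ne hA0 fun h0 => ?_
    have h1 : rho (wz 0 1) c = rho (wz 0 1) (Tl E) := by
      rw [rho_zero_one, rho_zero_one]
      refine tsum_congr fun n => ?_
      rw [hcn, ← h0, zero_sub, enorm_neg]
    rw [hinf] at h1
    exact (h01 _ (hTE.trans_lt ENNReal.coe_lt_top)).ne h1.symm
  -- asymptotics of `p`
  set F := E * q * V with hF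
  have hF1 : rho (wz 1 1) F < ⊤ := hmul 1 _ _ (hmul 1 _ _ (h12 _ hE2) hqt) (h12 _ hV2)
  have hpF : (1 - X) * ((1 - X) * p) = F := by
    rw [hF, ← hcE]
    have : p * ((1 - X) * (1 + B)) = c * q := by rw [← hfac, hp]
    linear_combination (-(1 - X) ^ 2 * p) * hV + (1 - X) * V * this
  have hq1 : 0 < E1 q := by
    have h1 := abs_E1_le ((rho_wz_mono (show 0 ≤ 1 by norm_num) 1 _).trans hq)
    rw [E1_sub (h01 _ hqt) (hαX 0), E1_C_mul_X] at h1
    push_cast at h1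
    have h2 := (abs_le.1 h1).1
    have h3 := (abs_le.1 hα).2
    linarith
  have hFpos : 0 < E1 F := by
    rw [hF, E1_mul (h01 _ (hmul 1 _ _ (h12 _ hE2) hqt)) (h02 _ hV2), E1_mul (h02 _ hE2) (h01 _ hqt)]
    positivity
  obtain ⟨K₂, hK₂⟩ : ∃ K : ℝ≥0, (K : ℝ≥0∞) = rho (wz 1 1) F := ⟨_, ENNReal.coe_toNNReal hF1.ne⟩
  have hTF : rho (wz 0 1) (Tl F) ≤ K₂ := hK₂ ▸ rho_Tl_le 0 F
  have hpn : ∀ n : ℕ, |coeff n p - E1 F * n| ≤ K₂ + E1 F := by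
    intro n
    have h1 := coeff_eq_sum (f := p) rfl n
    rw [Finset.sum_congr rfl fun k _ => coeff_eq_sub_Tl hpF (h01 _ hF1) k, Finset.sum_sub_distrib,
      Finset.sum_const, Finset.card_range, nsmul_eq_mul] at h1
    have h2 : |∑ k ∈ Finset.range (n + 1), coeff k (Tl F)| ≤ K₂ := by
      have hs := summable_coeff_norm (hTF.trans_lt ENNReal.coe_lt_top)
      refine (Finset.abs_sum_le_sum_abs _ _).trans ((hs.sum_le_tsum _ fun k _ => norm_nonneg _).trans ?_)
      rw [rho_zero_one] at hTF
      have := ENNReal.toReal_mono ENNReal.coe_ne_top hTF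
      rw [ENNReal.tsum_toReal_eq fun _ => enorm_ne_top] at this
      simpa using this
    rw [h1]
    push_cast
    calc |((n : ℝ) + 1) * E1 F - ∑ k ∈ Finset.range (n + 1), coeff k (Tl F) - E1 F * n|
        = |E1 F - ∑ k ∈ Finset.range (n + 1), coeff k (Tl F)| := by congr 1; ring
      _ ≤ |E1 F| + |∑ k ∈ Finset.range (n + 1), coeff k (Tl F)| := abs_sub _ _
      _ ≤ K₂ + E1 F := by rw [abs_of_pos hFpos]; linarith
  refine ⟨E1 E, E1 F, max K₁ (K₂ + E1 F), hA, hFpos, hAbel, fun n => (hcA n).trans (le_max_left _ _),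
    fun n => (hpn n).trans (le_max_right _ _)⟩

end RenewalAsymptotics

section Moments
open PowerSeries L1

variable {d : ℕ}

/-- The integral of a weight against an element of the lattice algebra. -/
def mom (w : Pt d → ℝ) : LA d →+ ℝ where
  toFun a := a.coeff.sum fun v c => c * w v
  map_zero' := by simp
  map_add' a b := by
    rw [AddMonoidAlgebra.coeff_add]
    exact Finsupp.sum_add_index' (by simp) (fun v b c => add_mul _ _ _)

theorem mom_apply (w : Pt d → ℝ) (a : LA d) : mom w a = ∑ v ∈ a.coeff.support, a.coeff v * w v := rfl

theorem mom_single (w : Pt d → ℝ) (v : Pt d) (c : ℝ) : mom w (AddMonoidAlgebra.single v c) = c * w v := by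
  show (Finsupp.single v c).sum (fun v c => c * w v) = _
  exact Finsupp.sum_single_index (zero_mul _)

theorem mom_mul (w : Pt d → ℝ) (a b : LA d) : mom w (a * b) =
    ∑ v ∈ a.coeff.support, ∑ u ∈ b.coeff.support, a.coeff v * b.coeff u * w (v + u) := by
  conv_lhs => rw [LA_eq_sum a, LA_eq_sum b, Finset.sum_mul_sum, map_sum]
  refine Finset.sum_congr rfl fun v _ => ?_
  rw [map_sum]
  exact Finset.sum_congr rfl fun u _ => by rw [AddMonoidAlgebra.single_mul_single, mom_single]

theorem mom_one_mul (a b : LA d) :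
    mom (fun _ => 1) (a * b) = mom (fun _ => 1) a * mom (fun _ => 1) b := by
  rw [mom_mul, mom_apply, mom_apply, Finset.sum_mul_sum]
  simp

/-- The squared Euclidean norm of a lattice point. -/
def sqn (v : Pt d) : ℝ := ∑ j, (v j : ℝ) ^ 2

theorem sqn_add (v u : Pt d) : sqn (v + u) = sqn v + sqn u + ∑ j, 2 * (v j : ℝ) * u j := by
  simp only [sqn, ← Finset.sum_add_distrib]
  refine Finset.sum_congr rfl fun j _ => ?_
  push_cast [Pi.add_apply]
  ring

theorem sqn_stp (e : Stp d) : sqn (stp e) = 1 := by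
  unfold sqn
  rw [Finset.sum_eq_single e.1]
  · rw [stp, Pi.single_eq_same]; split_ifs <;> simp
  · intro j _ hj
    rw [stp, Pi.single_eq_of_ne hj]; simp
  · simp

theorem sqn_nonneg (v : Pt d) : 0 ≤ sqn v := Finset.sum_nonneg fun _ _ => sq_nonneg _

theorem sqn_le (v : Pt d) : sqn v ≤ (dist1 0 v : ℝ) ^ 2 := by
  have h : (dist1 0 v : ℝ) = ∑ j, |(v j : ℝ)| := by
    simp only [dist1, Pi.zero_apply, zero_sub, Int.natAbs_neg, Nat.cast_sum]
    exact Finset.sum_congr rfl fun j _ => by rw [← Int.cast_abs, Int.abs_eq_natAbs, Int.cast_natCast]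
  rw [h, sqn, Finset.sum_congr rfl fun j _ => (sq_abs (v j : ℝ)).symm]
  exact Finset.sum_sq_le_sq_sum_of_nonneg fun j _ => abs_nonneg _

theorem mom_coord_of_even {b : LA d} (hb : ∀ v, b.coeff (-v) = b.coeff v) (j : Fin d) :
    mom (fun u => (u j : ℝ)) b = 0 := by
  have : mom (fun u => (u j : ℝ)) b = -mom (fun u => (u j : ℝ)) b := by
    conv_rhs => rw [mom_apply, ← Finset.sum_neg_distrib]
    rw [mom_apply]
    refine Finset.sum_equiv (Equiv.neg (Pt d)) (fun v => ?_) fun v _ => ?_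
    · simp [hb]
    · simp [hb]
  linarith

theorem mom_sqn_mul {a b : LA d} (hb : ∀ v, b.coeff (-v) = b.coeff v) :
    mom sqn (a * b) = mom sqn a * mom (fun _ => 1) b + mom (fun _ => 1) a * mom sqn b := by
  have h0 : ∑ v ∈ a.coeff.support, ∑ u ∈ b.coeff.support,
      a.coeff v * b.coeff u * ∑ j, 2 * (v j : ℝ) * u j = 0 := by
    refine Finset.sum_eq_zero fun v _ => ?_
    simp only [Finset.mul_sum]
    rw [Finset.sum_comm]
    refine Finset.sum_eq_zero fun j _ => ?_
    have := mom_coord_of_even hb j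
    rw [mom_apply] at this
    calc _ = a.coeff v * (2 * (v j : ℝ)) * ∑ u ∈ b.coeff.support, b.coeff u * (u j : ℝ) := by
          rw [Finset.mul_sum]; exact Finset.sum_congr rfl fun u _ => by ring
      _ = 0 := by rw [this, mul_zero]
  rw [mom_mul]
  simp only [sqn_add, mul_add (_ * _) (_ + _), Finset.sum_add_distrib]
  rw [h0, add_zero]
  simp only [mom_apply, Finset.sum_mul_sum, ← Finset.sum_add_distrib]
  exact Finset.sum_congr rfl fun v _ => Finset.sum_congr rfl fun u _ => by ring

theorem enorm_mom_le {w : Pt d → ℝ} {a : LA d} {M : ℝ≥0∞}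
    (h : ∀ v ∈ a.coeff.support, ‖w v‖ₑ ≤ M) : ‖mom w a‖ₑ ≤ M * tv a := by
  rw [mom_apply, tv_eq_sum, Finset.mul_sum]
  refine (enorm_sum_le _ _).trans (Finset.sum_le_sum fun v hv => ?_)
  rw [enorm_mul, mul_comm]
  exact mul_le_mul' (h v hv) le_rfl

theorem enorm_mom_one (a : LA d) (h : ∀ v, 0 ≤ a.coeff v) : ‖mom (fun _ => 1) a‖ₑ = tv a := by
  rw [mom_apply, tv_eq_sum, Real.enorm_of_nonneg (Finset.sum_nonneg fun v _ => by simpa using h v),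
    ENNReal.ofReal_sum_of_nonneg fun v _ => by simpa using h v]
  exact Finset.sum_congr rfl fun v _ => by rw [mul_one, Real.enorm_of_nonneg (h v)]

theorem integ_eq_mom {φ : Pt d → ℝ≥0∞} {w : Pt d → ℝ} (hw : ∀ v, 0 ≤ w v)
    (hφ : ∀ v, φ v = ENNReal.ofReal (w v)) {a : LA d} (ha : ∀ v, 0 ≤ a.coeff v) :
    integ φ a = ENNReal.ofReal (mom w a) := by
  rw [mom_apply, ENNReal.ofReal_sum_of_nonneg fun v _ => mul_nonneg (ha v) (hw v), integ,
    tsum_eq_sum (s := a.coeff.support)]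
  · exact Finset.sum_congr rfl fun v _ => by rw [hφ, mul_comm, ENNReal.ofReal_mul (ha v)]
  · intro v hv
    rw [Finsupp.notMem_support_iff.1 hv]; simp

theorem sqNormE_eq (v : Pt d) : sqNormE v = ENNReal.ofReal (sqn v) := by
  rw [sqNormE, sqn, ENNReal.ofReal_sum_of_nonneg fun j _ => sq_nonneg _]
  refine Finset.sum_congr rfl fun j _ => ?_
  rw [← sq_abs, ENNReal.ofReal_pow (abs_nonneg _), ← Int.cast_abs, Int.abs_eq_natAbs,
    Int.cast_natCast, ENNReal.ofReal_natCast]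

/-- Coefficientwise moments of a series over the lattice algebra. -/
def Mo (w : Pt d → ℝ) : PS d →+ PowerSeries ℝ where
  toFun F := PowerSeries.mk fun n => mom w (coeff n F)
  map_zero' := by ext; simp
  map_add' F H := by ext; simp

theorem coeff_Mo (w : Pt d → ℝ) (F : PS d) (n : ℕ) : coeff n (Mo w F) = mom w (coeff n F) := by
  simp [Mo]

theorem Mo_one_mul (F H : PS d) :
    Mo (fun _ => 1) (F * H) = Mo (fun _ => 1) F * Mo (fun _ => 1) H := by
  ext n
  rw [coeff_Mo, coeff_mul, coeff_mul, map_sum]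
  exact Finset.sum_congr rfl fun p _ => by rw [mom_one_mul, coeff_Mo, coeff_Mo]

theorem Mo_sqn_mul (F : PS d) {H : PS d} (hH : ∀ n v, (coeff n H).coeff (-v) = (coeff n H).coeff v) :
    Mo sqn (F * H) = Mo sqn F * Mo (fun _ => 1) H + Mo (fun _ => 1) F * Mo sqn H := by
  ext n
  rw [map_add, coeff_Mo, coeff_mul, coeff_mul, coeff_mul, map_sum, ← Finset.sum_add_distrib]
  exact Finset.sum_congr rfl fun p _ => by
    rw [mom_sqn_mul (hH _), coeff_Mo, coeff_Mo, coeff_Mo, coeff_Mo]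

theorem Mo_io (w : Pt d → ℝ) (f : PowerSeries ℝ) : Mo w (io d f) = C (w 0) * f := by
  ext n
  rw [coeff_Mo, coeff_io, mom_single, coeff_C_mul, mul_comm]

theorem Mo_X_mul_sum_sg {w : Pt d → ℝ} (hw : ∀ e, w (stp e) = 1) :
    Mo w (X * ∑ e : Stp d, sg (stp e)) = C (2 * (d : ℝ)) * X := by
  have h : (∑ e : Stp d, sg (stp e) : PS d) = C (∑ e : Stp d, AddMonoidAlgebra.single (stp e) (1 : ℝ)) := by
    rw [map_sum]; rfl
  rw [h]
  ext n
  rw [coeff_Mo, mul_comm X, coeff_C_mul, coeff_C_mul, coeff_X, coeff_X]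
  split_ifs with hn
  · rw [mul_one, mul_one, map_sum, Finset.sum_congr rfl fun e _ => by
      rw [mom_single, hw, mul_one], Finset.sum_const, Finset.card_univ, nsmul_eq_mul, mul_one]
    simp [mul_comm]
  · simp

theorem rho_Mo_one_le (u : ℕ → ℝ≥0∞) (F : PS d) : rho u (Mo (fun _ => 1) F) ≤ rho u F := by
  refine ENNReal.tsum_le_tsum fun n => mul_le_mul' le_rfl ?_
  rw [nm_real, coeff_Mo, nm_LA]
  exact (enorm_mom_le (M := 1) (by simp)).trans (one_mul _).le

theorem rho_Mo_one (u : ℕ → ℝ≥0∞) {F : PS d} (h : ∀ n v, 0 ≤ (coeff n F).coeff v) :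
    rho u (Mo (fun _ => 1) F) = rho u F :=
  tsum_congr fun n => by rw [nm_real, coeff_Mo, nm_LA, enorm_mom_one _ (h n)]

theorem rho_Mo_sqn_le (p : ℕ) (z : ℝ≥0) {F : PS d} (hF : Supp F) :
    rho (wz p z) (Mo sqn F) ≤ rho (wz (p + 2) z) F := by
  refine ENNReal.tsum_le_tsum fun n => ?_
  rw [nm_real, coeff_Mo, nm_LA]
  have h : ‖mom sqn (coeff n F)‖ₑ ≤ (1 + (n : ℝ≥0∞)) ^ 2 * tv (coeff n F) := by
    refine enorm_mom_le fun v hv => ?_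
    have hvn : dist1 0 v ≤ n := by
      by_contra! h
      exact Finsupp.mem_support_iff.1 hv (hF _ _ h)
    rw [Real.enorm_of_nonneg (sqn_nonneg v)]
    calc ENNReal.ofReal (sqn v) ≤ ENNReal.ofReal ((n : ℝ) ^ 2) := by
          refine ENNReal.ofReal_le_ofReal ((sqn_le v).trans ?_)
          gcongr
      _ = (n : ℝ≥0∞) ^ 2 := by
          rw [ENNReal.ofReal_pow (Nat.cast_nonneg _), ENNReal.ofReal_natCast]
      _ ≤ _ := by gcongr; exact le_add_self
  refine (mul_le_mul' le_rfl h).trans (le_of_eq ?_)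
  rw [wz, wz, pow_add]
  ring

theorem Supp_X_mul_sum_sg : Supp (X * ∑ e : Stp d, sg (stp e) : PS d) := by
  have h : (∑ e : Stp d, sg (stp e) : PS d) = C (∑ e : Stp d, AddMonoidAlgebra.single (stp e) (1 : ℝ)) := by
    rw [map_sum]; rfl
  intro n v hv
  rw [h, mul_comm X, coeff_C_mul, coeff_X]
  split_ifs with hn
  · rw [mul_one, AddMonoidAlgebra.coeff_sum, Finsupp.finsetSum_apply]
    refine Finset.sum_eq_zero fun e _ => ?_
    rw [AddMonoidAlgebra.coeff_single, Finsupp.single_apply, if_neg]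
    rintro rfl
    have := dist1_add_stp (0 : Pt d) e
    rw [zero_add] at this
    omega
  · simp

theorem Supp.sub {F H : PS d} (hF : Supp F) (hH : Supp H) : Supp (F - H) := fun n v hv => by
  rw [map_sub, AddMonoidAlgebra.coeff_sub, Finsupp.sub_apply, hF n v hv, hH n v hv, sub_zero]

variable {lam : ℝ}

theorem cN_eq_mom (hl : 0 ≤ lam) (n : ℕ) :
    cN (constLam d lam) n = ENNReal.ofReal (coeff n (Mo (fun _ => 1) (Gk lam ∅ (0 : Pt d)))) := by
  rw [cN_eq hl, coeff_Mo, coeff_Gk_empty]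
  exact integ_eq_mom (fun _ => zero_le_one) (fun _ => by simp) (W_nonneg hl _ _ _ _)

theorem msd_eq_mom (hl : 0 ≤ lam) (n : ℕ) :
    msd (constLam d lam) n = ENNReal.ofReal (coeff n (Mo sqn (Gk lam ∅ (0 : Pt d)))) := by
  rw [msd_eq hl, coeff_Mo, coeff_Gk_empty]
  exact integ_eq_mom sqn_nonneg sqNormE_eq (W_nonneg hl _ _ _ _)

theorem NN_Mo_Gk (hl : 0 ≤ lam) {w : Pt d → ℝ} (hw : ∀ v, 0 ≤ w v) :
    NN (Mo w (Gk lam ∅ (0 : Pt d))) := fun n => by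
  rw [coeff_Mo, mom_apply]
  exact Finset.sum_nonneg fun v _ => mul_nonneg (coeff_Gk_nonneg hl n v) (hw v)

end Moments

section Asymptotics
open PowerSeries L1 Filter Topology

variable {d : ℕ} {lam : ℝ}

variable (d lam) in
/-- The normalised series of walk counts. -/
def cS : PowerSeries ℝ := rescale (zcN d lam : ℝ) (Mo (fun _ => 1) (Gk lam ∅ (0 : Pt d)))

variable (d lam) in
/-- The normalised series of unnormalised mean-square displacements. -/
def pS : PowerSeries ℝ := rescale (zcN d lam : ℝ) (Mo sqn (Gk lam ∅ (0 : Pt d)))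

theorem coeff_cS (hl : 0 ≤ lam) (n : ℕ) :
    coeff n (cS d lam) = (cN (constLam d lam) n).toReal * (zcN d lam : ℝ) ^ n := by
  rw [cS, coeff_rescale, cN_eq_mom hl, ENNReal.toReal_ofReal (NN_Mo_Gk hl (fun _ => zero_le_one) n),
    mul_comm]

theorem coeff_pS (hl : 0 ≤ lam) (n : ℕ) :
    coeff n (pS d lam) = (msd (constLam d lam) n).toReal * (zcN d lam : ℝ) ^ n := by
  rw [pS, coeff_rescale, msd_eq_mom hl, ENNReal.toReal_ofReal (NN_Mo_Gk hl sqn_nonneg n), mul_comm]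

theorem rescale_C_mul_X (t a : ℝ) : rescale t (C a * X) = C (a * t) * X := by
  ext n
  rw [coeff_rescale, coeff_C_mul, coeff_C_mul, coeff_X]
  split_ifs with h <;> simp [h, mul_comm]

theorem Small.asymptotics {s : ℝ≥0} (h : Small d lam (zcN d lam) s) (hl : 0 ≤ lam) (hd : 1 ≤ d) :
    ∃ A F K : ℝ, 0 < A ∧ 0 < F ∧
      Tendsto (fun t : ℝ => E1 (rescale t (cS d lam)) * (1 - t)) (𝓝[<] 1) (𝓝 A) ∧
      (∀ n : ℕ, (1 + n) * |coeff n (cS d lam) - A| ≤ K) ∧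
      (∀ n : ℕ, |coeff n (pS d lam) - F * n| ≤ K) := by
  set ζ := zcN d lam with hζ
  have hΦ := h.phi_le hl
  have hone : ∀ w : Pt d → ℝ, w 0 = 0 → Mo w (1 : PS d) = 0 := fun w hw => by
    rw [← map_one (io d), Mo_io, hw, map_zero, zero_mul]
  have hone' : Mo (fun _ => 1) (1 : PS d) = 1 := by
    rw [← map_one (io d), Mo_io, map_one, one_mul]
  have hsq0 : sqn (0 : Pt d) = 0 := by simp [sqn]
  have heven : ∀ n v, (coeff n (1 - Phi d lam)).coeff (-v) = (coeff n (1 - Phi d lam)).coeff v := by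
    intro n v
    have h1 := congrArg (coeff n) (cX_Phi_neg lam v)
    rw [coeff_cX, coeff_cX] at h1
    rw [map_sub, AddMonoidAlgebra.coeff_sub, Finsupp.sub_apply, Finsupp.sub_apply, h1, coeff_one]
    split_ifs
    · simp [AddMonoidAlgebra.one_def, Finsupp.single_apply, eq_comm]
    · simp
  refine renewal_asymptotics (a := rescale (ζ : ℝ) (Mo (fun _ => 1) (Phi d lam)))
    (b := rescale (ζ : ℝ) (gg lam ∅ (0 : Pt d))) (q := rescale (ζ : ℝ) (Mo sqn (Phi d lam)))
    (α := 2 * d * ζ) ?_ ?_ ?_ ?_ ?_ ?_ ?_ ?_ ?_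
  · rw [cS, ← map_one (rescale (ζ : ℝ)), ← map_sub, ← map_mul, ← hone', ← map_sub, ← Mo_one_mul,
      Gk_mul_one_sub_Phi, Mo_io, map_one, one_mul]
  · rw [cS, pS, ← map_one (rescale (ζ : ℝ)), ← map_sub, ← map_mul, ← map_mul, ← hone', ← map_sub]
    congr 1
    have h1 := Mo_sqn_mul (Gk lam ∅ (0 : Pt d)) heven
    rw [Gk_mul_one_sub_Phi, Mo_io, hsq0, map_zero, zero_mul, map_sub (Mo sqn), hone _ hsq0] at h1
    linear_combination -h1
  · rw [← coeff_zero_eq_constantCoeff_apply, coeff_rescale, coeff_Mo, Phi_eq, coeff_zero_X_mul]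
    simp
  · have h1 : rescale (ζ : ℝ) (Mo (fun _ => 1) (Phi d lam)) - C (2 * d * (ζ : ℝ)) * X =
        rescale (ζ : ℝ) (Mo (fun _ => 1) (Phi d lam - X * ∑ e : Stp d, sg (stp e))) := by
      rw [map_sub, map_sub, Mo_X_mul_sum_sg fun _ => rfl, rescale_C_mul_X]
    rw [h1, rho_rescale]
    exact (rho_Mo_one_le _ _).trans hΦ
  · have h1 : rescale (ζ : ℝ) (Mo sqn (Phi d lam)) - C (2 * d * (ζ : ℝ)) * X =
        rescale (ζ : ℝ) (Mo sqn (Phi d lam - X * ∑ e : Stp d, sg (stp e))) := by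
      rw [map_sub, map_sub, Mo_X_mul_sum_sg sqn_stp, rescale_C_mul_X]
    rw [h1, rho_rescale]
    exact (rho_Mo_sqn_le 1 ζ ((Supp_Phi lam).sub Supp_X_mul_sum_sg)).trans hΦ
  · rw [rho_rescale]
    exact ((rho_wz_mono (by norm_num) ζ _).trans (h.gw_le hl)).trans_lt (by simp)
  · intro n
    rw [coeff_cS hl]
    positivity
  · intro t ht
    rw [cS, ← rho_rescale, rescale_rescale, ← NNReal.coe_mul, rho_rescale]
    refine (rho_Mo_one_le _ _).trans_lt (rho_Gk_lt_top lam hl hd ?_ 0)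
    have h0 : (0 : ℝ) < zcN d lam := by rw [coe_zcN lam hl hd]; exact zc_pos lam hl hd
    rw [← NNReal.coe_lt_coe] at ht ⊢
    push_cast at ht ⊢
    nlinarith
  · rw [cS, rho_rescale, rho_Mo_one _ (coeff_Gk_nonneg hl)]
    exact chi_zcN_eq_top hl hd h

theorem chi_toReal (hl : 0 ≤ lam) (hd : 1 ≤ d) {z : ℝ} (hz : 0 ≤ z) :
    (chi (constLam d lam) z).toReal = E1 (rescale (z / zc (constLam d lam)) (cS d lam)) := by
  have h0 := zc_pos lam hl hd
  rw [chi, ENNReal.tsum_toReal_eq fun n => by rw [cN_eq_mom hl]; exact ENNReal.mul_ne_top (by simp) (by simp), E1]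
  refine tsum_congr fun n => ?_
  rw [coeff_rescale, coeff_cS hl, coe_zcN lam hl hd, ENNReal.toReal_mul, ENNReal.toReal_pow,
    ENNReal.toReal_ofReal hz, div_pow]
  field_simp

theorem tendsto_chi_mul {A : ℝ} (hl : 0 ≤ lam) (hd : 1 ≤ d)
    (h : Tendsto (fun t : ℝ => E1 (rescale t (cS d lam)) * (1 - t)) (𝓝[<] 1) (𝓝 A)) :
    Tendsto (fun z : ℝ => (chi (constLam d lam) z).toReal * (zc (constLam d lam) - z))
      (𝓝[<] (zc (constLam d lam))) (𝓝 (A * zc (constLam d lam))) := by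
  have h0 := zc_pos lam hl hd
  set y := zc (constLam d lam)
  have h1 : Tendsto (fun z : ℝ => z / y) (𝓝[<] y) (𝓝[<] 1) := by
    refine tendsto_nhdsWithin_iff.2 ⟨?_, ?_⟩
    · have : Continuous fun z : ℝ => z / y := by fun_prop
      have h2 := this.tendsto y
      rw [div_self h0.ne'] at h2
      exact h2.mono_left nhdsWithin_le_nhds
    · filter_upwards [self_mem_nhdsWithin] with z hz
      exact (div_lt_one h0).2 hz
  refine ((h.comp h1).mul_const y).congr' ?_
  filter_upwards [Ioo_mem_nhdsLT h0] with z hz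
  rw [chi_toReal hl hd hz.1.le, Function.comp_apply, mul_assoc]
  congr 1
  field_simp

theorem abs_sub_le_rpow {u : ℕ → ℝ} {A K : ℝ} (h : ∀ n : ℕ, (1 + n) * |u n - A| ≤ K) {δ : ℝ}
    (hδ : δ < 1) : ∃ C : ℝ, ∀ n : ℕ, 1 ≤ n → |u n - A| ≤ C * (n : ℝ) ^ (-δ) := by
  refine ⟨K, fun n hn => ?_⟩
  have hn' : (1 : ℝ) ≤ n := by exact_mod_cast hn
  have hK : 0 ≤ K := le_trans (by positivity) (h 0)
  have h1 : (n : ℝ) ^ (-1 : ℝ) ≤ (n : ℝ) ^ (-δ) := Real.rpow_le_rpow_of_exponent_le hn' (by linarith)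
  rw [Real.rpow_neg_one] at h1
  refine le_trans ?_ (mul_le_mul_of_nonneg_left h1 hK)
  rw [← div_eq_mul_inv, le_div_iff₀ (by linarith)]
  have := h n
  nlinarith [abs_nonneg (u n - A)]

theorem exists_abs_div_sub_le {u p : ℕ → ℝ} {A F K : ℝ} (hA : 0 < A) (hF : 0 < F)
    (hu : ∀ n : ℕ, (1 + n) * |u n - A| ≤ K) (hp : ∀ n : ℕ, |p n - F * n| ≤ K) :
    ∃ C, 0 ≤ C ∧ ∀ n : ℕ, |p n / u n - F / A * n| ≤ C := by
  have hK : 0 ≤ K := le_trans (abs_nonneg _) (hp 0)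
  obtain ⟨N, hN⟩ := exists_nat_gt (2 * K / A)
  have hlarge : ∀ n : ℕ, N ≤ n → |p n / u n - F / A * n| ≤ (A + F) * K / (A * (A / 2)) := by
    intro n hn
    have hn' : (N : ℝ) ≤ n := by exact_mod_cast hn
    have h1 := hu n
    have h2 : |u n - A| ≤ A / 2 := by
      have h3 : 2 * K < N * A := (div_lt_iff₀ hA).1 hN
      by_contra! h4
      have h5 : (0 : ℝ) ≤ n := Nat.cast_nonneg n
      nlinarith
    have h3 : A / 2 ≤ u n := by linarith [(abs_le.1 h2).1]
    have hu0 : 0 < u n := by linarith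
    have h4 : p n / u n - F / A * n = (A * (p n - F * n) - F * (n * (u n - A))) / (A * u n) := by
      field_simp
      ring
    rw [h4, abs_div, abs_of_pos (mul_pos hA hu0)]
    have h5 : |A * (p n - F * n) - F * (n * (u n - A))| ≤ (A + F) * K := by
      refine (abs_sub _ _).trans ?_
      rw [abs_mul, abs_mul, abs_mul, abs_of_pos hA, abs_of_pos hF, Nat.abs_cast]
      have h6 := hp n
      have h7 : (n : ℝ) * |u n - A| ≤ K := by nlinarith [abs_nonneg (u n - A)]
      nlinarith
    gcongr
  refine ⟨(A + F) * K / (A * (A / 2)) + ∑ n ∈ Finset.range N, |p n / u n - F / A * n|,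
    by positivity, fun n => ?_⟩
  rcases le_or_gt N n with hn | hn
  · exact (hlarge n hn).trans (le_add_of_nonneg_right (Finset.sum_nonneg fun _ _ => abs_nonneg _))
  · refine le_trans ?_ (le_add_of_nonneg_left (by positivity))
    exact Finset.single_le_sum (f := fun n : ℕ => |p n / u n - F / A * n|) (fun _ _ => abs_nonneg _)
      (Finset.mem_range.2 hn)

theorem meanSq_eq (hl : 0 ≤ lam) (hd : 1 ≤ d) (n : ℕ) :
    meanSq (constLam d lam) n = coeff n (pS d lam) / coeff n (cS d lam) := by
  have h0 := zc_pos lam hl hd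
  rw [coeff_pS hl, coeff_cS hl, coe_zcN lam hl hd, mul_div_mul_right _ _ (pow_pos h0 n).ne', meanSq,
    ENNReal.toReal_div]

end Asymptotics

/-- **Mean-field behaviour of λ-LWW in high dimensions (constant loop weight).**
Fix `λ ≥ 0`.  There exists `d₀ = d₀(λ)` such that for every `d ≥ d₀` there are
constants `A > 0` and `D > 0` with:
(1) the susceptibility diverges linearly: `χ_λ(z)·(z_c − z) → A·z_c` as `z ↑ z_c`;
(2) for every `δ < 1`, `c_n^λ = A·z_c^{−n}·(1 + O(n^{−δ}))`;
(3) λ-LWW is diffusive: for every `δ < 1`, `⟨|ω_n|²⟩_n^λ = D·n·(1 + O(n^{−δ}))`. -/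
theorem main_theorem_constant_weight (lam : ℝ) (hlam : 0 ≤ lam) :
    ∃ d₀ : ℕ, ∀ d : ℕ, d₀ ≤ d →
      ∃ A D : ℝ, 0 < A ∧ 0 < D ∧
        (Filter.Tendsto
          (fun z : ℝ => (chi (constLam d lam) z).toReal * (zc (constLam d lam) - z))
          (nhdsWithin (zc (constLam d lam)) (Set.Iio (zc (constLam d lam))))
          (nhds (A * zc (constLam d lam)))) ∧
        (∀ δ : ℝ, δ < 1 → ∃ C : ℝ, ∀ n : ℕ, 1 ≤ n →
          |(cN (constLam d lam) n).toReal * zc (constLam d lam) ^ n - A|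
            ≤ C * (n : ℝ) ^ (-δ)) ∧
        (∀ δ : ℝ, δ < 1 → ∃ C : ℝ, ∀ n : ℕ, 1 ≤ n →
          |meanSq (constLam d lam) n - D * (n : ℝ)| ≤ C * (n : ℝ) ^ (1 - δ)) := by
  obtain ⟨s, d₀, hs⟩ := exists_small hlam
  refine ⟨d₀, fun d hd => ?_⟩
  obtain ⟨hd1, hsm⟩ := hs d hd
  obtain ⟨A, F, K, hA, hF, hlim, hc, hp⟩ := (hsm _ le_rfl).asymptotics hlam hd1
  refine ⟨A, F / A, hA, div_pos hF hA, tendsto_chi_mul hlam hd1 hlim, fun δ hδ => ?_, fun δ hδ => ?_⟩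
  · obtain ⟨C, hC⟩ := abs_sub_le_rpow hc hδ
    refine ⟨C, fun n hn => ?_⟩
    rw [← coe_zcN lam hlam hd1, ← coeff_cS hlam]
    exact hC n hn
  · obtain ⟨C, hC0, hC⟩ := exists_abs_div_sub_le hA hF hc hp
    refine ⟨C, fun n hn => ?_⟩
    rw [meanSq_eq hlam hd1]
    refine (hC n).trans (le_mul_of_one_le_right hC0 (Real.one_le_rpow ?_ (by linarith)))
    exact_mod_cast hn

end LWW
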